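/- Let P ⊂ ℝ^n be a smooth full-dimensional lattice polytope. Then P is unimodularly equivalent to a Cayley sum Cayley(R_0, …, R_t)_π of normally equivalent smooth lattice polytopes with t + 1 = cd(P) and t > n/2 if and only if Σ_F (-1)^{n - dim F} (dim F + 1)! Vol(F) = 0, the sum running over all nonempty faces F of P. -/

import Mathlib

noncomputable section

open MeasureTheory Pointwise

/-- A point of `ℝ^n` is a lattice point if all its coordinates are integers. -/
def IsLatticePt {n : ℕ} (x : Fin n → ℝ) : Prop := ∀ i, ∃ z : ℤ, x i = (z : ℝ)

/-- A lattice polytope is the convex hull of a finite set of lattice points. -/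
def IsLatticePolytope {n : ℕ} (P : Set (Fin n → ℝ)) : Prop :=
  ∃ V : Finset (Fin n → ℝ), (∀ v ∈ V, IsLatticePt v) ∧
    P = convexHull ℝ (↑V : Set (Fin n → ℝ))

/-- A rational polytope is the convex hull of a finite set of rational points. -/
def IsRatPolytope {n : ℕ} (P : Set (Fin n → ℝ)) : Prop :=
  ∃ V : Finset (Fin n → ℝ), (∀ v ∈ V, ∀ i, ∃ q : ℚ, v i = (q : ℝ)) ∧
    P = convexHull ℝ (↑V : Set (Fin n → ℝ))

/-- The vertices `0, e_1, …, e_t` of the standard unimodular simplex `Δ_t ⊆ ℝ^t`. -/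
def stdSimplexVert (t : ℕ) (k : Fin (t + 1)) : Fin t → ℝ :=
  fun j => if (k : ℕ) = (j : ℕ) + 1 then 1 else 0

/-- The standard unimodular simplex `Δ_t = conv(0, e_1, …, e_t) ⊆ ℝ^t`. -/
def unimodSimplex (t : ℕ) : Set (Fin t → ℝ) := convexHull ℝ (Set.range (stdSimplexVert t))

/-- The interior of the dilate `s • P` contains a lattice point. -/
def HasInteriorLatticePt {n : ℕ} (P : Set (Fin n → ℝ)) (s : ℕ) : Prop :=
  ∃ x ∈ interior ((s : ℝ) • P), IsLatticePt x

/-- The codegree `cd(P)`: the least positive integer `t` such that the interior of `t • P`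
contains a lattice point. -/
def codeg {n : ℕ} (P : Set (Fin n → ℝ)) : ℕ :=
  sInf {t : ℕ | 0 < t ∧ HasInteriorLatticePt P t}

/-- Pairing of an integer vector with a real vector. -/
def iprod {n : ℕ} (a : Fin n → ℤ) (x : Fin n → ℝ) : ℝ := ∑ i, (a i : ℝ) * x i

/-- An integer vector is primitive if it is nonzero and its coordinates have no common
non-unit divisor. -/
def IsPrimitive {n : ℕ} (a : Fin n → ℤ) : Prop :=
  a ≠ 0 ∧ ∀ d : ℤ, (∀ i, d ∣ a i) → IsUnit d

/-- `(a, b)` is a facet inequality of `P ⊆ ℝ^n`: `a` is a primitive integer inner normal,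
`b = min_{x ∈ P} ⟨a, x⟩`, and the corresponding face has dimension `n - 1`. -/
def IsFacetIneq {n : ℕ} (P : Set (Fin n → ℝ)) (a : Fin n → ℤ) (b : ℝ) : Prop :=
  IsPrimitive a ∧ (∀ x ∈ P, b ≤ iprod a x) ∧
  {x ∈ P | iprod a x = b}.Nonempty ∧
  Module.finrank ℝ ↥(vectorSpan ℝ {x ∈ P | iprod a x = b}) = n - 1

/-- The adjoint polytope `P^(s) = {x : ⟨a_F, x⟩ ≥ b_F + s for all facets F}`. -/
def adjointPoly {n : ℕ} (P : Set (Fin n → ℝ)) (s : ℝ) : Set (Fin n → ℝ) :=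
  {x | ∀ a b, IsFacetIneq P a b → b + s ≤ iprod a x}

/-- The set `{s > 0 : P^(s) ≠ ∅}`; the ℚ-codegree is `μ(P) = (sSup (muSet P))⁻¹`. -/
def muSet {n : ℕ} (P : Set (Fin n → ℝ)) : Set ℝ :=
  {s : ℝ | 0 < s ∧ (adjointPoly P s).Nonempty}

/-- `F` is a (nonempty, exposed) face of the polytope `P`; with `u = 0` this includes
`P` itself. -/
def IsFace {n : ℕ} (P F : Set (Fin n → ℝ)) : Prop :=
  F.Nonempty ∧ ∃ (u : (Fin n → ℝ) →ₗ[ℝ] ℝ) (c : ℝ),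
    (∀ x ∈ P, c ≤ u x) ∧ F = {x ∈ P | u x = c}

/-- The dimension of a face (or polytope): the rank of its direction vector space. -/
def fdim {n : ℕ} (F : Set (Fin n → ℝ)) : ℕ := Module.finrank ℝ ↥(vectorSpan ℝ F)

/-- `vol` is the relative lattice volume of `F`: the Lebesgue volume of the image of `F`
under an affine isomorphism of `aff F` with `ℝ^{dim F}` carrying `(aff F) ∩ ℤ^n` onto
`ℤ^{dim F}`. -/
def HasRelVol {n : ℕ} (F : Set (Fin n → ℝ)) (vol : ℝ) : Prop :=
  ∃ T : (Fin n → ℝ) →ᵃ[ℝ] (Fin (fdim F) → ℝ),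
    Set.BijOn T (affineSpan ℝ F : Set (Fin n → ℝ)) Set.univ ∧
    T '' ((affineSpan ℝ F : Set (Fin n → ℝ)) ∩ {x | IsLatticePt x}) = {y | IsLatticePt y} ∧
    vol = (volume (T '' F)).toReal

/-- The alternating face sum `Σ_F (-1)^{n - dim F} (dim F + 1)! Vol(F)`. -/
def faceSum {n : ℕ} (𝓕 : Finset (Set (Fin n → ℝ))) (volf : Set (Fin n → ℝ) → ℝ) : ℝ :=
  ∑ F ∈ 𝓕, (-1 : ℝ) ^ (n - fdim F) * (Nat.factorial (fdim F + 1) : ℝ) * volf F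

/-- The alternating sum over all nonempty faces of `P` of
`(-1)^{n - dim F} (dim F + 1)! Vol(F)` vanishes. -/
def FaceSumZero {n : ℕ} (P : Set (Fin n → ℝ)) : Prop :=
  ∃ (𝓕 : Finset (Set (Fin n → ℝ))) (volf : Set (Fin n → ℝ) → ℝ),
    (∀ F, F ∈ 𝓕 ↔ IsFace P F) ∧ (∀ F ∈ 𝓕, HasRelVol F (volf F)) ∧
    faceSum 𝓕 volf = 0

/-- A polytope `R ⊆ ℝ^n` (of dimension `d = fdim R`) is smooth: at each vertex there are
exactly `d` edges, whose primitive integer direction vectors form a ℤ-basis of the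
lattice `(vectorSpan R) ∩ ℤ^n`. -/
def IsSmoothPoly {n : ℕ} (R : Set (Fin n → ℝ)) : Prop :=
  ∀ v ∈ Set.extremePoints ℝ R,
    ∃ (w : Fin (fdim R) → (Fin n → ℤ)) (c : Fin (fdim R) → ℝ),
      (∀ i, 0 < c i) ∧ (∀ i, IsPrimitive (w i)) ∧
      LinearIndependent ℝ (fun i => ((fun j => ((w i j : ℝ))) : Fin n → ℝ)) ∧
      (∀ i, ((fun j => ((w i j : ℝ))) : Fin n → ℝ) ∈ vectorSpan ℝ R) ∧
      (∀ z : Fin n → ℤ, ((fun j => (z j : ℝ)) : Fin n → ℝ) ∈ vectorSpan ℝ R →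
        ∃ m : Fin (fdim R) → ℤ,
          ((fun j => (z j : ℝ)) : Fin n → ℝ) =
            ∑ i, (m i : ℝ) • ((fun j => ((w i j : ℝ))) : Fin n → ℝ)) ∧
      (∀ F : Set (Fin n → ℝ), (IsFace R F ∧ v ∈ F ∧ fdim F = 1) ↔
        ∃ i, F = segment ℝ v (v + c i • ((fun j => ((w i j : ℝ))) : Fin n → ℝ)))

/-- The real-linear map `ℝ^n → ℝ^t` induced by an integer matrix. -/
def matMap {t n : ℕ} (A : Matrix (Fin t) (Fin n) ℤ) : (Fin n → ℝ) → (Fin t → ℝ) :=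
  fun x k => ∑ j, (A k j : ℝ) * x j

/-- The piece `R_k = P ∩ π_ℝ^{-1}(v_k)` of a Cayley sum over the `k`-th vertex of `Δ_t`. -/
def cayleyPiece {t n : ℕ} (A : Matrix (Fin t) (Fin n) ℤ) (P : Set (Fin n → ℝ))
    (k : Fin (t + 1)) : Set (Fin n → ℝ) :=
  {x ∈ P | matMap A x = stdSimplexVert t k}

/-- Two polytopes are normally equivalent (have the same normal fan): for all linear
functionals `u, v`, the minimizing face of `u` equals that of `v` on `R` precisely when the
same holds on `S`. -/
def NormEquiv {n : ℕ} (R S : Set (Fin n → ℝ)) : Prop :=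
  ∀ u v : (Fin n → ℝ) →ₗ[ℝ] ℝ,
    ({x ∈ R | ∀ y ∈ R, u x ≤ u y} = {x ∈ R | ∀ y ∈ R, v x ≤ v y}) ↔
    ({x ∈ S | ∀ y ∈ S, u x ≤ u y} = {x ∈ S | ∀ y ∈ S, v x ≤ v y})

/-- `Q` is the Cayley sum, via the surjective lattice projection `A : ℤ^n → ℤ^t`, of the
normally equivalent polytopes `R_k = Q ∩ π_ℝ^{-1}(v_k)`: `π_ℝ` maps `Q` onto `Δ_t`. -/
def IsCayleyWith {n t : ℕ} (Q : Set (Fin n → ℝ)) (A : Matrix (Fin t) (Fin n) ℤ) : Prop :=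
  (∀ y : Fin t → ℤ, ∃ x : Fin n → ℤ, A.mulVec x = y) ∧
  matMap A '' Q = unimodSimplex t ∧
  ∀ k l : Fin (t + 1), NormEquiv (cayleyPiece A Q k) (cayleyPiece A Q l)

/-- The unimodular affine map `x ↦ Ux + w`. -/
def unimodMap {n : ℕ} (U : Matrix (Fin n) (Fin n) ℤ) (w : Fin n → ℤ) :
    (Fin n → ℝ) → (Fin n → ℝ) :=
  fun x i => (∑ j, (U i j : ℝ) * x j) + (w i : ℝ)

/-- The set `{s > 0 : P^(s) has the same normal fan as P}`; the nef value is
`τ(P) = (sSup (tauSet P))⁻¹`. -/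
def tauSet {n : ℕ} (P : Set (Fin n → ℝ)) : Set ℝ :=
  {s : ℝ | 0 < s ∧ NormEquiv (adjointPoly P s) P}

noncomputable section
open MeasureTheory Pointwise

theorem polar_zero {ι E : Type*} [Fintype ι] [DecidableEq ι] [AddCommGroup E] [Module ℝ E]
    (f : MultilinearMap ℝ (fun _ : ι => E) ℝ)
    (hsym : ∀ (x : ι → E) (ρ : Equiv.Perm ι), f (fun i => x (ρ i)) = f x)
    (hdiag : ∀ x : E, f (fun _ => x) = 0) (x : ι → E) : f x = 0 := by
  classical
  set e : Bool → ℝ := fun b => if b then 1 else 0 with he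
  set c : Bool → ℝ := fun b => if b then 1 else -1 with hc
  set W : (ι → ι) → ℝ := fun r => ∏ j, (1 - (0:ℝ) ^ (Finset.univ.filter (fun i => r i = j)).card)
    with hW
  have key : ∑ r : ι → ι, W r * f (fun i => x (r i)) = 0 := by
    have h1 : ∀ ε : ι → Bool, f (fun _ => ∑ j, e (ε j) • x j)
        = ∑ r : ι → ι, (∏ i, e (ε (r i))) * f (fun i => x (r i)) := by
      intro ε
      rw [f.map_sum (fun (_ : ι) (j : ι) => e (ε j) • x j)]
      refine Finset.sum_congr rfl fun r _ => ?_
      rw [f.map_smul_univ (fun i => e (ε (r i))) (fun i => x (r i)), smul_eq_mul]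
    have h2 : ∑ ε : ι → Bool, (∏ j, c (ε j)) * f (fun _ => ∑ j, e (ε j) • x j) = 0 := by
      simp [hdiag]
    rw [← h2]
    simp_rw [h1, Finset.mul_sum]
    rw [Finset.sum_comm]
    refine Finset.sum_congr rfl fun r _ => ?_
    simp_rw [← mul_assoc]
    rw [← Finset.sum_mul]
    congr 1
    have h3 : ∀ ε : ι → Bool, ∏ i, e (ε (r i))
        = ∏ j, e (ε j) ^ (Finset.univ.filter (fun i => r i = j)).card := by
      intro ε
      rw [← Finset.prod_fiberwise_of_maps_to (s := Finset.univ) (t := Finset.univ) (g := r)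
        (fun _ _ => Finset.mem_univ _)]
      refine Finset.prod_congr rfl fun j _ => ?_
      rw [Finset.prod_congr rfl (g := fun _ => e (ε j))]
      · simp
      · intro i hi
        simp at hi
        rw [hi]
    simp_rw [h3, ← Finset.prod_mul_distrib]
    have := Finset.prod_univ_sum (fun _ : ι => (Finset.univ : Finset Bool))
      (fun j b => c b * e b ^ (Finset.univ.filter (fun i => r i = j)).card)
    simp only [Fintype.piFinset_univ] at this
    rw [← this]
    simp only [hW]
    refine Finset.prod_congr rfl fun j _ => ?_
    simp [hc, he]
    ring
  have hterm : ∀ r : ι → ι, W r * f (fun i => x (r i)) = W r * f x := by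
    intro r
    by_cases hr : Function.Surjective r
    · have hb : Function.Bijective r := Finite.surjective_iff_bijective.mp hr
      rw [← hsym x (Equiv.ofBijective r hb)]
      rfl
    · have : W r = 0 := by
        simp only [Function.Surjective, not_forall] at hr
        obtain ⟨j, hj⟩ := hr
        apply Finset.prod_eq_zero (Finset.mem_univ j)
        have : (Finset.univ.filter (fun i => r i = j)) = ∅ := by
          ext i; simp; intro h; exact hj ⟨i, h⟩
        simp [this]
      simp [this]
  simp_rw [hterm, ← Finset.sum_mul] at key
  have hpos : 0 < ∑ r : ι → ι, W r := by
    apply Finset.sum_pos'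
    · intro r _
      apply Finset.prod_nonneg
      intro j _
      rcases Nat.eq_zero_or_pos (Finset.univ.filter (fun i => r i = j)).card with h | h
      · simp [h]
      · rw [zero_pow h.ne']; norm_num
    · refine ⟨id, Finset.mem_univ _, ?_⟩
      simp [hW, Finset.filter_eq']
  rcases mul_eq_zero.mp key with h | h
  · exact absurd h hpos.ne'
  · exact h

/-- mixed discriminant, as a multilinear map -/
def MD (O : Type*) [Fintype O] [DecidableEq O] :
    MultilinearMap ℝ (fun _ : O => Matrix O O ℝ) ℝ :=
  ∑ τ : Equiv.Perm O,
    ((Matrix.detRowAlternating (R := ℝ) (n := O)).toMultilinearMap.compLinearMap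
      (fun p => (LinearMap.proj p : (O → O → ℝ) →ₗ[ℝ] (O → ℝ)))).domDomCongr τ

section MDs
variable {O : Type*} [Fintype O] [DecidableEq O]

theorem MD_apply (X : O → Matrix O O ℝ) :
    MD O X = ∑ τ : Equiv.Perm O, Matrix.det (Matrix.of fun p => X (τ p) p) := by
  unfold MD
  rw [sum_apply]
  rfl

theorem MD_perm (X : O → Matrix O O ℝ) (ρ : Equiv.Perm O) :
    MD O (fun q => X (ρ q)) = MD O X := by
  rw [MD_apply, MD_apply]
  rw [← Equiv.sum_comp (Equiv.mulLeft ρ) (fun τ : Equiv.Perm O =>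
    Matrix.det (Matrix.of fun p => X (τ p) p))]
  rfl

theorem MD_diag (X : Matrix O O ℝ) :
    MD O (fun _ => X) = (Fintype.card O).factorial * X.det := by
  rw [MD_apply]
  have : ∀ τ : Equiv.Perm O, (Matrix.of fun p => X p) = X := fun _ => rfl
  simp [Finset.card_univ, Fintype.card_perm, this 1]

theorem MD_mul (g g' : Matrix O O ℝ) (X : O → Matrix O O ℝ) :
    MD O (fun q => g * X q * g') = g.det * g'.det * MD O X := by
  set L : Matrix O O ℝ →ₗ[ℝ] Matrix O O ℝ :=
    (LinearMap.mulRight ℝ g').comp (LinearMap.mulLeft ℝ g) with hL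
  have hLa : ∀ x, L x = g * x * g' := fun x => rfl
  have := polar_zero ((MD O).compLinearMap (fun _ => L) - (g.det * g'.det) • MD O)
    (by
      intro x ρ
      simp only [sub_apply, smul_apply,
        MultilinearMap.compLinearMap_apply]
      rw [MD_perm x ρ, MD_perm (fun q => L (x q)) ρ])
    (by
      intro x
      simp only [sub_apply, smul_apply,
        MultilinearMap.compLinearMap_apply, MD_diag, hLa, Matrix.det_mul, smul_eq_mul]
      ring) X
  simp only [sub_apply, smul_apply,
        MultilinearMap.compLinearMap_apply, hLa, smul_eq_mul] at this
  linarith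

/-- conjugation invariance -/
theorem MD_conj (g g' : Matrix O O ℝ) (h : g * g' = 1) (X : O → Matrix O O ℝ) :
    MD O (fun q => g * X q * g') = MD O X := by
  rw [MD_mul, ← Matrix.det_mul, h]; simp

def RowOnly (i : O) (X : Matrix O O ℝ) : Prop := ∀ p, p ≠ i → ∀ q, X p q = 0
def ColOK (i : O) (X : Matrix O O ℝ) : Prop := ∀ p, p ≠ i → X p i = 0

theorem MD_lemT (i : O) (X : O → Matrix O O ℝ) (hX : ∀ q, ColOK i (X q)) (q0 : O)
    (h0 : RowOnly i (X q0)) (h1 : X q0 i i = 0) : MD O X = 0 := by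
  rw [MD_apply]
  refine Finset.sum_eq_zero fun τ _ => ?_
  by_cases h : τ i = q0
  · apply Matrix.det_eq_zero_of_column_eq_zero i
    intro p
    by_cases hp : p = i
    · subst hp; simp [h, h1]
    · exact hX _ _ hp
  · apply Matrix.det_eq_zero_of_row_eq_zero (τ.symm q0)
    intro q
    simp only [Matrix.of_apply, Equiv.apply_symm_apply]
    exact h0 _ (fun hh => h (by rw [← hh]; simp)) q

theorem MD_lemR (i : O) (X : O → Matrix O O ℝ) (q0 q1 : O) (hq : q0 ≠ q1)
    (h0 : RowOnly i (X q0)) (h1 : RowOnly i (X q1)) : MD O X = 0 := by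
  rw [MD_apply]
  refine Finset.sum_eq_zero fun τ _ => ?_
  by_cases h : τ i = q0
  · apply Matrix.det_eq_zero_of_row_eq_zero (τ.symm q1)
    intro q
    simp only [Matrix.of_apply, Equiv.apply_symm_apply]
    exact h1 _ (fun hh => hq (by rw [← h, ← hh]; simp)) q
  · apply Matrix.det_eq_zero_of_row_eq_zero (τ.symm q0)
    intro q
    simp only [Matrix.of_apply, Equiv.apply_symm_apply]
    exact h0 _ (fun hh => h (by rw [← hh]; simp)) q

theorem MD_rankone (p r : O → O → ℝ) :
    MD O (fun q => Matrix.vecMulVec (p q) (r q)) =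
      Matrix.det (Matrix.of p) * Matrix.det (Matrix.of r) := by
  rw [MD_apply]
  have : ∀ τ : Equiv.Perm O,
      Matrix.det (Matrix.of fun a => Matrix.vecMulVec (p (τ a)) (r (τ a)) a)
        = (Equiv.Perm.sign τ : ℝ) * (∏ a, p (τ a) a) * Matrix.det (Matrix.of r) := by
    intro τ
    have h1 : (Matrix.of fun a => Matrix.vecMulVec (p (τ a)) (r (τ a)) a)
        = Matrix.of fun a b => p (τ a) a * (Matrix.of r).submatrix τ id a b := by
      ext a b; simp [Matrix.vecMulVec_apply]
    rw [h1, Matrix.det_mul_column, Matrix.det_permute]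
    ring
  simp_rw [this]
  rw [← Finset.sum_mul]
  congr 1
  rw [Matrix.det_apply']
  rfl

theorem MD_ones (G : Finset O) (A : O → Matrix O O ℝ)
    (hA : ∀ i ∈ G, RowOnly i (A i)) (hA1 : ∀ i ∈ G, A i i i = 1)
    (hA2 : ∀ i ∈ G, ∀ j ∈ G, ColOK i (A j)) :
    MD O (fun q => if q ∈ G then A q else 1) = (Fintype.card O - G.card).factorial := by
  rw [MD_apply]
  have hdet : ∀ τ : Equiv.Perm O,
      Matrix.det (Matrix.of fun p => (if τ p ∈ G then A (τ p) else 1 : Matrix O O ℝ) p)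
        = if ∀ q, q ∈ G → τ q = q then 1 else 0 := by
    intro τ
    split_ifs with h
    · rw [Matrix.twoBlockTriangular_det _ (fun p => p ∈ G)]
      · have e1 : (Matrix.toSquareBlockProp (Matrix.of fun p =>
            (if τ p ∈ G then A (τ p) else 1 : Matrix O O ℝ) p) (fun p => p ∈ G)) = 1 := by
          ext ⟨a, ha⟩ ⟨b, hb⟩
          simp only [Matrix.toSquareBlockProp_def, Matrix.of_apply, h a ha, if_pos ha,
            Matrix.one_apply, Subtype.mk.injEq]
          split_ifs with hab
          · subst hab; exact hA1 a ha
          · exact hA2 b hb a ha a hab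
        have e2 : (Matrix.toSquareBlockProp (Matrix.of fun p =>
            (if τ p ∈ G then A (τ p) else 1 : Matrix O O ℝ) p) (fun p => ¬ p ∈ G)) = 1 := by
          ext ⟨a, ha⟩ ⟨b, hb⟩
          have : ¬ τ a ∈ G := fun hh => ha (by
            have := h _ hh
            have := τ.injective this
            rwa [this] at hh)
          simp only [Matrix.toSquareBlockProp_def, Matrix.of_apply, if_neg this,
            Matrix.one_apply, Subtype.mk.injEq]
        rw [e1, e2]; simp
      · intro a ha b hb
        have : ¬ τ a ∈ G := fun hh => ha (by
            have := h _ hh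
            have := τ.injective this
            rwa [this] at hh)
        simp only [Matrix.of_apply, if_neg this]
        exact Matrix.one_apply_ne (fun hh => ha (hh ▸ hb))
    · push Not at h
      obtain ⟨q, hq, hne⟩ := h
      apply Matrix.det_eq_zero_of_row_eq_zero (τ.symm q)
      intro b
      simp only [Matrix.of_apply, Equiv.apply_symm_apply, if_pos hq]
      exact hA q hq _ (fun hh => hne (by conv_lhs => rw [← hh]; simp)) b
  simp_rw [hdet]
  rw [Finset.sum_boole]
  norm_cast
  rw [← Fintype.card_subtype]
  have e := Equiv.Perm.subtypeEquivSubtypePerm (fun q : O => ¬ q ∈ G)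
  have e2 : {f : Equiv.Perm O // ∀ a, ¬ ¬ a ∈ G → f a = a} ≃ {x : Equiv.Perm O // ∀ q ∈ G, x q = q} :=
    Equiv.subtypeEquivRight (fun f => by simp)
  rw [← Fintype.card_congr (e.trans e2), Fintype.card_perm, Fintype.card_subtype_compl]
  simp
end MDs

/-- the reduced mixed discriminant with one slot equal to the identity -/
def Lam (n : ℕ) : MultilinearMap ℝ (fun _ : Fin n => Matrix (Option (Fin n)) (Option (Fin n)) ℝ) ℝ :=
  MultilinearMap.mk' (fun X => MD (Option (Fin n)) (fun o => o.elim 1 X))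
    (by
      intro X i x y
      have : ∀ z, (fun o : Option (Fin n) => o.elim 1 (Function.update X i z)) =
          Function.update (fun o : Option (Fin n) => o.elim 1 X) (some i) z := by
        intro z; funext o
        cases o with
        | none => simp
        | some j =>
          by_cases h : j = i
          · subst h; simp
          · simp [h]
      rw [this, this, this, MultilinearMap.map_update_add])
    (by
      intro X i c x
      have : ∀ z, (fun o : Option (Fin n) => o.elim 1 (Function.update X i z)) =
          Function.update (fun o : Option (Fin n) => o.elim 1 X) (some i) z := by
        intro z; funext o
        cases o with
        | none => simp
        | some j =>
          by_cases h : j = i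
          · subst h; simp
          · simp [h]
      rw [this, this, MultilinearMap.map_update_smul])

theorem Lam_apply {n : ℕ} (X : Fin n → Matrix (Option (Fin n)) (Option (Fin n)) ℝ) :
    Lam n X = MD (Option (Fin n)) (fun o => o.elim 1 X) := rfl

theorem Lam_perm {n : ℕ} (X : Fin n → Matrix (Option (Fin n)) (Option (Fin n)) ℝ)
    (ρ : Equiv.Perm (Fin n)) : Lam n (fun j => X (ρ j)) = Lam n X := by
  rw [Lam_apply, Lam_apply, ← MD_perm (fun o : Option (Fin n) => o.elim 1 X) (Equiv.optionCongr ρ)]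
  congr 1
  funext o
  cases o <;> rfl

theorem Lam_conj {n : ℕ} (g g' : Matrix (Option (Fin n)) (Option (Fin n)) ℝ) (h : g * g' = 1)
    (X : Fin n → Matrix (Option (Fin n)) (Option (Fin n)) ℝ) :
    Lam n (fun j => g * X j * g') = Lam n X := by
  rw [Lam_apply, Lam_apply, ← MD_conj g g' h (fun o : Option (Fin n) => o.elim 1 X)]
  congr 1
  funext o
  cases o
  · simp [h]
  · rfl

theorem Lam_lemT {n : ℕ} (i : Fin n) (X : Fin n → Matrix (Option (Fin n)) (Option (Fin n)) ℝ)
    (hX : ∀ q, ColOK (some i) (X q)) (q0 : Fin n)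
    (h0 : RowOnly (some i) (X q0)) (h1 : X q0 (some i) (some i) = 0) : Lam n X = 0 := by
  rw [Lam_apply]
  refine MD_lemT (some i) _ ?_ (some q0) h0 h1
  intro q
  cases q with
  | none => intro p hp; exact Matrix.one_apply_ne hp
  | some q => exact hX q

theorem Lam_lemR {n : ℕ} (i : Fin n) (X : Fin n → Matrix (Option (Fin n)) (Option (Fin n)) ℝ)
    (q0 q1 : Fin n) (hq : q0 ≠ q1)
    (h0 : RowOnly (some i) (X q0)) (h1 : RowOnly (some i) (X q1)) : Lam n X = 0 := by
  rw [Lam_apply]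
  exact MD_lemR (some i) _ (some q0) (some q1) (by simpa using hq) h0 h1

/-- antisymmetrised version: an alternating map in the columns `k ↦ (j ↦ M j k)`. -/
def ALT {n : ℕ} {E : Type*} [AddCommGroup E] [Module ℝ E]
    (L : MultilinearMap ℝ (fun _ : Fin n => E) ℝ) : (Fin n → E) [⋀^Fin n]→ₗ[ℝ] ℝ :=
  (L.compLinearMap (fun j => (LinearMap.proj j : (Fin n → E) →ₗ[ℝ] E))).alternatization

def alt {n : ℕ} {E : Type*} [AddCommGroup E] [Module ℝ E]
    (L : MultilinearMap ℝ (fun _ : Fin n => E) ℝ) (M : Fin n → Fin n → E) : ℝ :=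
  ALT L (fun k j => M j k)

section alts
variable {n : ℕ} {E : Type*} [AddCommGroup E] [Module ℝ E]
    (L : MultilinearMap ℝ (fun _ : Fin n => E) ℝ)

theorem alt_apply (M : Fin n → Fin n → E) :
    alt L M = ∑ σ : Equiv.Perm (Fin n), (Equiv.Perm.sign σ : ℝ) * L (fun j => M j (σ j)) := by
  unfold alt ALT
  rw [MultilinearMap.alternatization_apply]
  refine Finset.sum_congr rfl fun σ _ => ?_
  rw [Units.smul_def, zsmul_eq_mul]
  rfl

theorem alt_rowperm (hL : ∀ (X : Fin n → E) (ρ : Equiv.Perm (Fin n)), L (fun j => X (ρ j)) = L X)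
    (M : Fin n → Fin n → E) (ρ : Equiv.Perm (Fin n)) :
    alt L (fun j k => M (ρ j) k) = Equiv.Perm.sign ρ * alt L M := by
  rw [alt_apply, alt_apply, Finset.mul_sum, ← Equiv.sum_comp (Equiv.mulRight ρ)]
  refine Finset.sum_congr rfl fun σ _ => ?_
  simp only [Equiv.coe_mulRight, Equiv.Perm.coe_mul, Function.comp]
  rw [hL (fun j => M j (σ j)) ρ, Equiv.Perm.sign_mul]
  push_cast; ring

theorem alt_colperm (M : Fin n → Fin n → E) (ρ : Equiv.Perm (Fin n)) :
    alt L (fun j k => M j (ρ k)) = Equiv.Perm.sign ρ * alt L M := by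
  unfold alt
  have := AlternatingMap.map_perm (ALT L) (fun k j => M j k) ρ
  rw [Units.smul_def, zsmul_eq_mul] at this
  exact this

theorem alt_conjperm
    (hL : ∀ (X : Fin n → E) (ρ : Equiv.Perm (Fin n)), L (fun j => X (ρ j)) = L X)
    (M : Fin n → Fin n → E) (ρ : Equiv.Perm (Fin n)) :
    alt L (fun j k => M (ρ j) (ρ k)) = alt L M := by
  rw [alt_rowperm L hL (fun j k => M j (ρ k)), alt_colperm L M ρ, ← mul_assoc]
  norm_cast
  simp

theorem alt_map (φ : E →ₗ[ℝ] E) (hφ : ∀ X : Fin n → E, L (fun j => φ (X j)) = L X)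
    (M : Fin n → Fin n → E) : alt L (fun j k => φ (M j k)) = alt L M := by
  rw [alt_apply, alt_apply]
  refine Finset.sum_congr rfl fun σ _ => ?_
  rw [hφ (fun j => M j (σ j))]

/-- Column `i` replaced by minus itself plus a combination of the others plus columns that
do not matter. -/
theorem alt_col_neg (i : Fin n) (c : Fin n → ℝ) (M : Fin n → Fin n → E) (Y : Fin n → E)
    (S : Finset (Fin n)) (hS : i ∉ S)
    (hY : alt L (fun j k => if k = i then Y j else M j k) = 0) :
    alt L (fun j k => if k = i then - M j i + ∑ l ∈ S, c l • M j l + Y j else M j k)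
      = - alt L M := by
  classical
  have key : ∀ Z : Fin n → E, alt L (fun j k => if k = i then Z j else M j k)
      = ALT L (Function.update (fun k j => M j k) i Z) := by
    intro Z
    unfold alt
    congr 1
    funext k j
    by_cases h : k = i
    · subst h; simp
    · simp [h]
  rw [key] at hY ⊢
  have e : (fun j => - M j i + ∑ l ∈ S, c l • M j l + Y j)
      = (-1 : ℝ) • (fun j => M j i) + ∑ l ∈ S, c l • (fun j => M j l) + Y := by
    funext j; simp
  rw [e, AlternatingMap.map_update_add, AlternatingMap.map_update_add,
    AlternatingMap.map_update_smul, hY]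
  have : (ALT L) (Function.update (fun k j => M j k) i (∑ l ∈ S, c l • fun j => M j l)) = 0 := by
    rw [AlternatingMap.map_update_sum]
    refine Finset.sum_eq_zero fun l hl => ?_
    rw [AlternatingMap.map_update_smul]
    have hli : i ≠ l := fun h => hS (h ▸ hl)
    rw [AlternatingMap.map_update_self (ALT L) (fun k j => M j k) hli]
    simp
  rw [this, Function.update_eq_self i (fun k j => M j k)]
  simp [alt]

end alts
end

noncomputable section
open MeasureTheory Pointwise

section stokes
variable {n : ℕ} {E : Type*} [NormedAddCommGroup E] [NormedSpace ℝ E]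
    (L : MultilinearMap ℝ (fun _ : Fin n => E) ℝ)

theorem alt_hasDerivAt (hc : Continuous L) (M : ℝ → Fin n → Fin n → E) (M' : Fin n → Fin n → E)
    (t : ℝ) (h : ∀ j k, HasDerivAt (fun t => M t j k) (M' j k) t) :
    HasDerivAt (fun t => alt L (M t)) (∑ j, alt L (Function.update (M t) j (M' j))) t := by
  have e : (∑ j, alt L (Function.update (M t) j (M' j)))
      = ∑ σ : Equiv.Perm (Fin n), (Equiv.Perm.sign σ : ℝ) *
        ∑ j, L (Function.update (fun i => M t i (σ i)) j (M' j (σ j))) := by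
    simp_rw [alt_apply, Finset.mul_sum]
    rw [Finset.sum_comm]
    refine Finset.sum_congr rfl fun σ _ => Finset.sum_congr rfl fun j _ => ?_
    congr 2
    funext i
    by_cases hij : i = j
    · subst hij; simp
    · simp [hij]
  rw [e]
  simp_rw [alt_apply]
  apply HasDerivAt.fun_sum
  intro σ _
  apply HasDerivAt.const_mul
  let Lc : ContinuousMultilinearMap ℝ (fun _ : Fin n => E) ℝ := ⟨L, hc⟩
  have h1 := (Lc.hasFDerivAt (fun i => M t i (σ i))).comp_hasDerivAt t
    (f := fun t => fun i => M t i (σ i)) (f' := fun i => M' i (σ i))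
    (hasDerivAt_pi.mpr fun i => h i (σ i))
  rw [ContinuousMultilinearMap.linearDeriv_apply] at h1
  exact h1

theorem alt_continuousOn {X : Type*} [TopologicalSpace X] (hc : Continuous L)
    (M : X → Fin n → Fin n → E) (S : Set X) (h : ∀ j k, ContinuousOn (fun x => M x j k) S) :
    ContinuousOn (fun x => alt L (M x)) S := by
  simp_rw [alt_apply]
  refine continuousOn_finsetSum _ fun σ _ => ?_
  apply ContinuousOn.mul continuousOn_const
  exact hc.comp_continuousOn (continuousOn_pi.mpr fun i => h i (σ i))

/-- partial derivative -/
def pd {F : Type*} [NormedAddCommGroup F] [NormedSpace ℝ F] (j : Fin n)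
    (f : (Fin n → ℝ) → F) (y : Fin n → ℝ) : F := fderiv ℝ f y (Pi.single j 1)

variable {F : Type*} [NormedAddCommGroup F] [NormedSpace ℝ F]

theorem pd_hasDerivAt (j : Fin n) (f : (Fin n → ℝ) → F) (y : Fin n → ℝ)
    (hf : DifferentiableAt ℝ f y) :
    HasDerivAt (fun t => f (Function.update y j t)) (pd j f y) (y j) := by
  have h1 := hasDerivAt_update y j (y j)
  have hf' : HasFDerivAt f (fderiv ℝ f y) (Function.update y j (y j)) := by
    rw [Function.update_eq_self]; exact hf.hasFDerivAt
  exact hf'.comp_hasDerivAt (y j) h1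

theorem pd_contDiffAt (j : Fin n) (f : (Fin n → ℝ) → F) (y : Fin n → ℝ)
    (hf : ContDiffAt ℝ (⊤ : ℕ∞) f y) : ContDiffAt ℝ (⊤ : ℕ∞) (pd j f) y := by
  have : ContDiffAt ℝ (⊤ : ℕ∞) (fderiv ℝ f) y := hf.fderiv_right (by simp)
  exact this.clm_apply contDiffAt_const

theorem pd_comm (i j : Fin n) (f : (Fin n → ℝ) → F) (y : Fin n → ℝ)
    (hf : ContDiffAt ℝ (⊤ : ℕ∞) f y) : pd i (pd j f) y = pd j (pd i f) y := by
  have hs : IsSymmSndFDerivAt ℝ f y := hf.isSymmSndFDerivAt (by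
    rw [minSmoothness_of_isRCLikeNormedField]
    exact (WithTop.coe_le_coe.mpr (le_top : ((2 : ℕ∞)) ≤ ⊤) :
      (((2 : ℕ∞) : WithTop ℕ∞)) ≤ ((⊤ : ℕ∞) : WithTop ℕ∞)))
  have hd : DifferentiableAt ℝ (fderiv ℝ f) y :=
    (hf.fderiv_right (m := (⊤ : ℕ∞)) (by simp)).differentiableAt (by simp)
  have key : ∀ v w : Fin n → ℝ, fderiv ℝ (fun y => fderiv ℝ f y v) y w
      = fderiv ℝ (fderiv ℝ f) y w v := by
    intro v w
    have := (hd.hasFDerivAt.clm_apply (hasFDerivAt_const v y)).fderiv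
    rw [this]; simp
  unfold pd
  rw [key, key]
  exact hs _ _

structure TileFns (n : ℕ) (E : Type*) [NormedAddCommGroup E] [NormedSpace ℝ E] where
  A : Fin n → (Fin n → ℝ) → E
  m : Fin n → (Fin n → ℝ) → E
  U : Set (Fin n → ℝ)
  hU : IsOpen U
  hA : ∀ k, ∀ y ∈ U, ContDiffAt ℝ (⊤ : ℕ∞) (A k) y
  hm : ∀ k, ∀ y ∈ U, ContDiffAt ℝ (⊤ : ℕ∞) (m k) y

namespace TileFns
variable (D : TileFns n E)

def N (k : Fin n) (y : Fin n → ℝ) : E := D.A k y - D.m k y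

theorem hN (k : Fin n) (y) (hy : y ∈ D.U) : ContDiffAt ℝ (⊤ : ℕ∞) (D.N k) y :=
  (D.hA k y hy).sub (D.hm k y hy)

def Mrow (s : ℝ) (G : Finset (Fin n)) (y : Fin n → ℝ) (j k : Fin n) : E :=
  if j ∈ G then (if k = j then D.A j y else 0) else pd j (D.m k) y + s • pd j (D.N k) y

/-- derivative of row `i` of `Mrow` in direction `j` -/
def Rrow (s : ℝ) (G : Finset (Fin n)) (y : Fin n → ℝ) (j i k : Fin n) : E :=
  if i ∈ G then (if k = i then pd j (D.A i) y else 0)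
  else pd j (pd i (D.m k)) y + s • pd j (pd i (D.N k)) y

def FF (s : ℝ) (G : Finset (Fin n)) (y : Fin n → ℝ) : ℝ := alt L (D.Mrow s G y)

def WW (s : ℝ) (G : Finset (Fin n)) (j : Fin n) (y : Fin n → ℝ) : ℝ :=
  alt L (Function.update (D.Mrow s G y) j (fun k => D.N k y))

def dW (s : ℝ) (G : Finset (Fin n)) (j : Fin n) (y : Fin n → ℝ) : ℝ :=
  alt L (Function.update (D.Mrow s G y) j (fun k => pd j (D.N k) y)) +
  ∑ i ∈ Finset.univ.erase j, alt L (Function.update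
    (Function.update (D.Mrow s G y) j (fun k => D.N k y)) i (D.Rrow s G y j i))

def dF (s : ℝ) (G : Finset (Fin n)) (y : Fin n → ℝ) : ℝ :=
  ∑ j ∈ Gᶜ, alt L (Function.update (D.Mrow s G y) j (fun k => pd j (D.N k) y))

theorem FF_hasDerivAt (hc : Continuous L) (s : ℝ) (G : Finset (Fin n)) (y : Fin n → ℝ) :
    HasDerivAt (fun s => D.FF L s G y) (D.dF L s G y) s := by
  have := alt_hasDerivAt L hc (fun s => D.Mrow s G y)
    (fun j k => if j ∈ G then 0 else pd j (D.N k) y) s (by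
      intro j k
      unfold Mrow
      split_ifs
      · exact hasDerivAt_const _ _
      · exact hasDerivAt_const _ _
      · simpa using ((hasDerivAt_id s).smul_const (pd j (D.N k) y)).const_add (pd j (D.m k) y))
  refine HasDerivAt.congr_deriv this ?_
  symm
  unfold dF
  rw [← Finset.sum_compl_add_sum G]
  have h0 : ∑ j ∈ G, alt L (Function.update (D.Mrow s G y) j
      ((fun j k => if j ∈ G then 0 else pd j (D.N k) y) j)) = 0 := by
    refine Finset.sum_eq_zero fun j hj => ?_
    simp only [hj, if_true]
    rw [alt_apply]
    refine Finset.sum_eq_zero fun σ _ => ?_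
    rw [L.map_coord_zero j]
    · simp
    · simp
  rw [h0, add_zero]
  refine Finset.sum_congr rfl fun j hj => ?_
  simp only [Finset.mem_compl] at hj
  simp [hj]

theorem Mrow_hasDerivAt (s : ℝ) (G : Finset (Fin n)) (y : Fin n → ℝ) (hy : y ∈ D.U)
    (j i k : Fin n) :
    HasDerivAt (fun t => D.Mrow s G (Function.update y j t) i k) (D.Rrow s G y j i k) (y j) := by
  unfold Mrow Rrow
  split_ifs
  · exact pd_hasDerivAt j _ _ ((D.hA i y hy).differentiableAt (by simp))
  · exact hasDerivAt_const _ _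
  · apply HasDerivAt.add
    · exact pd_hasDerivAt j _ _ ((pd_contDiffAt i _ y (D.hm k y hy)).differentiableAt (by simp))
    · exact (pd_hasDerivAt j _ _
        ((pd_contDiffAt i _ y (D.hN k y hy)).differentiableAt (by simp))).const_smul s

theorem WW_hasDerivAt (hc : Continuous L) (s : ℝ) (G : Finset (Fin n)) (j : Fin n)
    (y : Fin n → ℝ) (hy : y ∈ D.U) :
    HasDerivAt (fun t => D.WW L s G j (Function.update y j t)) (D.dW L s G j y) (y j) := by
  have := alt_hasDerivAt L hc (fun t => Function.update (D.Mrow s G (Function.update y j t)) j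
      (fun k => D.N k (Function.update y j t)))
    (Function.update (fun i k => D.Rrow s G y j i k) j (fun k => pd j (D.N k) y)) (y j) (by
      intro i k
      by_cases hij : i = j
      · subst hij
        simp only [Function.update_self]
        exact pd_hasDerivAt i _ _ ((D.hN k y hy).differentiableAt (by simp))
      · simp only [Function.update_of_ne hij]
        exact D.Mrow_hasDerivAt s G y hy j i k)
  refine HasDerivAt.congr_deriv this ?_
  symm
  unfold dW
  rw [← Finset.add_sum_erase _ _ (Finset.mem_univ j)]
  simp only [Function.update_eq_self, Function.update_idem, Function.update_self]
  congr 1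
  refine Finset.sum_congr rfl fun i hi => ?_
  rw [Function.update_of_ne (Finset.ne_of_mem_erase hi)]

theorem Mrow_continuousOn (s : ℝ) (G : Finset (Fin n)) (i k : Fin n) :
    ContinuousOn (fun y => D.Mrow s G y i k) D.U := by
  intro y hy
  apply ContinuousAt.continuousWithinAt
  unfold Mrow
  split_ifs
  · exact (D.hA i y hy).continuousAt
  · exact continuousAt_const
  · exact (pd_contDiffAt i _ y (D.hm k y hy)).continuousAt.add
      ((pd_contDiffAt i _ y (D.hN k y hy)).continuousAt.const_smul s)

theorem Mrow_continuousOn' (G : Finset (Fin n)) (i k : Fin n) :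
    ContinuousOn (fun p : ℝ × (Fin n → ℝ) => D.Mrow p.1 G p.2 i k) (Set.univ ×ˢ D.U) := by
  rintro ⟨s, y⟩ ⟨-, hy⟩
  apply ContinuousAt.continuousWithinAt
  unfold Mrow
  split_ifs
  · exact ContinuousAt.comp' (f := Prod.snd) (D.hA i y hy).continuousAt continuousAt_snd
  · exact continuousAt_const
  · exact (ContinuousAt.comp' (f := Prod.snd)
      (pd_contDiffAt i _ y (D.hm k y hy)).continuousAt continuousAt_snd).add
      (continuousAt_fst.smul (ContinuousAt.comp' (f := Prod.snd)
        (pd_contDiffAt i _ y (D.hN k y hy)).continuousAt continuousAt_snd))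

theorem FF_continuousOn (hc : Continuous L) (s : ℝ) (G : Finset (Fin n)) :
    ContinuousOn (D.FF L s G) D.U :=
  alt_continuousOn L hc _ _ (fun j k => D.Mrow_continuousOn s G j k)

theorem dF_continuousOn' (hc : Continuous L) (G : Finset (Fin n)) :
    ContinuousOn (fun p : ℝ × (Fin n → ℝ) => D.dF L p.1 G p.2) (Set.univ ×ˢ D.U) := by
  unfold dF
  refine continuousOn_finsetSum _ fun j _ => alt_continuousOn L hc _ _ fun i k => ?_
  by_cases hij : i = j
  · subst hij
    simp only [Function.update_self]
    rintro ⟨s, y⟩ ⟨-, hy⟩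
    apply ContinuousAt.continuousWithinAt
    exact ContinuousAt.comp' (f := Prod.snd)
        (pd_contDiffAt i _ y (D.hN k y hy)).continuousAt continuousAt_snd
  · simp only [Function.update_of_ne hij]
    exact D.Mrow_continuousOn' G i k

theorem WW_continuousOn (hc : Continuous L) (s : ℝ) (G : Finset (Fin n)) (j : Fin n) :
    ContinuousOn (D.WW L s G j) D.U := by
  refine alt_continuousOn L hc _ _ (fun i k => ?_)
  by_cases hij : i = j
  · subst hij
    simp only [Function.update_self]
    exact fun y hy => (D.hN k y hy).continuousAt.continuousWithinAt
  · simp only [Function.update_of_ne hij]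
    exact D.Mrow_continuousOn s G i k

theorem dW_continuousOn (hc : Continuous L) (s : ℝ) (G : Finset (Fin n)) (j : Fin n) :
    ContinuousOn (D.dW L s G j) D.U := by
  unfold dW
  apply ContinuousOn.add
  · refine alt_continuousOn L hc _ _ (fun i k => ?_)
    by_cases hij : i = j
    · subst hij
      simp only [Function.update_self]
      exact fun y hy => (pd_contDiffAt i _ y (D.hN k y hy)).continuousAt.continuousWithinAt
    · simp only [Function.update_of_ne hij]
      exact D.Mrow_continuousOn s G i k
  · refine continuousOn_finsetSum _ fun l _ => alt_continuousOn L hc _ _ fun i k => ?_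
    by_cases hil : i = l
    · subst hil
      simp only [Function.update_self]
      intro y hy
      apply ContinuousAt.continuousWithinAt
      unfold Rrow
      split_ifs
      · exact (pd_contDiffAt j _ y (D.hA i y hy)).continuousAt
      · exact continuousAt_const
      · exact (pd_contDiffAt j _ y (pd_contDiffAt i _ y (D.hm k y hy))).continuousAt.add
          ((pd_contDiffAt j _ y (pd_contDiffAt i _ y (D.hN k y hy))).continuousAt.const_smul s)
    · simp only [Function.update_of_ne hil]
      by_cases hij : i = j
      · subst hij
        simp only [Function.update_self]
        exact fun y hy => (D.hN k y hy).continuousAt.continuousWithinAt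
      · simp only [Function.update_of_ne hij]
        exact D.Mrow_continuousOn s G i k

/-- the divergence identity -/
theorem div_eq (hL : ∀ (X : Fin n → E) (ρ : Equiv.Perm (Fin n)), L (fun j => X (ρ j)) = L X)
    (s : ℝ) (G : Finset (Fin n)) (y : Fin n → ℝ) (hy : y ∈ D.U)
    (hT : ∀ j ∉ G, ∀ i ∈ G, alt L (Function.update
      (Function.update (D.Mrow s G y) j (fun k => D.N k y)) i (D.Rrow s G y j i)) = 0) :
    ∑ j ∈ Gᶜ, D.dW L s G j y = D.dF L s G y := by
  unfold dW dF
  rw [Finset.sum_add_distrib, add_eq_left]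
  set T : Fin n → Fin n → ℝ := fun j i => alt L (Function.update
    (Function.update (D.Mrow s G y) j (fun k => D.N k y)) i (D.Rrow s G y j i)) with hTd
  have h1 : ∀ j ∈ Gᶜ, ∑ i ∈ Finset.univ.erase j, T j i
      = ∑ i ∈ Gᶜ, if i = j then 0 else T j i := by
    intro j hj
    have : ∑ i ∈ Finset.univ.erase j, T j i = ∑ i, if i = j then 0 else T j i := by
      rw [← Finset.add_sum_erase _ _ (Finset.mem_univ j)]
      simp only [if_true, zero_add]
      exact Finset.sum_congr rfl fun i hi => by simp [Finset.ne_of_mem_erase hi]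
    rw [this, ← Finset.sum_compl_add_sum G, add_eq_left]
    refine Finset.sum_eq_zero fun i hi => ?_
    split_ifs
    · rfl
    · exact hT j (by simpa using hj) i hi
  rw [Finset.sum_congr rfl h1]
  have h2 : ∀ i ∈ Gᶜ, ∀ j ∈ Gᶜ, i ≠ j → T j i = - T i j := by
    intro i hi j hj hij
    simp only [Finset.mem_compl] at hi hj
    have hR : D.Rrow s G y j i = D.Rrow s G y i j := by
      funext k
      simp only [Rrow, hi, hj, if_false]
      rw [pd_comm i j _ y (D.hm k y hy), pd_comm i j _ y (D.hN k y hy)]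
    simp only [hTd]
    rw [hR]
    have := alt_rowperm L hL (Function.update
      (Function.update (D.Mrow s G y) j (fun k => D.N k y)) i (D.Rrow s G y i j)) (Equiv.swap i j)
    rw [Equiv.Perm.sign_swap hij] at this
    have h3 : (fun l k => (Function.update
      (Function.update (D.Mrow s G y) j (fun k => D.N k y)) i (D.Rrow s G y i j))
        ((Equiv.swap i j) l) k) = (Function.update
      (Function.update (D.Mrow s G y) i (fun k => D.N k y)) j (D.Rrow s G y i j)) := by
      funext l
      by_cases hli : l = i
      · subst hli
        simp [Function.update_of_ne (Ne.symm hij), Function.update_of_ne hij]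
      · by_cases hlj : l = j
        · subst hlj
          simp
        · rw [Equiv.swap_apply_of_ne_of_ne hli hlj]
          simp [hli, hlj]
    rw [h3] at this
    rw [this]; simp
  have h3 : ∑ j ∈ Gᶜ, ∑ i ∈ Gᶜ, (if i = j then 0 else T j i)
      = - ∑ j ∈ Gᶜ, ∑ i ∈ Gᶜ, (if i = j then 0 else T j i) := by
    conv_lhs => rw [Finset.sum_comm]
    simp_rw [← Finset.sum_neg_distrib]
    refine Finset.sum_congr rfl fun i hi => Finset.sum_congr rfl fun j hj => ?_
    by_cases hij : i = j
    · simp [hij]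
    · rw [if_neg hij, if_neg (Ne.symm hij), h2 i hi j hj hij]
  linarith
end TileFns
end stokes
end

noncomputable section
open MeasureTheory Pointwise

def cube (n : ℕ) : Set (Fin n → ℝ) := Set.Icc 0 1

theorem mem_cube {n : ℕ} {y : Fin n → ℝ} : y ∈ cube n ↔ ∀ j, 0 ≤ y j ∧ y j ≤ 1 := by
  unfold cube
  simp only [Set.mem_Icc, Pi.le_def, Pi.zero_apply, Pi.one_apply]
  exact ⟨fun h j => ⟨h.1 j, h.2 j⟩, fun h => ⟨fun j => (h j).1, fun j => (h j).2⟩⟩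

theorem cube_compact (n : ℕ) : IsCompact (cube n) := isCompact_Icc
theorem cube_meas (n : ℕ) : MeasurableSet (cube n) := measurableSet_Icc

theorem update_mem_cube {n : ℕ} {y : Fin n → ℝ} (hy : y ∈ cube n) (j : Fin n) {t : ℝ}
    (ht : t ∈ Set.Icc (0:ℝ) 1) : Function.update y j t ∈ cube n := by
  rw [mem_cube] at hy ⊢
  intro i
  by_cases h : i = j
  · subst h; simpa using ht
  · simpa [h] using hy i

theorem cube_split {m : ℕ} (j : Fin (m+1)) (f : (Fin (m+1) → ℝ) → ℝ)
    (hf : ContinuousOn f (cube (m+1))) :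
    ∫ y in cube (m+1), f y =
      ∫ x in cube m, ∫ t in (0:ℝ)..1, f (j.insertNth t x) := by
  have hmp := (volume_preserving_piFinSuccAbove (fun _ : Fin (m + 1) => ℝ) j).symm _
  set e := (MeasurableEquiv.piFinSuccAbove (fun _ : Fin (m+1) => ℝ) j).symm with he
  have hea : ∀ p : ℝ × (Fin m → ℝ), e p = j.insertNth p.1 p.2 := fun p => rfl
  have hpre : e ⁻¹' (cube (m+1)) = Set.Icc (0:ℝ) 1 ×ˢ cube m := by
    ext ⟨t, x⟩
    simp only [Set.mem_preimage, hea, mem_cube, Set.mem_prod, Set.mem_Icc]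
    rw [Fin.forall_iff_succAbove j]
    simp
  have h1 := hmp.setIntegral_preimage_emb e.measurableEmbedding f (cube (m+1))
  rw [← h1, hpre]
  have hintg : IntegrableOn (fun p : ℝ × (Fin m → ℝ) => f (e p)) (Set.Icc (0:ℝ) 1 ×ˢ cube m)
      (volume.prod volume) := by
    have : IntegrableOn f (cube (m+1)) := hf.integrableOn_compact (cube_compact _)
    have h2 := (hmp.integrableOn_comp_preimage e.measurableEmbedding (f := f) (s := cube (m+1))).mpr this
    rw [hpre] at h2
    exact h2
  rw [Measure.volume_eq_prod, ← setIntegral_prod_swap, setIntegral_prod]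
  · refine setIntegral_congr_fun (cube_meas m) fun x _ => ?_
    simp only [intervalIntegral.integral_of_le zero_le_one, hea, Prod.swap]
    rw [integral_Icc_eq_integral_Ioc]
  · exact hintg.swap

theorem cube_ftc {n : ℕ} (j : Fin n) (g g' : (Fin n → ℝ) → ℝ)
    (hg : ContinuousOn g (cube n)) (hg' : ContinuousOn g' (cube n))
    (h : ∀ y ∈ cube n, HasDerivAt (fun t => g (Function.update y j t)) (g' y) (y j)) :
    ∫ y in cube n, g' y = (∫ y in cube n, g (Function.update y j 1)) -
      ∫ y in cube n, g (Function.update y j 0) := by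
  cases n with
  | zero => exact j.elim0
  | succ m =>
    have hupd : ∀ c ∈ Set.Icc (0:ℝ) 1, ContinuousOn (fun y => g (Function.update y j c)) (cube (m+1)) := by
      intro c hc
      apply hg.comp
      · exact (continuous_id.update j continuous_const).continuousOn
      · intro y hy; exact update_mem_cube hy j hc
    have h0 := hupd 0 (by simp)
    have h1 := hupd 1 (by simp)
    rw [← integral_sub (h1.integrableOn_compact (cube_compact _))
      (h0.integrableOn_compact (cube_compact _))]
    rw [cube_split j _ hg', cube_split j (fun y => g (Function.update y j 1) - g (Function.update y j 0)) (h1.sub h0)]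
    refine setIntegral_congr_fun (cube_meas m) fun x hx => ?_
    have hins : ∀ t ∈ Set.Icc (0:ℝ) 1, (j.insertNth t x : Fin (m+1) → ℝ) ∈ cube (m+1) := by
      intro t ht
      rw [mem_cube] at hx ⊢
      rw [Fin.forall_iff_succAbove j]
      simpa using ⟨ht, hx⟩
    have hu : ∀ t c : ℝ, Function.update (j.insertNth t x : Fin (m+1) → ℝ) j c = j.insertNth c x := by
      intro t c; simp
    simp only [hu]
    rw [intervalIntegral.integral_const, sub_zero, one_smul]
    have hcont : Continuous (fun t : ℝ => (j.insertNth t x : Fin (m+1) → ℝ)) :=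
      continuous_pi fun i => by
        refine Fin.succAboveCases j ?_ ?_ i
        · simpa using continuous_id'
        · intro i; simpa using continuous_const
    rw [intervalIntegral.integral_eq_sub_of_hasDerivAt
      (f := fun t => g (j.insertNth t x))]
    · intro t ht
      rw [Set.uIcc_of_le zero_le_one] at ht
      have := h _ (hins t ht)
      simpa [hu] using this
    · apply ContinuousOn.intervalIntegrable
      rw [Set.uIcc_of_le zero_le_one]
      exact hg'.comp hcont.continuousOn hins

theorem cube_perm {n : ℕ} (τ : Equiv.Perm (Fin n)) (f : (Fin n → ℝ) → ℝ) :
    ∫ y in cube n, f (fun j => y (τ j)) = ∫ y in cube n, f y := by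
  have hmp := volume_measurePreserving_piCongrLeft (fun _ : Fin n => ℝ) τ.symm
  have hval : ∀ y : Fin n → ℝ, (MeasurableEquiv.piCongrLeft (fun _ : Fin n => ℝ) τ.symm) y
      = fun j => y (τ j) := by
    intro y; funext j
    have := Equiv.piCongrLeft_apply_apply (fun _ : Fin n => ℝ) τ.symm y (τ j)
    simp only [Equiv.symm_apply_apply] at this
    exact this
  have h1 := hmp.setIntegral_preimage_emb (MeasurableEquiv.measurableEmbedding _) f (cube n)
  rw [← h1]
  have hpre : (MeasurableEquiv.piCongrLeft (fun _ : Fin n => ℝ) τ.symm) ⁻¹' (cube n) = cube n := by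
    ext y
    simp only [Set.mem_preimage, hval, mem_cube]
    exact ⟨fun h j => by simpa using h (τ.symm j), fun h j => h _⟩
  rw [hpre]
  simp_rw [hval]

theorem cube_deriv {n : ℕ} (F F' : ℝ → (Fin n → ℝ) → ℝ)
    (hF : ∀ s, ContinuousOn (F s) (cube n))
    (hF' : ContinuousOn (fun p : ℝ × (Fin n → ℝ) => F' p.1 p.2) (Set.univ ×ˢ cube n))
    (h : ∀ s, ∀ y ∈ cube n, HasDerivAt (fun s => F s y) (F' s y) s) (s : ℝ) :
    HasDerivAt (fun s => ∫ y in cube n, F s y) (∫ y in cube n, F' s y) s := by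
  have hcomp : IsCompact (Set.Icc (s-1) (s+1) ×ˢ cube n) := isCompact_Icc.prod (cube_compact n)
  obtain ⟨C, hC⟩ := hcomp.exists_bound_of_continuousOn
    (hF'.mono (Set.prod_mono (Set.subset_univ _) le_rfl))
  have hs' : ContinuousOn (F' s) (cube n) := by
    have : ContinuousOn (fun y : Fin n → ℝ => (s, y)) (cube n) := by fun_prop
    exact hF'.comp this (fun y hy => ⟨trivial, hy⟩)
  have hfin : IsFiniteMeasure (volume.restrict (cube n)) :=
    ⟨by simpa using (cube_compact n).measure_lt_top⟩
  refine (hasDerivAt_integral_of_dominated_loc_of_deriv_le (s := Set.Icc (s-1) (s+1))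
    (bound := fun _ => C) (Icc_mem_nhds (by linarith) (by linarith)) ?_ ?_ ?_ ?_ ?_ ?_).2
  · exact Filter.Eventually.of_forall fun s => ((hF s).aestronglyMeasurable (cube_meas n))
  · exact (hF s).integrableOn_compact (cube_compact n)
  · exact hs'.aestronglyMeasurable (cube_meas n)
  · exact (ae_restrict_iff' (cube_meas n)).mpr
      (Filter.Eventually.of_forall fun y hy x hx => hC (x, y) ⟨hx, hy⟩)
  · exact integrable_const _
  · exact (ae_restrict_iff' (cube_meas n)).mpr
      (Filter.Eventually.of_forall fun y hy x hx => h x y hy)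
end

noncomputable section
open MeasureTheory Pointwise

/-- set the coordinates in `G` to zero -/
def zG {n : ℕ} (G : Finset (Fin n)) (y : Fin n → ℝ) : Fin n → ℝ := fun j => if j ∈ G then 0 else y j

theorem zG_mem {n : ℕ} (G : Finset (Fin n)) {y : Fin n → ℝ} (hy : y ∈ cube n) : zG G y ∈ cube n := by
  rw [mem_cube] at hy ⊢
  intro j; unfold zG
  split_ifs
  · simp
  · exact hy j

theorem zG_cont {n : ℕ} (G : Finset (Fin n)) : Continuous (zG G) := by
  refine continuous_pi fun j => ?_
  unfold zG
  split_ifs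
  · exact continuous_const
  · exact continuous_apply j

theorem zG_update {n : ℕ} (G : Finset (Fin n)) (y : Fin n → ℝ) (j : Fin n) (hj : j ∉ G) (t : ℝ) :
    zG G (Function.update y j t) = Function.update (zG G y) j t := by
  funext i
  by_cases h : i = j
  · subst h; simp [zG, hj]
  · simp [zG, h]

theorem zG_update0 {n : ℕ} (G : Finset (Fin n)) (y : Fin n → ℝ) (j : Fin n) :
    Function.update (zG G y) j 0 = zG (insert j G) y := by
  funext i
  by_cases h : i = j
  · subst h; simp [zG]
  · simp [zG, h]

structure Glob (n : ℕ) (E : Type*) [NormedAddCommGroup E] [NormedSpace ℝ E] (ι : Type*)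
    (L : MultilinearMap ℝ (fun _ : Fin n => E) ℝ) where
  D : ι → TileFns n E
  hcube : ∀ v, cube n ⊆ (D v).U
  hc : Continuous L
  hL : ∀ (X : Fin n → E) (ρ : Equiv.Perm (Fin n)), L (fun j => X (ρ j)) = L X
  nb : ι → Fin n → ι
  tau : ι → Fin n → Equiv.Perm (Fin n)
  nb_nb : ∀ v i, nb (nb v i) (tau v i i) = v
  tau_tau : ∀ v i, tau (nb v i) (tau v i i) = (tau v i)⁻¹
  hT1 : ∀ v s G, ∀ z ∈ cube n, (∀ i ∈ G, z i = 0) → ∀ j ∉ G, ∀ i ∈ G,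
    alt L (Function.update (Function.update ((D v).Mrow s G z) j (fun k => (D v).N k z)) i
      ((D v).Rrow s G z j i)) = 0
  hT2 : ∀ v s G, ∀ z ∈ cube n, (∀ i ∈ G, z i = 0) → ∀ j ∉ G, z j = 0 →
    (D v).WW L s G j z = (D v).FF L s (insert j G) z
  hT3 : ∀ v s G, ∀ z ∈ cube n, (∀ i ∈ G, z i = 0) → ∀ j ∉ G, z j = 1 →
    (D (nb v j)).WW L s (G.map (tau v j).toEmbedding) (tau v j j) (fun k => z ((tau v j).symm k))
      = - (D v).WW L s G j z

namespace Glob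
variable {n : ℕ} {E : Type*} [NormedAddCommGroup E] [NormedSpace ℝ E] {ι : Type*} [Fintype ι]
    [DecidableEq ι]
    {L : MultilinearMap ℝ (fun _ : Fin n => E) ℝ} (T : Glob n E ι L)

def IG (s : ℝ) (v : ι) (G : Finset (Fin n)) : ℝ := ∫ y in cube n, (T.D v).FF L s G (zG G y)

def wall (s : ℝ) (v : ι) (G : Finset (Fin n)) (j : Fin n) : ℝ :=
  ∫ y in cube n, (T.D v).WW L s G j (Function.update (zG G y) j 1)

attribute [local irreducible] TileFns.FF TileFns.WW TileFns.dF TileFns.dW in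
theorem IG_deriv (s : ℝ) (v : ι) (G : Finset (Fin n)) :
    HasDerivAt (fun s => T.IG s v G) (∑ j ∈ Gᶜ, (T.wall s v G j - T.IG s v (insert j G))) s := by
  have hmaps : Set.MapsTo (zG G) (cube n) (T.D v).U := fun y hy => T.hcube v (zG_mem G hy)
  have h1 := cube_deriv (fun s y => (T.D v).FF L s G (zG G y)) (fun s y => (T.D v).dF L s G (zG G y))
    (fun s => ((T.D v).FF_continuousOn L T.hc s G).comp (zG_cont G).continuousOn hmaps)
    (by
      have : Continuous (fun p : ℝ × (Fin n → ℝ) => (p.1, zG G p.2)) :=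
        continuous_fst.prodMk ((zG_cont G).comp continuous_snd)
      have h0 := ((T.D v).dF_continuousOn' L T.hc G)
      have h00 : Set.MapsTo (fun p : ℝ × (Fin n → ℝ) => (p.1, zG G p.2)) (Set.univ ×ˢ cube n)
        (Set.univ ×ˢ (T.D v).U) := fun p hp => ⟨trivial, hmaps hp.2⟩
      exact ContinuousOn.comp (g := fun p : ℝ × (Fin n → ℝ) => (T.D v).dF L p.1 G p.2)
        h0 this.continuousOn h00)
    (fun s y _ => (T.D v).FF_hasDerivAt L T.hc s G (zG G y)) s
  refine HasDerivAt.congr_deriv h1 ?_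
  have h2 : ∀ y ∈ cube n, (T.D v).dF L s G (zG G y) = ∑ j ∈ Gᶜ, (T.D v).dW L s G j (zG G y) := by
    intro y hy
    rw [(T.D v).div_eq L T.hL s G (zG G y) (hmaps hy)]
    exact T.hT1 v s G _ (zG_mem G hy) (fun i hi => by simp [zG, hi])
  rw [setIntegral_congr_fun (cube_meas n) h2, integral_finsetSum]
  · refine Finset.sum_congr rfl fun j hj => ?_
    have hj' : j ∉ G := by simpa using hj
    rw [cube_ftc j (fun y => (T.D v).WW L s G j (zG G y))]
    · simp only [zG_update G _ j hj', zG_update0]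
      congr 1
      refine setIntegral_congr_fun (cube_meas n) fun y hy => ?_
      refine T.hT2 v s G _ (zG_mem _ hy) (fun i hi => by simp [zG, hi]) j hj' (by simp [zG])
    · exact ((T.D v).WW_continuousOn L T.hc s G j).comp (zG_cont G).continuousOn hmaps
    · exact ((T.D v).dW_continuousOn L T.hc s G j).comp (zG_cont G).continuousOn hmaps
    · intro y hy
      have := (T.D v).WW_hasDerivAt L T.hc s G j (zG G y) (hmaps hy)
      simp only [zG_update G _ j hj']
      have hz : zG G y j = y j := by simp [zG, hj']
      rw [hz] at this
      exact this
  · intro j _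
    exact (((T.D v).dW_continuousOn L T.hc s G j).comp (zG_cont G).continuousOn
      hmaps).integrableOn_compact (cube_compact n)

theorem wall_neg (s : ℝ) (v : ι) (G : Finset (Fin n)) (j : Fin n) (hj : j ∉ G) :
    T.wall s (T.nb v j) (G.map (T.tau v j).toEmbedding) (T.tau v j j) = - T.wall s v G j := by
  unfold wall
  rw [← cube_perm (T.tau v j).symm, ← integral_neg]
  refine setIntegral_congr_fun (cube_meas n) fun y hy => ?_
  rw [← T.hT3 v s G (Function.update (zG G y) j 1) (update_mem_cube (zG_mem G hy) j (by simp))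
    (fun i hi => by
      have hij : i ≠ j := fun h => hj (h ▸ hi)
      rw [Function.update_of_ne hij]; simp [zG, hi]) j hj (by simp)]
  congr 1
  funext k
  by_cases h : k = T.tau v j j
  · rw [h]; simp
  · have h' : (T.tau v j).symm k ≠ j := fun hh => h ((Equiv.symm_apply_eq _).mp hh)
    rw [Function.update_of_ne h, Function.update_of_ne h']
    simp only [zG]
    congr 1
    simp only [Finset.mem_map_equiv]

theorem wall_sum (s : ℝ) :
    ∑ v, ∑ G : Finset (Fin n), ∑ j ∈ Gᶜ, (s-1)^G.card * T.wall s v G j = 0 := by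
  have e : ∑ v, ∑ G : Finset (Fin n), ∑ j ∈ Gᶜ, (s-1)^G.card * T.wall s v G j
      = ∑ x ∈ (Finset.univ : Finset (ι × Finset (Fin n) × Fin n)).filter
          (fun x => x.2.2 ∉ x.2.1), (s-1)^x.2.1.card * T.wall s x.1 x.2.1 x.2.2 := by
    rw [Finset.sum_filter, Fintype.sum_prod_type]
    refine Finset.sum_congr rfl fun v _ => ?_
    rw [Fintype.sum_prod_type]
    refine Finset.sum_congr rfl fun G _ => ?_
    rw [← Finset.sum_filter]
    refine Finset.sum_congr ?_ fun _ _ => rfl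
    ext j; simp
  rw [e]
  have hneg : ∀ x ∈ (Finset.univ : Finset (ι × Finset (Fin n) × Fin n)).filter
          (fun x => x.2.2 ∉ x.2.1), (s-1)^x.2.1.card * T.wall s x.1 x.2.1 x.2.2 +
      (s-1)^(x.2.1.map (T.tau x.1 x.2.2).toEmbedding).card *
        T.wall s (T.nb x.1 x.2.2) (x.2.1.map (T.tau x.1 x.2.2).toEmbedding)
          (T.tau x.1 x.2.2 x.2.2) = 0 := by
    intro x hx
    rw [T.wall_neg s _ _ _ (by simpa using hx), Finset.card_map]
    ring
  refine Finset.sum_involution (fun x _ => (T.nb x.1 x.2.2, x.2.1.map (T.tau x.1 x.2.2).toEmbedding,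
    T.tau x.1 x.2.2 x.2.2)) hneg ?_ ?_ ?_
  · intro x hx hne heq
    apply hne
    have h1 := hneg x hx
    have h2 : T.nb x.1 x.2.2 = x.1 := congrArg Prod.fst heq
    have h3 : x.2.1.map (T.tau x.1 x.2.2).toEmbedding = x.2.1 := congrArg (fun x => x.2.1) heq
    have h4 : T.tau x.1 x.2.2 x.2.2 = x.2.2 := congrArg (fun x => x.2.2) heq
    rw [h2, h3, h4] at h1
    linarith
  · intro x hx
    simp at hx ⊢
    exact hx
  · rintro ⟨v, G, j⟩ hx
    simp only [T.nb_nb, T.tau_tau]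
    congr 2
    · ext k
      simp [Equiv.Perm.inv_def]
    · simp

theorem reindex (s : ℝ) (X : Finset (Fin n) → ℝ) :
    ∑ G : Finset (Fin n), ∑ j ∈ Gᶜ, (s-1)^G.card * X (insert j G)
      = ∑ G : Finset (Fin n), (G.card : ℝ) * (s-1)^(G.card-1) * X G := by
  have h1 : ∀ G : Finset (Fin n), (G.card : ℝ) * (s-1)^(G.card-1) * X G
      = ∑ j ∈ G, (s-1)^(G.card-1) * X G := by
    intro G; rw [Finset.sum_const, nsmul_eq_mul]; ring
  simp_rw [h1]
  rw [Finset.sum_sigma', Finset.sum_sigma']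
  refine Finset.sum_bij' (fun x _ => ⟨insert x.2 x.1, x.2⟩) (fun x _ => ⟨x.1.erase x.2, x.2⟩)
    ?_ ?_ ?_ ?_ ?_
  · rintro ⟨G, j⟩ h; simp
  · rintro ⟨G, j⟩ h; simp
  · rintro ⟨G, j⟩ h
    simp at h
    simp [Finset.erase_insert h]
  · rintro ⟨G, j⟩ h
    simp at h
    simp [Finset.insert_erase h]
  · rintro ⟨G, j⟩ h
    simp at h
    simp [Finset.card_insert_of_notMem h]

theorem main : ∑ v, T.IG 1 v ∅ = ∑ v, ∑ G : Finset (Fin n), (-1 : ℝ)^G.card * T.IG 0 v G := by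
  set J : ℝ → ℝ := fun s => ∑ v, ∑ G : Finset (Fin n), (s-1)^G.card * T.IG s v G with hJ
  have hd : ∀ s, HasDerivAt J 0 s := by
    intro s
    have h1 : HasDerivAt J (∑ v, ∑ G : Finset (Fin n), ((G.card : ℝ) * (s-1)^(G.card-1) * T.IG s v G
        + (s-1)^G.card * ∑ j ∈ Gᶜ, (T.wall s v G j - T.IG s v (insert j G)))) s := by
      refine HasDerivAt.fun_sum fun v _ => HasDerivAt.fun_sum fun G _ => ?_
      have hp := ((hasDerivAt_id s).sub_const 1).pow G.card
      have h3 := hp.mul (T.IG_deriv s v G)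
      refine HasDerivAt.congr_deriv (f := fun s => (s-1)^G.card * T.IG s v G) h3 ?_
      simp
    refine h1.congr_deriv ?_
    have h2 : ∀ v, ∑ G : Finset (Fin n), ((G.card : ℝ) * (s-1)^(G.card-1) * T.IG s v G
        + (s-1)^G.card * ∑ j ∈ Gᶜ, (T.wall s v G j - T.IG s v (insert j G)))
        = ∑ G : Finset (Fin n), ∑ j ∈ Gᶜ, (s-1)^G.card * T.wall s v G j := by
      intro v
      rw [Finset.sum_add_distrib, ← reindex s (T.IG s v), ← Finset.sum_add_distrib]
      refine Finset.sum_congr rfl fun G _ => ?_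
      rw [Finset.mul_sum, ← Finset.sum_add_distrib]
      refine Finset.sum_congr rfl fun j _ => ?_
      ring
    simp_rw [h2]
    exact T.wall_sum s
  have hJc : J 1 = J 0 := is_const_of_deriv_eq_zero (fun s => (hd s).differentiableAt)
    (fun s => (hd s).deriv) 1 0
  have e1 : J 1 = ∑ v, T.IG 1 v ∅ := by
    simp only [hJ, sub_self]
    refine Finset.sum_congr rfl fun v _ => ?_
    rw [Finset.sum_eq_single ∅]
    · simp
    · intro G _ hG
      rw [zero_pow (by simpa using hG), zero_mul]
    · simp
  rw [← e1, hJc]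
  simp only [hJ, zero_sub]
end Glob
end

noncomputable section
open MeasureTheory Pointwise
set_option linter.unusedSectionVars false

attribute [local instance] Matrix.normedAddCommGroup Matrix.normedSpace

theorem det_contDiffAt {X : Type*} [NormedAddCommGroup X] [NormedSpace ℝ X] {O : Type*} [Fintype O]
    [DecidableEq O] (f : X → Matrix O O ℝ) (x : X)
    (h : ∀ p q, ContDiffAt ℝ (⊤ : ℕ∞) (fun y => f y p q) x) :
    ContDiffAt ℝ (⊤ : ℕ∞) (fun y => (f y).det) x := by
  simp_rw [Matrix.det_apply]
  refine ContDiffAt.sum fun σ _ => ?_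
  simp_rw [Units.smul_def, zsmul_eq_mul]
  exact contDiffAt_const.mul (contDiffAt_prod fun i _ => h _ _)

theorem inv_contDiffAt {X : Type*} [NormedAddCommGroup X] [NormedSpace ℝ X] {O : Type*} [Fintype O]
    [DecidableEq O] (f : X → Matrix O O ℝ) (x : X)
    (h : ∀ p q, ContDiffAt ℝ (⊤ : ℕ∞) (fun y => f y p q) x) (hd : (f x).det ≠ 0) (p q : O) :
    ContDiffAt ℝ (⊤ : ℕ∞) (fun y => (f y)⁻¹ p q) x := by
  have : ∀ y, (f y)⁻¹ p q = ((f y).det)⁻¹ * (f y).adjugate p q := by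
    intro y
    rw [Matrix.inv_def, Ring.inverse_eq_inv']; rfl
  simp_rw [this]
  refine ((det_contDiffAt f x h).inv hd).mul ?_
  simp_rw [Matrix.adjugate_apply]
  refine det_contDiffAt _ _ fun a b => ?_
  simp_rw [Matrix.updateRow_apply]
  split_ifs
  · exact contDiffAt_const
  · exact h a b

theorem entry_contDiffAt {X : Type*} [NormedAddCommGroup X] [NormedSpace ℝ X] {O : Type*} [Fintype O]
    [DecidableEq O] (f : X → Matrix O O ℝ) (x : X)
    (h : ∀ p q, ContDiffAt ℝ (⊤ : ℕ∞) (fun y => f y p q) x) : ContDiffAt ℝ (⊤ : ℕ∞) f x := by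
  refine contDiffAt_pi.mpr fun p => contDiffAt_pi.mpr fun q => h p q

/-- exponents of the lattice points in the coordinates at a vertex -/
structure Loc (n : ℕ) (S : Type*) where
  a : S → Fin n → ℕ
  o : S
  e : Fin n → S
  ho : ∀ j, a o j = 0
  he : ∀ i j, a (e i) j = if j = i then 1 else 0

namespace Loc
variable {n : ℕ} {S : Type*} [Fintype S] (D : Loc n S)

def la (x : S) : Option (Fin n) → ℝ := fun p => p.elim 1 (fun j => (D.a x j : ℝ))

/-- the exponent `a - e_p` (truncated) -/
def ex (x : S) (p : Option (Fin n)) (j : Fin n) : ℕ := if p = some j then D.a x j - 1 else D.a x j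

def mo (x : S) (p : Option (Fin n)) (y : Fin n → ℝ) : ℝ := ∏ j, y j ^ (D.ex x p j)

def sm (y : Fin n → ℝ) : Matrix (Option (Fin n)) (Option (Fin n)) ℝ :=
  Matrix.of fun p q => ∑ x, D.la x p * D.mo x p y * D.la x q
def smk (k : Fin n) (y : Fin n → ℝ) : Matrix (Option (Fin n)) (Option (Fin n)) ℝ :=
  Matrix.of fun p q => ∑ x, (D.a x k : ℝ) * D.la x p * D.mo x p y * D.la x q

def tot (y : Fin n → ℝ) : ℝ := ∑ x, D.mo x none y
def mean (k : Fin n) (y : Fin n → ℝ) : ℝ := (∑ x, (D.a x k : ℝ) * D.mo x none y) / D.tot y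

theorem mo_contDiff (x : S) (p : Option (Fin n)) : ContDiff ℝ (⊤ : ℕ∞) (D.mo x p) := by
  unfold mo
  exact contDiff_prod fun j _ => (contDiff_apply ℝ ℝ j).pow _

theorem sm_contDiff (p q : Option (Fin n)) : ContDiff ℝ (⊤ : ℕ∞) (fun y => D.sm y p q) := by
  unfold sm
  simp only [Matrix.of_apply]
  exact ContDiff.sum fun x _ => (contDiff_const.mul (D.mo_contDiff x p)).mul contDiff_const

theorem smk_contDiff (k) (p q : Option (Fin n)) : ContDiff ℝ (⊤ : ℕ∞) (fun y => D.smk k y p q) := by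
  unfold smk
  simp only [Matrix.of_apply]
  exact ContDiff.sum fun x _ => (contDiff_const.mul (D.mo_contDiff x p)).mul contDiff_const

theorem tot_contDiff : ContDiff ℝ (⊤ : ℕ∞) D.tot := by
  unfold tot
  exact ContDiff.sum fun x _ => (D.mo_contDiff x _)

theorem mean_contDiffAt (k : Fin n) (y) (hy : D.tot y ≠ 0) : ContDiffAt ℝ (⊤ : ℕ∞) (D.mean k) y := by
  refine ContDiffAt.div ?_ D.tot_contDiff.contDiffAt hy
  exact (ContDiff.sum fun x _ => contDiff_const.mul (D.mo_contDiff x _)).contDiffAt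

theorem det_contDiff : ContDiff ℝ (⊤ : ℕ∞) (fun y => (D.sm y).det) :=
  contDiff_iff_contDiffAt.mpr fun _ => det_contDiffAt _ _ fun p q => (D.sm_contDiff p q).contDiffAt

def tile : TileFns n (Matrix (Option (Fin n)) (Option (Fin n)) ℝ) where
  A k y := (D.sm y)⁻¹ * D.smk k y
  m k y := D.mean k y • 1
  U := {y | (D.sm y).det ≠ 0 ∧ D.tot y ≠ 0}
  hU := (isOpen_ne_fun D.det_contDiff.continuous continuous_const).inter
    (isOpen_ne_fun D.tot_contDiff.continuous continuous_const)
  hA k y hy := by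
    refine entry_contDiffAt _ _ fun p q => ?_
    simp_rw [Matrix.mul_apply]
    exact ContDiffAt.sum fun r _ => (inv_contDiffAt _ _ (fun p q => (D.sm_contDiff p q).contDiffAt)
      hy.1 p r).mul (D.smk_contDiff k r q).contDiffAt
  hm k y hy := (D.mean_contDiffAt k y hy.2).smul contDiffAt_const

theorem mo_nonneg (x : S) (p) (y : Fin n → ℝ) (hy : ∀ j, 0 ≤ y j) : 0 ≤ D.mo x p y :=
  Finset.prod_nonneg fun j _ => pow_nonneg (hy j) _

theorem mo_none (x : S) (y : Fin n → ℝ) : D.mo x none y = ∏ j, y j ^ (D.a x j) := by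
  simp [mo, ex]

theorem mo_some_mul (x : S) (i : Fin n) (y : Fin n → ℝ) (h : D.a x i ≠ 0) :
    D.mo x (some i) y * y i = D.mo x none y := by
  classical
  unfold mo
  rw [← Finset.mul_prod_erase _ _ (Finset.mem_univ i), ← Finset.mul_prod_erase Finset.univ
    (fun j => y j ^ D.ex x none j) (Finset.mem_univ i)]
  have h1 : ∏ j ∈ Finset.univ.erase i, y j ^ D.ex x (some i) j
      = ∏ j ∈ Finset.univ.erase i, y j ^ D.ex x none j := by
    refine Finset.prod_congr rfl fun j hj => ?_
    simp [ex, (Finset.ne_of_mem_erase hj).symm]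
  rw [h1]
  have : y i ^ D.ex x none i = y i ^ D.ex x (some i) i * y i := by
    rw [← pow_succ]; congr 1; simp [ex]; omega
  rw [this]; ring

/-- at `y i = 0` monomials with positive exponent vanish -/
theorem mo_zero (x : S) (p) (i : Fin n) (y : Fin n → ℝ) (hy : y i = 0) (h : D.ex x p i ≠ 0) :
    D.mo x p y = 0 :=
  Finset.prod_eq_zero (Finset.mem_univ i) (by rw [hy, zero_pow h])

theorem mo_pos (x : S) (p) (y : Fin n → ℝ) (hy : ∀ j, D.ex x p j ≠ 0 → 0 < y j) : 0 < D.mo x p y := by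
  refine Finset.prod_pos fun j _ => ?_
  by_cases h : D.ex x p j = 0
  · rw [h]; simp
  · exact pow_pos (hy j h) _

theorem tot_pos (y : Fin n → ℝ) (hy : ∀ j, 0 ≤ y j) : 0 < D.tot y := by
  unfold tot
  refine Finset.sum_pos' (fun x _ => D.mo_nonneg x _ y hy) ⟨D.o, Finset.mem_univ _, ?_⟩
  refine D.mo_pos _ _ _ fun j h => ?_
  exact absurd (by simp [ex, D.ho]) h

theorem la_o : ∀ p, D.la D.o p = if p = none then 1 else 0 := by
  rintro (_ | j)
  · simp [la]
  · simp [la, D.ho]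

theorem la_e (i : Fin n) : ∀ p, D.la (D.e i) p = if p = none then 1 else if p = some i then 1 else 0 := by
  rintro (_ | j)
  · simp [la]
  · simp [la, D.he]

/-- kernel argument -/
theorem det_ne (y : Fin n → ℝ) (hy : ∀ j, 0 ≤ y j) : (D.sm y).det ≠ 0 := by
  classical
  intro hd
  obtain ⟨v, hv0, hv⟩ := Matrix.exists_mulVec_eq_zero_iff.mpr hd
  apply hv0
  have hrow : ∀ p, ∑ x, D.la x p * D.mo x p y * (∑ q, D.la x q * v q) = 0 := by
    intro p
    have := congrFun hv p
    simp only [Matrix.mulVec, dotProduct, sm, Matrix.of_apply, Pi.zero_apply] at this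
    rw [← this]
    simp_rw [Finset.sum_mul, Finset.mul_sum]
    rw [Finset.sum_comm]
    refine Finset.sum_congr rfl fun _ _ => Finset.sum_congr rfl fun _ _ => by ring
  -- weights of coordinates
  set yy : Option (Fin n) → ℝ := fun p => p.elim 1 y with hyy
  have hla : ∀ x p, D.la x p * D.mo x p y * yy p = D.la x p * D.mo x none y := by
    rintro x (_ | j)
    · simp [hyy]
    · by_cases h : D.a x j = 0
      · simp [la, h]
      · rw [mul_assoc]; simp only [hyy, Option.elim]; rw [D.mo_some_mul x j y h]
  have hsum : ∑ x, D.mo x none y * (∑ q, D.la x q * v q)^2 = 0 := by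
    have h1 : ∑ p, v p * yy p * (∑ x, D.la x p * D.mo x p y * (∑ q, D.la x q * v q)) = 0 :=
      Finset.sum_eq_zero fun p _ => by rw [hrow p, mul_zero]
    rw [← h1]
    simp_rw [Finset.mul_sum (s := (Finset.univ : Finset S))]
    rw [Finset.sum_comm]
    refine Finset.sum_congr rfl fun x _ => ?_
    rw [sq, ← mul_assoc, Finset.mul_sum]
    refine Finset.sum_congr rfl fun p _ => ?_
    have := hla x p
    linear_combination (-(v p * ∑ q, D.la x q * v q)) * this
  have hz : ∀ x, D.mo x none y * (∑ q, D.la x q * v q)^2 = 0 := by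
    intro x
    exact (Finset.sum_eq_zero_iff_of_nonneg (fun x _ => mul_nonneg (D.mo_nonneg x _ y hy)
      (sq_nonneg _))).mp hsum x (Finset.mem_univ x)
  have ho' : v none = 0 := by
    have h1 := hz D.o
    have h2 : 0 < D.mo D.o none y := D.mo_pos _ _ _ fun j h => absurd (by simp [ex, D.ho]) h
    have h3 := (mul_eq_zero.mp h1).resolve_left h2.ne'
    simpa [D.la_o] using h3
  have hpos : ∀ j, y j ≠ 0 → v (some j) = 0 := by
    intro j hj
    have h1 := hz (D.e j)
    have h2 : 0 < D.mo (D.e j) none y := D.mo_pos _ _ _ fun i h => by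
      by_cases hij : i = j
      · subst hij; exact lt_of_le_of_ne (hy i) (Ne.symm hj)
      · exact absurd (by simp [ex, D.he, hij]) h
    have h3 := (mul_eq_zero.mp h1).resolve_left h2.ne'
    have h4 : (∑ q, D.la (D.e j) q * v q) = v none + v (some j) := by
      rw [Fintype.sum_option]
      simp [D.la_e]
    rw [h4, ho'] at h3
    simpa using h3
  have hneg : ∀ j, y j = 0 → v (some j) = 0 := by
    intro j hj
    have h1 := hrow (some j)
    have h2 : ∀ x, D.la x (some j) * D.mo x (some j) y * (∑ q, D.la x q * v q)
        = D.la x (some j) * D.mo x (some j) y * (D.la x (some j) * v (some j)) := by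
      intro x
      by_cases hx : D.mo x (some j) y = 0
      · rw [hx]; ring
      · congr 1
        refine Finset.sum_eq_single_of_mem _ (Finset.mem_univ _) ?_
        rintro (_ | i) _ hi
        · rw [ho', mul_zero]
        · by_cases hyi : y i = 0
          · by_cases hai : D.a x i = 0
            · simp [la, hai]
            · exfalso; apply hx
              refine D.mo_zero x _ i y hyi ?_
              have : j ≠ i := fun h => hi (by rw [h])
              simp [ex, this, hai]
          · rw [hpos i hyi, mul_zero]
    simp_rw [h2] at h1
    have h3 : (∑ x, D.la x (some j) * D.mo x (some j) y * D.la x (some j)) * v (some j) = 0 := by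
      rw [← h1, Finset.sum_mul]
      exact Finset.sum_congr rfl fun _ _ => by ring
    refine (mul_eq_zero.mp h3).resolve_left (ne_of_gt ?_)
    refine Finset.sum_pos' (fun x _ => ?_) ⟨D.e j, Finset.mem_univ _, ?_⟩
    · have : 0 ≤ D.la x (some j) := by simp [la]
      exact mul_nonneg (mul_nonneg this (D.mo_nonneg x _ y hy)) this
    · have : D.la (D.e j) (some j) = 1 := by simp [la, D.he]
      rw [this, one_mul, mul_one]
      refine D.mo_pos _ _ _ fun i h => ?_
      by_cases hij : i = j
      · subst hij; exact absurd (by simp [ex, D.he]) h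
      · exact absurd (by simp [ex, D.he, hij]) h
  funext p
  rcases p with _ | j
  · exact ho'
  · by_cases h : y j = 0
    · exact hneg j h
    · exact hpos j h

theorem cube_sub : cube n ⊆ D.tile.U := fun y hy =>
  ⟨D.det_ne y fun j => (mem_cube.mp hy j).1, (D.tot_pos y fun j => (mem_cube.mp hy j).1).ne'⟩

end Loc
end

noncomputable section
open MeasureTheory Pointwise
set_option linter.unusedSectionVars false

attribute [local instance] Matrix.normedAddCommGroup Matrix.normedSpace

section tang
variable {n : ℕ} {O : Type*} [Fintype O] [DecidableEq O]

theorem pd_entry (j : Fin n) (f : (Fin n → ℝ) → Matrix O O ℝ) (y : Fin n → ℝ)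
    (hf : DifferentiableAt ℝ f y) (p q : O) :
    HasDerivAt (fun t => f (Function.update y j t) p q) (pd j f y p q) (y j) := by
  have h := pd_hasDerivAt j f y hf
  have h1 := (hasDerivAt_pi (φ := fun t => f (Function.update y j t))).mp h p
  exact (hasDerivAt_pi (φ := fun t => f (Function.update y j t) p)).mp h1 q

/-- tangential derivative of an entry that is constant on a coordinate slice -/
theorem pd_entry_const (j : Fin n) (f : (Fin n → ℝ) → Matrix O O ℝ) (y : Fin n → ℝ)
    (hf : DifferentiableAt ℝ f y) (p q : O) (U : Set (Fin n → ℝ)) (hU : IsOpen U) (hy : y ∈ U)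
    (i : Fin n) (hij : j ≠ i) (c b : ℝ) (hyi : y i = b) (h : ∀ z ∈ U, z i = b → f z p q = c) :
    pd j f y p q = 0 := by
  have h1 := pd_entry j f y hf p q
  have h2 : HasDerivAt (fun _ : ℝ => c) 0 (y j) := hasDerivAt_const _ _
  have hc : ContinuousAt (fun t => Function.update y j t) (y j) :=
    (continuous_const.update j continuous_id).continuousAt
  have h3 : (fun t => f (Function.update y j t) p q) =ᶠ[nhds (y j)] fun _ => c := by
    have : ∀ᶠ t in nhds (y j), Function.update y j t ∈ U := by
      apply hc.eventually_mem
      rw [Function.update_eq_self]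
      exact hU.mem_nhds hy
    filter_upwards [this] with t ht
    exact h _ ht (by rw [Function.update_of_ne hij.symm, hyi])
  exact h1.unique (h2.congr_of_eventuallyEq h3)
end tang

theorem ColOK.add {O : Type*} {i : O} {X Y : Matrix O O ℝ} (hX : ColOK i X) (hY : ColOK i Y) :
    ColOK i (X + Y) := fun p hp => by rw [Matrix.add_apply, hX p hp, hY p hp, add_zero]
theorem ColOK.sub {O : Type*} {i : O} {X Y : Matrix O O ℝ} (hX : ColOK i X) (hY : ColOK i Y) :
    ColOK i (X - Y) := fun p hp => by rw [Matrix.sub_apply, hX p hp, hY p hp, sub_zero]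
theorem ColOK.smul {O : Type*} {i : O} {X : Matrix O O ℝ} (c : ℝ) (hX : ColOK i X) :
    ColOK i (c • X) := fun p hp => by rw [Matrix.smul_apply, hX p hp, smul_zero]
theorem ColOK.zero {O : Type*} {i : O} : ColOK i (0 : Matrix O O ℝ) := fun _ _ => rfl
theorem RowOnly.add {O : Type*} {i : O} {X Y : Matrix O O ℝ} (hX : RowOnly i X) (hY : RowOnly i Y) :
    RowOnly i (X + Y) := fun p hp q => by rw [Matrix.add_apply, hX p hp, hY p hp, add_zero]
theorem RowOnly.sub {O : Type*} {i : O} {X Y : Matrix O O ℝ} (hX : RowOnly i X) (hY : RowOnly i Y) :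
    RowOnly i (X - Y) := fun p hp q => by rw [Matrix.sub_apply, hX p hp, hY p hp, sub_zero]
theorem RowOnly.smul {O : Type*} {i : O} {X : Matrix O O ℝ} (c : ℝ) (hX : RowOnly i X) :
    RowOnly i (c • X) := fun p hp q => by rw [Matrix.smul_apply, hX p hp, smul_zero]
theorem RowOnly.zero {O : Type*} {i : O} : RowOnly i (0 : Matrix O O ℝ) := fun _ _ _ => rfl
theorem ColOK.mul {O : Type*} [Fintype O] {i : O} {X Y : Matrix O O ℝ} (hX : ColOK i X) (hY : ColOK i Y) :
    ColOK i (X * Y) := fun p hp => by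
  rw [Matrix.mul_apply]
  refine Finset.sum_eq_zero fun r _ => ?_
  by_cases h : r = i
  · subst h; rw [hX p hp, zero_mul]
  · rw [hY r h, mul_zero]
theorem ColOK.inv {O : Type*} [Fintype O] [DecidableEq O] {i : O} {X : Matrix O O ℝ} (hX : ColOK i X)
    (hd : X.det ≠ 0) : ColOK i X⁻¹ ∧ X⁻¹ i i * X i i = 1 := by
  have h1 : X⁻¹ * X = 1 := Matrix.nonsing_inv_mul _ (isUnit_iff_ne_zero.mpr hd)
  have h2 : ∀ p, X⁻¹ p i * X i i = if p = i then 1 else 0 := by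
    intro p
    have := congrFun (congrFun h1 p) i
    rw [Matrix.mul_apply, Finset.sum_eq_single_of_mem i (Finset.mem_univ i)
      (fun r _ hr => by rw [hX r hr, mul_zero])] at this
    rw [this, Matrix.one_apply]
  have h3 : X i i ≠ 0 := by
    intro h
    have := h2 i
    rw [h] at this
    simp at this
  refine ⟨fun p hp => ?_, by simpa using h2 i⟩
  have := h2 p
  rw [if_neg hp] at this
  exact (mul_eq_zero.mp this).resolve_right h3

namespace Loc
variable {n : ℕ} {S : Type*} [Fintype S] (D : Loc n S)

theorem sm_col (i : Fin n) (y : Fin n → ℝ) (hy : y i = 0) : ColOK (some i) (D.sm y) := by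
  intro p hp
  simp only [sm, Matrix.of_apply]
  refine Finset.sum_eq_zero fun x _ => ?_
  by_cases h : D.a x i = 0
  · simp [la, h]
  · rw [D.mo_zero x p i y hy (by simp [ex, hp, h])]; ring

theorem smk_col (k i : Fin n) (y : Fin n → ℝ) (hy : y i = 0) : ColOK (some i) (D.smk k y) := by
  intro p hp
  simp only [smk, Matrix.of_apply]
  refine Finset.sum_eq_zero fun x _ => ?_
  by_cases h : D.a x i = 0
  · simp [la, h]
  · rw [D.mo_zero x p i y hy (by simp [ex, hp, h])]; ring

theorem smk_row (i : Fin n) (y : Fin n → ℝ) (hy : y i = 0) : RowOnly (some i) (D.smk i y) := by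
  intro p hp q
  simp only [smk, Matrix.of_apply]
  refine Finset.sum_eq_zero fun x _ => ?_
  by_cases h : D.a x i = 0
  · simp [h]
  · rw [D.mo_zero x p i y hy (by simp [ex, hp, h])]; ring

theorem smk_row' (i : Fin n) (y : Fin n → ℝ) (hy : y i = 0) (q) :
    D.smk i y (some i) q = D.sm y (some i) q := by
  simp only [smk, sm, Matrix.of_apply]
  refine Finset.sum_congr rfl fun x _ => ?_
  by_cases h : D.a x i = 0
  · simp [h, la]
  · by_cases h' : D.a x i = 1
    · simp [h']
    · rw [D.mo_zero x (some i) i y hy (by simp [ex]; omega)]; ring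

theorem A_col (k i : Fin n) (y) (hyU : y ∈ D.tile.U) (hy : y i = 0) : ColOK (some i) (D.tile.A k y) :=
  ((D.sm_col i y hy).inv hyU.1).1.mul (D.smk_col k i y hy)

theorem A_row (i : Fin n) (y) (hyU : y ∈ D.tile.U) (hy : y i = 0) : RowOnly (some i) (D.tile.A i y) := by
  intro p hp q
  change ((D.sm y)⁻¹ * D.smk i y) p q = 0
  rw [Matrix.mul_apply]
  refine Finset.sum_eq_zero fun r _ => ?_
  by_cases h : r = some i
  · rw [h, ((D.sm_col i y hy).inv hyU.1).1 p hp, zero_mul]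
  · rw [D.smk_row i y hy r h, mul_zero]

theorem A_one (i : Fin n) (y) (hyU : y ∈ D.tile.U) (hy : y i = 0) :
    D.tile.A i y (some i) (some i) = 1 := by
  change ((D.sm y)⁻¹ * D.smk i y) _ _ = 1
  rw [Matrix.mul_apply, Finset.sum_eq_single_of_mem (some i) (Finset.mem_univ _)
    (fun r _ hr => by rw [D.smk_row i y hy r hr, mul_zero]), D.smk_row' i y hy]
  exact ((D.sm_col i y hy).inv hyU.1).2

theorem m_col (k i : Fin n) (y) : ColOK (some i) (D.tile.m k y) := by
  intro p hp
  change (D.mean k y • (1 : Matrix _ _ ℝ)) p (some i) = 0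
  rw [Matrix.smul_apply, Matrix.one_apply_ne hp, smul_zero]

theorem mean_zero (i : Fin n) (y : Fin n → ℝ) (hy : y i = 0) : D.mean i y = 0 := by
  unfold mean
  rw [Finset.sum_eq_zero, zero_div]
  intro x _
  by_cases h : D.a x i = 0
  · simp [h]
  · rw [D.mo_zero x none i y hy (by simp [ex, h])]; ring

theorem m_zero (i : Fin n) (y : Fin n → ℝ) (hy : y i = 0) : D.tile.m i y = 0 := by
  change (D.mean i y • (1 : Matrix _ _ ℝ)) = 0
  rw [D.mean_zero i y hy, zero_smul]

theorem A_diff (k : Fin n) (y) (hyU : y ∈ D.tile.U) : DifferentiableAt ℝ (D.tile.A k) y :=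
  (D.tile.hA k y hyU).differentiableAt (by simp)
theorem m_diff (k : Fin n) (y) (hyU : y ∈ D.tile.U) : DifferentiableAt ℝ (D.tile.m k) y :=
  (D.tile.hm k y hyU).differentiableAt (by simp)

theorem pd_N (j k : Fin n) (y) (hyU : y ∈ D.tile.U) :
    pd j (D.tile.N k) y = pd j (D.tile.A k) y - pd j (D.tile.m k) y := by
  unfold pd
  have : D.tile.N k = fun y => D.tile.A k y - D.tile.m k y := rfl
  rw [this, fderiv_fun_sub (D.A_diff k y hyU) (D.m_diff k y hyU)]
  rfl

theorem pdA_col (j k i : Fin n) (hij : j ≠ i) (y) (hyU : y ∈ D.tile.U) (hy : y i = 0) :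
    ColOK (some i) (pd j (D.tile.A k) y) := fun p hp =>
  pd_entry_const j _ y (D.A_diff k y hyU) p _ D.tile.U D.tile.hU hyU i hij 0 0 hy
    fun z hz hzi => D.A_col k i z hz hzi p hp

theorem pdA_row (j i : Fin n) (hij : j ≠ i) (y) (hyU : y ∈ D.tile.U) (hy : y i = 0) :
    RowOnly (some i) (pd j (D.tile.A i) y) := fun p hp q =>
  pd_entry_const j _ y (D.A_diff i y hyU) p q D.tile.U D.tile.hU hyU i hij 0 0 hy
    fun z hz hzi => D.A_row i z hz hzi p hp q

theorem pdA_one (j i : Fin n) (hij : j ≠ i) (y) (hyU : y ∈ D.tile.U) (hy : y i = 0) :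
    pd j (D.tile.A i) y (some i) (some i) = 0 :=
  pd_entry_const j _ y (D.A_diff i y hyU) _ _ D.tile.U D.tile.hU hyU i hij 1 0 hy
    fun z hz hzi => D.A_one i z hz hzi

theorem pdm_col (j k i : Fin n) (hij : j ≠ i) (y) (hyU : y ∈ D.tile.U) (hy : y i = 0) :
    ColOK (some i) (pd j (D.tile.m k) y) := fun p hp =>
  pd_entry_const j _ y (D.m_diff k y hyU) p _ D.tile.U D.tile.hU hyU i hij 0 0 hy
    fun z _ _ => D.m_col k i z p hp

theorem pdm_zero (j i : Fin n) (hij : j ≠ i) (y) (hyU : y ∈ D.tile.U) (hy : y i = 0) :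
    pd j (D.tile.m i) y = 0 := by
  ext p q
  exact pd_entry_const j _ y (D.m_diff i y hyU) p q D.tile.U D.tile.hU hyU i hij 0 0 hy
    fun z _ hz => by rw [D.m_zero i z hz]; rfl

theorem N_col (k i : Fin n) (y) (hyU : y ∈ D.tile.U) (hy : y i = 0) : ColOK (some i) (D.tile.N k y) :=
  (D.A_col k i y hyU hy).sub (D.m_col k i y)

/-- any row of `Mrow` other than a non-`G` row `i` is fine in column `i` -/
theorem Mrow_col (s : ℝ) (G : Finset (Fin n)) (y) (hyU : y ∈ D.tile.U) (i : Fin n) (hy : y i = 0)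
    (j k : Fin n) (hj : j ∈ G ∨ j ≠ i) : ColOK (some i) (D.tile.Mrow s G y j k) := by
  unfold TileFns.Mrow
  split_ifs with h1 h2
  · exact D.A_col j i y hyU hy
  · exact ColOK.zero
  · have hj' := hj.resolve_left h1
    rw [D.pd_N j k y hyU]
    exact (D.pdm_col j k i hj' y hyU hy).add (((D.pdA_col j k i hj' y hyU hy).sub
      (D.pdm_col j k i hj' y hyU hy)).smul s)

theorem T1 (s : ℝ) (G : Finset (Fin n)) (z) (hz : z ∈ cube n) (hzG : ∀ i ∈ G, z i = 0)
    (j : Fin n) (hj : j ∉ G) (i : Fin n) (hi : i ∈ G) :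
    alt (Lam n) (Function.update (Function.update (D.tile.Mrow s G z) j (fun k => D.tile.N k z)) i
      (D.tile.Rrow s G z j i)) = 0 := by
  have hU := D.cube_sub hz
  have hij : j ≠ i := fun h => hj (h ▸ hi)
  rw [alt_apply]
  refine Finset.sum_eq_zero fun σ _ => ?_
  by_cases h : σ i = i
  · rw [Lam_lemT i _ ?_ i, mul_zero]
    · simp only [Function.update_self, TileFns.Rrow, hi, if_true, h]
      exact D.pdA_row j i hij z hU (hzG i hi)
    · simp only [Function.update_self, TileFns.Rrow, hi, if_true, h]
      exact D.pdA_one j i hij z hU (hzG i hi)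
    · intro q
      by_cases hq : q = i
      · subst hq
        simp only [Function.update_self, TileFns.Rrow, hi, if_true, h]
        exact D.pdA_col j q q hij z hU (hzG _ hi)
      · simp only [Function.update_of_ne hq]
        by_cases hqj : q = j
        · subst hqj
          simp only [Function.update_self]
          exact D.N_col _ i z hU (hzG i hi)
        · simp only [Function.update_of_ne hqj]
          exact D.Mrow_col s G z hU i (hzG i hi) q _ (Or.inr hq)
  · rw [(Lam n).map_coord_zero i, mul_zero]
    simp [Function.update_self, TileFns.Rrow, hi, h]

theorem T2 (s : ℝ) (G : Finset (Fin n)) (z) (hz : z ∈ cube n) (hzG : ∀ i ∈ G, z i = 0)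
    (j : Fin n) (hj : j ∉ G) (hzj : z j = 0) :
    D.tile.WW (Lam n) s G j z = D.tile.FF (Lam n) s (insert j G) z := by
  have hU := D.cube_sub hz
  unfold TileFns.WW TileFns.FF
  rw [alt_apply, alt_apply]
  refine Finset.sum_congr rfl fun σ _ => ?_
  have hother : ∀ q, q ≠ j → ∀ k, D.tile.Mrow s (insert j G) z q k = D.tile.Mrow s G z q k := by
    intro q hq k
    simp [TileFns.Mrow, hq]
  by_cases h : σ j = j
  · congr 2
    funext q
    by_cases hq : q = j
    · subst hq
      simp [TileFns.Mrow, h, TileFns.N, D.m_zero q z hzj]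
    · rw [Function.update_of_ne hq, hother q hq]
  · congr 1
    have hR : Lam n (fun q => D.tile.Mrow s (insert j G) z q (σ q)) = 0 := by
      apply (Lam n).map_coord_zero j
      simp [TileFns.Mrow, h]
    rw [hR]
    set q0 := σ.symm j with hq0
    have hσ : σ q0 = j := by simp [hq0]
    have hq0j : q0 ≠ j := fun hh => h (by rw [← hh, hσ, hh])
    by_cases hq0G : q0 ∈ G
    · apply (Lam n).map_coord_zero q0
      simp [Function.update_of_ne hq0j, hσ, TileFns.Mrow, hq0G, hq0j.symm]
    · have hval : D.tile.Mrow s G z q0 j = s • pd q0 (D.tile.A j) z := by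
        simp only [TileFns.Mrow, hq0G, if_false]
        rw [D.pd_N q0 j z hU, D.pdm_zero q0 j hq0j z hU hzj]
        simp
      refine Lam_lemT j _ ?_ q0 ?_ ?_
      · intro q
        by_cases hqj : q = j
        · subst hqj
          simp only [Function.update_self]
          exact D.N_col _ q z hU hzj
        · simp only [Function.update_of_ne hqj]
          exact D.Mrow_col s G z hU j hzj q _ (Or.inr hqj)
      · simp only [Function.update_of_ne hq0j, hσ, hval]
        exact (D.pdA_row q0 j hq0j z hU hzj).smul s
      · simp only [Function.update_of_ne hq0j, hσ, hval, Matrix.smul_apply]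
        rw [D.pdA_one q0 j hq0j z hU hzj, smul_zero]
end Loc

theorem Lam_continuous (n : ℕ) : Continuous (Lam n) := by
  have : (Lam n : _ → ℝ) = fun X => ∑ τ : Equiv.Perm (Option (Fin n)),
      Matrix.det (Matrix.of fun p => ((τ p).elim 1 X : Matrix (Option (Fin n)) (Option (Fin n)) ℝ) p) := by
    funext X; rw [Lam_apply, MD_apply]
  rw [this]
  refine continuous_finsetSum _ fun τ _ => Continuous.matrix_det ?_
  refine continuous_pi fun p => ?_
  change Continuous fun X => ((τ p).elim 1 X : Matrix (Option (Fin n)) (Option (Fin n)) ℝ) p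
  rcases τ p with _ | j
  · exact continuous_const
  · exact (continuous_apply p).comp (continuous_apply j)

end

noncomputable section
open MeasureTheory Pointwise
set_option linter.unusedSectionVars false

attribute [local instance] Matrix.normedAddCommGroup Matrix.normedSpace

structure Wall {n : ℕ} {S : Type*} (D D' : Loc n S) (i : Fin n) (τ : Equiv.Perm (Fin n)) where
  c0 : ℝ
  c : Fin n → ℝ
  h1 : ∀ x, ∀ j, j ≠ i → D'.a x (τ j) = D.a x j
  h2 : ∀ x, (D'.a x (τ i) : ℝ) = - D.a x i + ∑ l ∈ Finset.univ.erase i, c l * D.a x l + c0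

namespace Wall
variable {n : ℕ} {S : Type*} [Fintype S] {D D' : Loc n S} {i : Fin n} {τ : Equiv.Perm (Fin n)}

def tr (W : Wall D D' i τ) (w : Fin n → ℝ) : Matrix (Option (Fin n)) (Option (Fin n)) ℝ := fun p r =>
  match p with
  | none => if r = none then 1 else 0
  | some k => if τ.symm k = i then
      (match r with
       | none => W.c0
       | some l => if l = i then -1 else W.c l * w l)
      else if r = some (τ.symm k) then 1 else 0

theorem tr_none (W : Wall D D' i τ) (w : Fin n → ℝ) (f : Option (Fin n) → ℝ) : ∑ r, W.tr w none r * f r = f none := by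
  simp [tr]

theorem tr_some (W : Wall D D' i τ) (w : Fin n → ℝ) (f : Option (Fin n) → ℝ) (j : Fin n) (hj : j ≠ i) :
    ∑ r, W.tr w (some (τ j)) r * f r = f (some j) := by
  simp [tr, hj]

theorem tr_i (W : Wall D D' i τ) (w : Fin n → ℝ) (f : Option (Fin n) → ℝ) :
    ∑ r, W.tr w (some (τ i)) r * f r =
      - f (some i) + ∑ l ∈ Finset.univ.erase i, W.c l * (w l * f (some l)) + W.c0 * f none := by
  rw [Fintype.sum_option, ← Finset.add_sum_erase _ _ (Finset.mem_univ i)]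
  simp only [tr, Equiv.symm_apply_apply, if_true]
  have : ∑ l ∈ Finset.univ.erase i, (if l = i then -1 else W.c l * w l) * f (some l)
      = ∑ l ∈ Finset.univ.erase i, W.c l * (w l * f (some l)) :=
    Finset.sum_congr rfl fun l hl => by rw [if_neg (Finset.ne_of_mem_erase hl)]; ring
  rw [this]; ring

theorem cases_p (τ : Equiv.Perm (Fin n)) (i : Fin n) (p : Option (Fin n)) :
    p = none ∨ p = some (τ i) ∨ ∃ j, j ≠ i ∧ p = some (τ j) := by
  rcases p with _ | k
  · simp
  · right
    by_cases h : τ.symm k = i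
    · left; rw [← h]; simp
    · right; exact ⟨_, h, by simp⟩

theorem la_tr (W : Wall D D' i τ) (x : S) (p : Option (Fin n)) : D'.la x p = ∑ r, W.tr 1 p r * D.la x r := by
  rcases cases_p τ i p with h | h | ⟨j, hj, h⟩ <;> subst h
  · rw [W.tr_none]; rfl
  · rw [W.tr_i]
    simp only [Loc.la, Option.elim, Pi.one_apply, one_mul, mul_one]
    exact W.h2 x
  · rw [W.tr_some _ _ j hj]
    simp [Loc.la, W.h1 x j hj]

theorem mo_eq (_W : Wall D D' i τ) (z : Fin n → ℝ) (hz : z i = 1) (x : S) (p p' : Option (Fin n))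
    (h : ∀ j, j ≠ i → D'.ex x p' (τ j) = D.ex x p j) :
    D'.mo x p' (fun k => z (τ.symm k)) = D.mo x p z := by
  unfold Loc.mo
  rw [← Equiv.prod_comp τ]
  refine Finset.prod_congr rfl fun j _ => ?_
  simp only [Equiv.symm_apply_apply]
  by_cases hj : j = i
  · rw [hj, hz]; simp
  · rw [h j hj]

theorem mo_none (W : Wall D D' i τ) (z : Fin n → ℝ) (hz : z i = 1) (x : S) :
    D'.mo x none (fun k => z (τ.symm k)) = D.mo x none z :=
  W.mo_eq z hz x _ _ fun j hj => by simp [Loc.ex, W.h1 x j hj]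

theorem mo_i (W : Wall D D' i τ) (z : Fin n → ℝ) (hz : z i = 1) (x : S) :
    D'.mo x (some (τ i)) (fun k => z (τ.symm k)) = D.mo x none z :=
  W.mo_eq z hz x _ _ fun j hj => by simp [Loc.ex, W.h1 x j hj, Ne.symm hj]

theorem mo_j (W : Wall D D' i τ) (z : Fin n → ℝ) (hz : z i = 1) (x : S) (j : Fin n) :
    D'.mo x (some (τ j)) (fun k => z (τ.symm k)) = D.mo x (some j) z :=
  W.mo_eq z hz x _ _ fun l hl => by simp [Loc.ex, W.h1 x l hl]

theorem la_mo (z : Fin n → ℝ) (x : S) (l : Fin n) :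
    z l * (D.la x (some l) * D.mo x (some l) z) = D.la x (some l) * D.mo x none z := by
  by_cases h : D.a x l = 0
  · simp [Loc.la, h]
  · rw [← D.mo_some_mul x l z h]; ring

theorem lamo_tr (W : Wall D D' i τ) (z : Fin n → ℝ) (hz : z i = 1) (x : S) (p : Option (Fin n)) :
    D'.la x p * D'.mo x p (fun k => z (τ.symm k)) = ∑ r, W.tr z p r * (D.la x r * D.mo x r z) := by
  rcases cases_p τ i p with h | h | ⟨j, hj, h⟩ <;> subst h
  · rw [W.tr_none, W.mo_none z hz]; rfl
  · rw [W.tr_i, W.mo_i z hz]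
    simp_rw [la_mo]
    have h1 := la_mo (D := D) z x i
    rw [hz, one_mul] at h1
    rw [h1, W.la_tr, W.tr_i]
    simp only [Pi.one_apply, one_mul]
    rw [add_mul, add_mul, Finset.sum_mul]
    simp only [mul_assoc]
    ring_nf
  · rw [W.tr_some _ _ j hj, W.mo_j z hz, W.la_tr, W.tr_some _ _ j hj]

theorem gen_tr (W : Wall D D' i τ) (z : Fin n → ℝ) (hz : z i = 1) (b : S → ℝ) (p q : Option (Fin n)) :
    ∑ x, b x * D'.la x p * D'.mo x p (fun k => z (τ.symm k)) * D'.la x q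
      = (W.tr z * (Matrix.of fun p q => ∑ x, b x * D.la x p * D.mo x p z * D.la x q) *
          (W.tr 1).transpose) p q := by
  rw [Matrix.mul_apply]
  simp_rw [Matrix.mul_apply, Matrix.transpose_apply, Matrix.of_apply]
  have : ∀ x, b x * D'.la x p * D'.mo x p (fun k => z (τ.symm k)) * D'.la x q =
      ∑ r, ∑ r', (W.tr z p r' * (b x * D.la x r' * D.mo x r' z * D.la x r)) * W.tr 1 q r := by
    intro x
    rw [mul_assoc (b x), W.lamo_tr z hz, W.la_tr x q, Finset.mul_sum, Finset.mul_sum]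
    refine Finset.sum_congr rfl fun r _ => ?_
    rw [Finset.sum_mul]
    refine Finset.sum_congr rfl fun r' _ => ?_
    ring
  simp_rw [this]
  rw [Finset.sum_comm]
  refine Finset.sum_congr rfl fun r _ => ?_
  rw [Finset.sum_comm, Finset.sum_mul]
  refine Finset.sum_congr rfl fun r' _ => ?_
  rw [Finset.mul_sum, Finset.sum_mul]

theorem sm_tr (W : Wall D D' i τ) (z : Fin n → ℝ) (hz : z i = 1) :
    D'.sm (fun k => z (τ.symm k)) = W.tr z * D.sm z * (W.tr 1).transpose := by
  ext p q
  have := W.gen_tr z hz (fun _ => 1) p q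
  simp only [one_mul] at this
  exact this

theorem smk_tr (W : Wall D D' i τ) (z : Fin n → ℝ) (hz : z i = 1) (k : Fin n) (hk : k ≠ i) :
    D'.smk (τ k) (fun k => z (τ.symm k)) = W.tr z * D.smk k z * (W.tr 1).transpose := by
  ext p q
  have := W.gen_tr z hz (fun x => D'.a x (τ k)) p q
  refine Eq.trans this ?_
  simp_rw [W.h1 _ k hk]
  rfl

theorem smi_tr (W : Wall D D' i τ) (z : Fin n → ℝ) (hz : z i = 1) :
    D'.smk (τ i) (fun k => z (τ.symm k)) = W.tr z * (- D.smk i z +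
      ∑ l ∈ Finset.univ.erase i, W.c l • D.smk l z + W.c0 • D.sm z) * (W.tr 1).transpose := by
  ext p q
  have := W.gen_tr z hz (fun x => D'.a x (τ i)) p q
  refine Eq.trans this ?_
  refine congrFun (congrFun (congrArg (fun X => W.tr z * X * (W.tr 1).transpose) ?_) p) q
  ext p q
  simp only [Matrix.of_apply, Matrix.add_apply, Matrix.neg_apply, Matrix.sum_apply,
    Matrix.smul_apply, Loc.smk, Loc.sm, smul_eq_mul, W.h2, Finset.mul_sum]
  rw [Finset.sum_comm, ← Finset.sum_neg_distrib, ← Finset.sum_add_distrib, ← Finset.sum_add_distrib]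
  refine Finset.sum_congr rfl fun x _ => ?_
  have : ∑ l ∈ Finset.univ.erase i, W.c l * (↑(D.a x l) * D.la x p * D.mo x p z * D.la x q)
    = (∑ l ∈ Finset.univ.erase i, W.c l * ↑(D.a x l)) * (D.la x p * D.mo x p z * D.la x q) := by
    rw [Finset.sum_mul]
    exact Finset.sum_congr rfl fun _ _ => by ring
  rw [this]; ring

/-- the conjugation -/
def conj (W : Wall D D' i τ) : Matrix (Option (Fin n)) (Option (Fin n)) ℝ →ₗ[ℝ] Matrix (Option (Fin n)) (Option (Fin n)) ℝ :=
  (LinearMap.mulRight ℝ (W.tr 1).transpose).comp (LinearMap.mulLeft ℝ ((W.tr 1).transpose)⁻¹)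

theorem conj_apply (W : Wall D D' i τ) (X) : W.conj X = ((W.tr 1).transpose)⁻¹ * X * (W.tr 1).transpose := rfl

theorem dets (W : Wall D D' i τ) (z : Fin n → ℝ) (hz : z i = 1) (hU : (fun k => z (τ.symm k)) ∈ D'.tile.U) :
    (W.tr z).det ≠ 0 ∧ (D.sm z).det ≠ 0 ∧ (W.tr 1).transpose.det ≠ 0 := by
  have := hU.1
  rw [W.sm_tr z hz, Matrix.det_mul, Matrix.det_mul] at this
  exact ⟨left_ne_zero_of_mul (left_ne_zero_of_mul this), right_ne_zero_of_mul
    (left_ne_zero_of_mul this), right_ne_zero_of_mul this⟩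

theorem conj_gen (W : Wall D D' i τ) (z : Fin n → ℝ) (hz : z i = 1) (hU : (fun k => z (τ.symm k)) ∈ D'.tile.U) (X) :
    (D'.sm (fun k => z (τ.symm k)))⁻¹ * (W.tr z * X * (W.tr 1).transpose) =
      W.conj ((D.sm z)⁻¹ * X) := by
  obtain ⟨h1, h2, h3⟩ := W.dets z hz hU
  rw [W.sm_tr z hz, Matrix.mul_inv_rev, Matrix.mul_inv_rev, conj_apply]
  have : (W.tr z)⁻¹ * W.tr z = 1 := Matrix.nonsing_inv_mul _ (isUnit_iff_ne_zero.mpr h1)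
  simp only [Matrix.mul_assoc]
  rw [← Matrix.mul_assoc (W.tr z)⁻¹, this, Matrix.one_mul]

theorem A_tr (W : Wall D D' i τ) (z : Fin n → ℝ) (hz : z i = 1) (hU : (fun k => z (τ.symm k)) ∈ D'.tile.U)
    (k : Fin n) (hk : k ≠ i) :
    D'.tile.A (τ k) (fun k => z (τ.symm k)) = W.conj (D.tile.A k z) := by
  change (D'.sm _)⁻¹ * D'.smk (τ k) _ = _
  rw [W.smk_tr z hz k hk, W.conj_gen z hz hU]; rfl

theorem A_tri (W : Wall D D' i τ) (z : Fin n → ℝ) (hz : z i = 1) (hU : (fun k => z (τ.symm k)) ∈ D'.tile.U) :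
    D'.tile.A (τ i) (fun k => z (τ.symm k)) = W.conj (- D.tile.A i z
      + ∑ l ∈ Finset.univ.erase i, W.c l • D.tile.A l z + W.c0 • 1) := by
  change (D'.sm _)⁻¹ * D'.smk (τ i) _ = _
  rw [W.smi_tr z hz, W.conj_gen z hz hU]
  congr 1
  rw [Matrix.mul_add, Matrix.mul_add, Matrix.mul_neg, Matrix.mul_sum, Matrix.mul_smul,
    Matrix.nonsing_inv_mul _ (isUnit_iff_ne_zero.mpr (W.dets z hz hU).2.1)]
  simp_rw [Matrix.mul_smul]
  rfl

theorem conj_one (W : Wall D D' i τ) (z : Fin n → ℝ) (hz : z i = 1) (hU : (fun k => z (τ.symm k)) ∈ D'.tile.U) :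
    W.conj 1 = 1 := by
  rw [conj_apply, Matrix.mul_one]
  exact Matrix.nonsing_inv_mul _ (isUnit_iff_ne_zero.mpr (W.dets z hz hU).2.2)

theorem tot_tr (W : Wall D D' i τ) (z : Fin n → ℝ) (hz : z i = 1) : D'.tot (fun k => z (τ.symm k)) = D.tot z := by
  unfold Loc.tot
  simp_rw [W.mo_none z hz]

theorem m_tr (W : Wall D D' i τ) (z : Fin n → ℝ) (hz : z i = 1) (hU : (fun k => z (τ.symm k)) ∈ D'.tile.U)
    (k : Fin n) (hk : k ≠ i) :
    D'.tile.m (τ k) (fun k => z (τ.symm k)) = W.conj (D.tile.m k z) := by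
  change D'.mean _ _ • (1 : Matrix _ _ ℝ) = W.conj (D.mean _ _ • (1 : Matrix _ _ ℝ))
  rw [map_smul, W.conj_one z hz hU]
  congr 1
  unfold Loc.mean
  rw [W.tot_tr z hz]
  simp_rw [W.h1 _ k hk, W.mo_none z hz]

theorem m_tri (W : Wall D D' i τ) (z : Fin n → ℝ) (hz : z i = 1) (hU : (fun k => z (τ.symm k)) ∈ D'.tile.U) :
    D'.tile.m (τ i) (fun k => z (τ.symm k)) = W.conj (- D.tile.m i z
      + ∑ l ∈ Finset.univ.erase i, W.c l • D.tile.m l z + W.c0 • 1) := by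
  have ht : D.tot z ≠ 0 := by rw [← W.tot_tr z hz]; exact hU.2
  have h1 : D'.mean (τ i) (fun k => z (τ.symm k)) = - D.mean i z
      + ∑ l ∈ Finset.univ.erase i, W.c l * D.mean l z + W.c0 := by
    unfold Loc.mean
    rw [W.tot_tr z hz]
    simp_rw [W.h2, W.mo_none z hz]
    rw [div_eq_iff ht, add_mul, add_mul, Finset.sum_mul]
    have e1 : ∀ l, W.c l * ((∑ x, (D.a x l : ℝ) * D.mo x none z) / D.tot z) * D.tot z
      = ∑ x, W.c l * (D.a x l * D.mo x none z) := by
      intro l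
      rw [mul_assoc, div_mul_cancel₀ _ ht, Finset.mul_sum]
    simp_rw [e1]
    rw [neg_mul, div_mul_cancel₀ _ ht, Finset.sum_comm, Loc.tot, Finset.mul_sum,
      ← Finset.sum_neg_distrib, ← Finset.sum_add_distrib, ← Finset.sum_add_distrib]
    refine Finset.sum_congr rfl fun x _ => ?_
    rw [add_mul, add_mul, Finset.sum_mul]
    congr 2
    · ring
    · exact Finset.sum_congr rfl fun _ _ => by ring
  change D'.mean _ _ • (1 : Matrix _ _ ℝ) = W.conj (- (D.mean i z • (1 : Matrix _ _ ℝ))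
      + ∑ l ∈ Finset.univ.erase i, W.c l • (D.mean l z • (1 : Matrix _ _ ℝ)) + W.c0 • 1)
  have h2 : (- (D.mean i z • (1 : Matrix (Option (Fin n)) (Option (Fin n)) ℝ))
      + ∑ l ∈ Finset.univ.erase i, W.c l • (D.mean l z • (1 : Matrix _ _ ℝ)) + W.c0 • 1)
      = D'.mean (τ i) (fun k => z (τ.symm k)) • 1 := by
    rw [h1, add_smul, add_smul, neg_smul, Finset.sum_smul]
    simp_rw [smul_smul]
  rw [h2, map_smul, W.conj_one z hz hU]

theorem N_tr (W : Wall D D' i τ) (z : Fin n → ℝ) (hz : z i = 1) (hU : (fun k => z (τ.symm k)) ∈ D'.tile.U)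
    (k : Fin n) (hk : k ≠ i) :
    D'.tile.N (τ k) (fun k => z (τ.symm k)) = W.conj (D.tile.N k z) := by
  unfold TileFns.N
  rw [W.A_tr z hz hU k hk, W.m_tr z hz hU k hk, map_sub]

theorem N_tri (W : Wall D D' i τ) (z : Fin n → ℝ) (hz : z i = 1) (hU : (fun k => z (τ.symm k)) ∈ D'.tile.U) :
    D'.tile.N (τ i) (fun k => z (τ.symm k)) = W.conj (- D.tile.N i z
      + ∑ l ∈ Finset.univ.erase i, W.c l • D.tile.N l z) := by
  unfold TileFns.N
  rw [W.A_tri z hz hU, W.m_tri z hz hU, ← map_sub]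
  congr 1
  simp_rw [smul_sub]
  rw [Finset.sum_sub_distrib]
  abel

theorem perm_update (z : Fin n → ℝ) (j : Fin n) (t : ℝ) :
    Function.update (fun k => z (τ.symm k)) (τ j) t = fun k => Function.update z j t (τ.symm k) := by
  funext k
  by_cases h : k = τ j
  · subst h; simp
  · have h' : τ.symm k ≠ j := fun hh => h ((Equiv.symm_apply_eq _).mp hh)
    rw [Function.update_of_ne h, Function.update_of_ne h']

theorem conj_cont (W : Wall D D' i τ) : Continuous W.conj := LinearMap.continuous_of_finiteDimensional _

/-- transfer of tangential derivatives -/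
theorem pd_tr (W : Wall D D' i τ) (z : Fin n → ℝ) (hz : z i = 1) (hU : (fun k => z (τ.symm k)) ∈ D'.tile.U)
    (j : Fin n) (hj : j ≠ i) (f' f : (Fin n → ℝ) → Matrix (Option (Fin n)) (Option (Fin n)) ℝ)
    (hf' : DifferentiableAt ℝ f' (fun k => z (τ.symm k))) (X)
    (hf : HasDerivAt (fun t => f (Function.update z j t)) X (z j))
    (h : ∀ z, z i = 1 → (fun k => z (τ.symm k)) ∈ D'.tile.U → f' (fun k => z (τ.symm k)) = W.conj (f z)) :
    pd (τ j) f' (fun k => z (τ.symm k)) = W.conj X := by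
  have h1 := pd_hasDerivAt (τ j) f' _ hf'
  simp only [Equiv.symm_apply_apply] at h1
  let Φ : Matrix (Option (Fin n)) (Option (Fin n)) ℝ →L[ℝ] Matrix (Option (Fin n)) (Option (Fin n)) ℝ :=
    ⟨W.conj, W.conj_cont⟩
  have h2 : HasDerivAt (fun t => Φ (f (Function.update z j t))) (Φ X) (z j) := Φ.hasFDerivAt.comp_hasDerivAt _ hf
  refine h1.unique (h2.congr_of_eventuallyEq ?_)
  have hc : ContinuousAt (fun t => Function.update (fun k => z (τ.symm k)) (τ j) t) (z j) :=
    (continuous_const.update _ continuous_id).continuousAt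
  have : ∀ᶠ t in nhds (z j), Function.update (fun k => z (τ.symm k)) (τ j) t ∈ D'.tile.U := by
    apply hc.eventually_mem
    rw [perm_update, Function.update_eq_self]
    exact D'.tile.hU.mem_nhds hU
  filter_upwards [this] with t ht
  rw [perm_update] at ht ⊢
  exact h _ (by rw [Function.update_of_ne hj.symm, hz]) ht

theorem T3 (W : Wall D D' i τ) (s : ℝ) (G : Finset (Fin n)) (z) (hzc : z ∈ cube n) (hzG : ∀ i ∈ G, z i = 0)
    (hiG : i ∉ G) (hz : z i = 1) :
    D'.tile.WW (Lam n) s (G.map τ.toEmbedding) (τ i) (fun k => z (τ.symm k))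
      = - D.tile.WW (Lam n) s G i z := by
  classical
  have hzU := D.cube_sub hzc
  have hU : (fun k => z (τ.symm k)) ∈ D'.tile.U := D'.cube_sub (by
    rw [mem_cube] at hzc ⊢; exact fun j => hzc _)
  set M := Function.update (D.tile.Mrow s G z) i (fun k => D.tile.N k z) with hM
  set Y : Fin n → Matrix (Option (Fin n)) (Option (Fin n)) ℝ := fun j =>
    if j ∈ G then 0 else ∑ l ∈ G, W.c l • M j l with hY
  set S' : Finset (Fin n) := Finset.univ.erase i \ G with hS'
  have hYz : alt (Lam n) (fun j k => if k = i then Y j else M j k) = 0 := by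
    rw [alt_apply]
    refine Finset.sum_eq_zero fun σ _ => ?_
    set j0 := σ.symm i with hj0
    have hσ : σ j0 = i := by simp [hj0]
    have hX : ∀ Z, Function.update (fun j => if σ j = i then Y j else M j (σ j)) j0 Z
        = fun j => if j = j0 then Z else M j (σ j) := by
      intro Z
      funext j
      by_cases h : j = j0
      · subst h; simp
      · rw [Function.update_of_ne h]
        have : σ j ≠ i := fun hh => h (by rw [hj0, ← hh]; simp)
        simp [this, h]
    have hX0 : (fun j => if σ j = i then Y j else M j (σ j)) =
        Function.update (fun j => if σ j = i then Y j else M j (σ j)) j0 (Y j0) := by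
      conv_lhs => rw [← Function.update_eq_self j0 (fun j => if σ j = i then Y j else M j (σ j))]
      simp only [hσ, if_true]
    rw [hX0]
    by_cases hj0G : j0 ∈ G
    · have : Y j0 = 0 := by simp [hY, hj0G]
      rw [this, (Lam n).map_update_zero, mul_zero]
    · have : Y j0 = ∑ l ∈ G, W.c l • M j0 l := by simp [hY, hj0G]
      rw [this, (Lam n).map_update_sum, Finset.sum_eq_zero, mul_zero]
      intro l hl
      rw [(Lam n).map_update_smul, hX]
      have hlj : l ≠ j0 := fun h => hj0G (h ▸ hl)
      have hli : l ≠ i := fun h => hiG (h ▸ hl)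
      rw [Lam_lemR l _ j0 l hlj.symm, smul_zero]
      · simp only [if_true]
        by_cases h : j0 = i
        · rw [hM, h, Function.update_self]
          simp only [TileFns.N, D.m_zero l z (hzG l hl), sub_zero]
          exact D.A_row l z hzU (hzG l hl)
        · rw [hM, Function.update_of_ne h]
          simp only [TileFns.Mrow, hj0G, if_false]
          rw [D.pd_N j0 l z hzU, D.pdm_zero j0 l hlj.symm z hzU (hzG l hl), sub_zero, zero_add]
          exact (D.pdA_row j0 l hlj.symm z hzU (hzG l hl)).smul s
      · simp only [hlj, if_false]
        rw [hM, Function.update_of_ne hli]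
        simp only [TileFns.Mrow, hl, if_true]
        split_ifs
        · exact D.A_row l z hzU (hzG l hl)
        · exact RowOnly.zero
  have key := alt_col_neg (Lam n) i W.c M Y S' (by simp [hS']) hYz
  unfold TileFns.WW
  rw [← hM, ← key]
  refine Eq.trans ?_ (alt_map (Lam n) W.conj (fun X => by
    simp only [conj_apply]
    exact Lam_conj _ _ (Matrix.nonsing_inv_mul _ (isUnit_iff_ne_zero.mpr (W.dets z hz hU).2.2)) X) _)
  rw [← alt_conjperm (Lam n) Lam_perm _ τ]
  congr 1
  funext j k
  have hsplit : ∀ f : Fin n → Matrix (Option (Fin n)) (Option (Fin n)) ℝ,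
      ∑ l ∈ S', f l + ∑ l ∈ G, f l = ∑ l ∈ Finset.univ.erase i, f l := by
    intro f
    have hsub : G ⊆ Finset.univ.erase i := fun l hl =>
      Finset.mem_erase.mpr ⟨fun h => hiG (h ▸ hl), Finset.mem_univ _⟩
    rw [hS', Finset.sum_sdiff hsub]
  by_cases hji : j = i
  · subst hji
    rw [Function.update_self]
    simp only [hM, Function.update_self]
    by_cases hk : k = j
    · subst hk
      rw [if_pos rfl, W.N_tri z hz hU, hY]
      simp only [hiG, if_false, hM, Function.update_self]
      rw [add_assoc, hsplit]
    · rw [if_neg hk, W.N_tr z hz hU k hk]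
  · have hτ : τ j ≠ τ i := fun h => hji (τ.injective h)
    rw [Function.update_of_ne hτ]
    by_cases hjG : j ∈ G
    · have hjG' : τ j ∈ G.map τ.toEmbedding := Finset.mem_map_of_mem _ hjG
      simp only [TileFns.Mrow, hjG', if_true, τ.injective.eq_iff]
      by_cases hk : k = i
      · subst hk
        simp only [hM, Function.update_of_ne hji, Function.update_self, Ne.symm hji, if_false,
          if_true, hY, hjG, TileFns.Mrow]
        rw [Finset.sum_eq_zero, neg_zero, zero_add, zero_add, map_zero]
        intro l hl
        have : l ≠ j := fun h => (Finset.mem_sdiff.mp hl).2 (h ▸ hjG)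
        simp [this]
      · simp only [hM, Function.update_of_ne hji, hk, if_false, TileFns.Mrow, hjG, if_true]
        split_ifs with h
        · exact W.A_tr z hz hU j hji
        · rw [map_zero]
    · have hjG' : τ j ∉ G.map τ.toEmbedding := by simp [hjG]
      simp only [TileFns.Mrow, hjG', if_false]
      rw [D'.pd_N _ _ _ hU]
      by_cases hk : k = i
      · subst hk
        have e1 : pd (τ j) (D'.tile.A (τ k)) (fun k => z (τ.symm k)) = W.conj
            (- pd j (D.tile.A k) z + ∑ l ∈ Finset.univ.erase k, W.c l • pd j (D.tile.A l) z) := by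
          refine W.pd_tr z hz hU j hji _ (fun z => - D.tile.A k z
            + ∑ l ∈ Finset.univ.erase k, W.c l • D.tile.A l z + W.c0 • 1) (D'.A_diff _ _ hU) _ ?_
            (fun z hz hU => W.A_tri z hz hU)
          refine HasDerivAt.add_const _ ?_
          refine HasDerivAt.add (pd_hasDerivAt j _ z (D.A_diff k z hzU)).neg ?_
          exact HasDerivAt.fun_sum fun l _ => (pd_hasDerivAt j _ z (D.A_diff l z hzU)).fun_const_smul _
        have e2 : pd (τ j) (D'.tile.m (τ k)) (fun k => z (τ.symm k)) = W.conj
            (- pd j (D.tile.m k) z + ∑ l ∈ Finset.univ.erase k, W.c l • pd j (D.tile.m l) z) := by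
          refine W.pd_tr z hz hU j hji _ (fun z => - D.tile.m k z
            + ∑ l ∈ Finset.univ.erase k, W.c l • D.tile.m l z + W.c0 • 1) (D'.m_diff _ _ hU) _ ?_
            (fun z hz hU => W.m_tri z hz hU)
          refine HasDerivAt.add_const _ ?_
          refine HasDerivAt.add (pd_hasDerivAt j _ z (D.m_diff k z hzU)).neg ?_
          exact HasDerivAt.fun_sum fun l _ => (pd_hasDerivAt j _ z (D.m_diff l z hzU)).fun_const_smul _
        rw [e1, e2, if_pos rfl, hY]
        simp only [hjG, if_false]
        rw [add_assoc, hsplit, ← map_sub, ← map_smul, ← map_add]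
        congr 1
        have e3 : ∀ l, M j l = pd j (D.tile.m l) z + s • (pd j (D.tile.A l) z - pd j (D.tile.m l) z) := by
          intro l
          simp only [hM, Function.update_of_ne hji, TileFns.Mrow, hjG, if_false]
          rw [D.pd_N j l z hzU]
        simp_rw [e3]
        simp only [smul_add, smul_sub, Finset.sum_add_distrib, Finset.sum_sub_distrib,
          Finset.smul_sum, smul_comm s, smul_neg]
        abel
      · rw [if_neg hk]
        have e1 := W.pd_tr z hz hU j hji _ (fun z => D.tile.A k z) (D'.A_diff _ _ hU) _
            (pd_hasDerivAt j _ z (D.A_diff k z hzU)) (fun z hz hU => W.A_tr z hz hU k hk)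
        have e2 := W.pd_tr z hz hU j hji _ (fun z => D.tile.m k z) (D'.m_diff _ _ hU) _
            (pd_hasDerivAt j _ z (D.m_diff k z hzU)) (fun z hz hU => W.m_tr z hz hU k hk)
        rw [e1, e2, ← map_sub, ← map_smul, ← map_add]
        simp only [hM, Function.update_of_ne hji, TileFns.Mrow, hjG, if_false]
        rw [D.pd_N j k z hzU]
end Wall

/-- global combinatorial data -/
structure Comb (n : ℕ) (S ι : Type*) where
  D : ι → Loc n S
  nb : ι → Fin n → ι
  tau : ι → Fin n → Equiv.Perm (Fin n)
  nb_nb : ∀ v i, nb (nb v i) (tau v i i) = v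
  tau_tau : ∀ v i, tau (nb v i) (tau v i i) = (tau v i)⁻¹
  wall : ∀ v i, Wall (D v) (D (nb v i)) i (tau v i)

def Comb.glob {n : ℕ} {S ι : Type*} [Fintype S] (C : Comb n S ι) :
    Glob n (Matrix (Option (Fin n)) (Option (Fin n)) ℝ) ι (Lam n) where
  D v := (C.D v).tile
  hcube v := (C.D v).cube_sub
  hc := Lam_continuous n
  hL := Lam_perm
  nb := C.nb
  tau := C.tau
  nb_nb := C.nb_nb
  tau_tau := C.tau_tau
  hT1 v s G z hz hG j hj i hi := (C.D v).T1 s G z hz hG j hj i hi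
  hT2 v s G z hz hG j hj h := (C.D v).T2 s G z hz hG j hj h
  hT3 v s G z hz hG j hj h := (C.wall v j).T3 s G z hz hG hj h
end

noncomputable section
open MeasureTheory Pointwise
set_option linter.unusedSectionVars false

namespace Loc
variable {n : ℕ} {S : Type*} [Fintype S] (D : Loc n S)

def jac (y : Fin n → ℝ) : Matrix (Fin n) (Fin n) ℝ := Matrix.of fun j k => pd j (D.mean k) y

theorem mo_update (x : S) (j : Fin n) (y : Fin n → ℝ) (t : ℝ) :
    D.mo x none (Function.update y j t) = t ^ D.a x j * ∏ i ∈ Finset.univ.erase j, y i ^ D.a x i := by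
  rw [D.mo_none, ← Finset.mul_prod_erase _ _ (Finset.mem_univ j), Function.update_self]
  congr 1
  exact Finset.prod_congr rfl fun i hi => by rw [Function.update_of_ne (Finset.ne_of_mem_erase hi)]

theorem mo_hasDerivAt (x : S) (j : Fin n) (y : Fin n → ℝ) :
    HasDerivAt (fun t => D.mo x none (Function.update y j t)) (D.a x j * D.mo x (some j) y) (y j) := by
  simp_rw [D.mo_update]
  have h := (hasDerivAt_pow (D.a x j) (y j)).mul_const (∏ i ∈ Finset.univ.erase j, y i ^ D.a x i)
  refine h.congr_deriv ?_
  rw [mul_assoc]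
  congr 1
  unfold mo
  rw [← Finset.mul_prod_erase _ _ (Finset.mem_univ j)]
  congr 1
  · simp [ex]
  · exact Finset.prod_congr rfl fun i hi => by simp [ex, (Finset.ne_of_mem_erase hi).symm]

theorem a_mo (x : S) (j : Fin n) (y : Fin n → ℝ) :
    y j * ((D.a x j : ℝ) * D.mo x (some j) y) = D.a x j * D.mo x none y := by
  by_cases h : D.a x j = 0
  · simp [h]
  · rw [← D.mo_some_mul x j y h]; ring

theorem sum_hasDerivAt (b : S → ℝ) (j : Fin n) (y : Fin n → ℝ) :
    HasDerivAt (fun t => ∑ x, b x * D.mo x none (Function.update y j t))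
      (∑ x, b x * (D.a x j * D.mo x (some j) y)) (y j) :=
  HasDerivAt.fun_sum fun x _ => (D.mo_hasDerivAt x j y).const_mul _

theorem pd_mean (j k : Fin n) (y : Fin n → ℝ) (ht : D.tot y ≠ 0) :
    y j * pd j (D.mean k) y = ∑ x, (D.mo x none y / D.tot y) *
      (((D.a x j : ℝ) - D.mean j y) * (D.a x k - D.mean k y)) := by
  have hd : DifferentiableAt ℝ (D.mean k) y := (D.mean_contDiffAt k y ht).differentiableAt (by simp)
  have h1 := pd_hasDerivAt j (D.mean k) y hd
  have h2 := D.sum_hasDerivAt (fun x => D.a x k) j y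
  have h3 := D.sum_hasDerivAt (fun x => 1) j y
  simp only [one_mul] at h3
  have h4 := h2.div h3 (by rw [Function.update_eq_self]; exact ht)
  have h5 := h1.unique h4
  rw [h5]
  simp only [Function.update_eq_self]
  have ht' : (∑ x, D.mo x none y) = D.tot y := rfl
  rw [ht']
  have ek : ∑ x, (D.a x k : ℝ) * D.mo x none y = D.mean k y * D.tot y := by
    unfold mean; rw [div_mul_cancel₀ _ ht]
  have ej : ∑ x, (D.a x j : ℝ) * D.mo x none y = D.mean j y * D.tot y := by
    unfold mean; rw [div_mul_cancel₀ _ ht]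
  have e1 : y j * ∑ x, (D.a x k : ℝ) * (D.a x j * D.mo x (some j) y) =
      ∑ x, (D.a x k : ℝ) * (D.a x j * D.mo x none y) := by
    rw [Finset.mul_sum]
    refine Finset.sum_congr rfl fun x _ => ?_
    rw [← D.a_mo]; ring
  have e2 : y j * ∑ x, ((D.a x j : ℝ) * D.mo x (some j) y) = D.mean j y * D.tot y := by
    rw [Finset.mul_sum, ← ej]
    refine Finset.sum_congr rfl fun x _ => ?_
    rw [← D.a_mo]
  rw [ek]
  have e3 : ∑ x, D.mo x none y / D.tot y * (((D.a x j : ℝ) - D.mean j y) * (D.a x k - D.mean k y))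
      = (∑ x, (D.a x k : ℝ) * (D.a x j * D.mo x none y)) / D.tot y - D.mean j y * D.mean k y := by
    have : ∀ x, D.mo x none y / D.tot y * (((D.a x j : ℝ) - D.mean j y) * (D.a x k - D.mean k y))
      = ((D.a x k : ℝ) * (D.a x j * D.mo x none y)) / D.tot y
        - D.mean j y * ((D.a x k : ℝ) * D.mo x none y) / D.tot y
        - D.mean k y * ((D.a x j : ℝ) * D.mo x none y) / D.tot y
        + D.mean j y * D.mean k y * (D.mo x none y / D.tot y) := fun x => by ring
    simp_rw [this]
    rw [Finset.sum_add_distrib, Finset.sum_sub_distrib, Finset.sum_sub_distrib,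
      ← Finset.sum_div, ← Finset.sum_div, ← Finset.sum_div, ← Finset.mul_sum, ← Finset.mul_sum,
      ← Finset.mul_sum, ← Finset.sum_div, ek, ej, ht']
    field_simp
    ring
  rw [e3, ← e1]
  have : y j * (((∑ x, (D.a x k : ℝ) * (D.a x j * D.mo x (some j) y)) * D.tot y -
      D.mean k y * D.tot y * ∑ x, (D.a x j : ℝ) * D.mo x (some j) y) / D.tot y ^ 2) =
      ((y j * ∑ x, (D.a x k : ℝ) * (D.a x j * D.mo x (some j) y)) * D.tot y -
      D.mean k y * D.tot y * (y j * ∑ x, (D.a x j : ℝ) * D.mo x (some j) y)) / D.tot y ^ 2 := by ring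
  rw [this, e2]
  field_simp

theorem jac_nonneg (y : Fin n → ℝ) (hy : ∀ j, 0 < y j) : 0 ≤ (D.jac y).det := by
  have ht := D.tot_pos y fun j => (hy j).le
  have h1 : Matrix.diagonal y * D.jac y =
      (Matrix.of fun (x : S) (j : Fin n) => Real.sqrt (D.mo x none y / D.tot y) * (D.a x j - D.mean j y)).conjTranspose
       * (Matrix.of fun (x : S) (j : Fin n) => Real.sqrt (D.mo x none y / D.tot y) * (D.a x j - D.mean j y)) := by
    ext j k
    rw [Matrix.diagonal_mul, jac, Matrix.of_apply, D.pd_mean j k y ht.ne', Matrix.mul_apply]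
    refine Finset.sum_congr rfl fun x _ => ?_
    simp only [Matrix.conjTranspose_apply, Matrix.of_apply, star_trivial]
    have : D.mo x none y / D.tot y = Real.sqrt (D.mo x none y / D.tot y) * Real.sqrt (D.mo x none y / D.tot y) :=
      (Real.mul_self_sqrt (div_nonneg (D.mo_nonneg x _ y fun j => (hy j).le) ht.le)).symm
    conv_lhs => rw [this]
    ring
  have h2 := (Matrix.posSemidef_conjTranspose_mul_self (Matrix.of fun (x : S) (j : Fin n) =>
    Real.sqrt (D.mo x none y / D.tot y) * (D.a x j - D.mean j y))).det_nonneg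
  rw [← h1, Matrix.det_mul, Matrix.det_diagonal] at h2
  exact nonneg_of_mul_nonneg_right h2 (Finset.prod_pos fun j _ => hy j)

theorem mean_hasFDerivAt (k : Fin n) (y : Fin n → ℝ) (ht : D.tot y ≠ 0) :
    HasFDerivAt (D.mean k) (fderiv ℝ (D.mean k) y) y :=
  ((D.mean_contDiffAt k y ht).differentiableAt (by simp)).hasFDerivAt

theorem fderiv_eq (k : Fin n) (y v : Fin n → ℝ) :
    fderiv ℝ (D.mean k) y v = ∑ j, v j * pd j (D.mean k) y := by
  conv_lhs => rw [pi_eq_sum_univ' v]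
  rw [map_sum]
  refine Finset.sum_congr rfl fun j _ => ?_
  rw [map_smul, smul_eq_mul]
  congr 2

end Loc
end

noncomputable section
open MeasureTheory Pointwise
set_option linter.unusedSectionVars false

/-- data of a tiling of a full dimensional polytope by vertex charts -/
structure Tiling (d : ℕ) (S ι : Type*) where
  D : ι → Loc d S
  b : S → Fin d → ℝ
  W : ι → Matrix (Fin d) (Fin d) ℝ
  hb : ∀ v x, b x - b (D v).o = (W v).mulVec (fun j => ((D v).a x j : ℝ))
  hW : ∀ v, |(W v).det| = 1
  inj : ∀ v v', b (D v).o = b (D v').o → v = v'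
  hmax : ∀ u : Fin d → ℝ, ∃ v, ∀ x, dotProduct u (b x) ≤ dotProduct u (b (D v).o)

namespace Tiling
variable {d : ℕ} {S ι : Type*} [Fintype S] [Fintype ι] (T : Tiling d S ι)

def Gib (u p : Fin d → ℝ) : Prop := ∑ x, Real.exp (dotProduct u (T.b x)) • (T.b x - p) = 0

def kap (v : ι) (y : Fin d → ℝ) : Fin d → ℝ :=
  T.b (T.D v).o + (T.W v).mulVec (fun k => (T.D v).mean k y)

def uu (v : ι) (y : Fin d → ℝ) : Fin d → ℝ := Matrix.vecMul (fun j => Real.log (y j)) (T.W v)⁻¹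

theorem detW (v : ι) : IsUnit (T.W v).det := by
  rw [isUnit_iff_ne_zero]; intro h; have := T.hW v; rw [h] at this; simp at this

theorem uu_W (v : ι) (y : Fin d → ℝ) : Matrix.vecMul (T.uu v y) (T.W v) = fun j => Real.log (y j) := by
  unfold uu
  rw [Matrix.vecMul_vecMul, Matrix.nonsing_inv_mul _ (T.detW v), Matrix.vecMul_one]

theorem dot_b (v : ι) (u : Fin d → ℝ) (x : S) : dotProduct u (T.b x) = dotProduct u (T.b (T.D v).o)
    + ∑ j, Matrix.vecMul u (T.W v) j * (T.D v).a x j := by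
  have h := congrArg (dotProduct u) (T.hb v x)
  rw [dotProduct_sub, Matrix.dotProduct_mulVec] at h
  have : dotProduct (Matrix.vecMul u (T.W v)) (fun j => ((T.D v).a x j : ℝ)) = 
    ∑ j, Matrix.vecMul u (T.W v) j * (T.D v).a x j := rfl
  rw [this] at h; linarith

theorem exp_dot (v : ι) (u y : Fin d → ℝ) (hy : ∀ j, y j = Real.exp (Matrix.vecMul u (T.W v) j)) (x : S) :
    Real.exp (dotProduct u (T.b x)) = Real.exp (dotProduct u (T.b (T.D v).o)) * (T.D v).mo x none y := by
  rw [T.dot_b v, Real.exp_add, (T.D v).mo_none, Real.exp_sum]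
  congr 1
  refine Finset.prod_congr rfl fun j _ => ?_
  rw [hy j, ← Real.exp_nat_mul, mul_comm]

theorem gibbs (v : ι) (u y : Fin d → ℝ) (hy : ∀ j, y j = Real.exp (Matrix.vecMul u (T.W v) j)) :
    T.Gib u (T.kap v y) := by
  unfold Gib
  have ht := (T.D v).tot_pos y fun j => by rw [hy j]; exact (Real.exp_pos _).le
  have e : ∀ x, T.b x - T.kap v y = (T.W v).mulVec (fun j => ((T.D v).a x j : ℝ) - (T.D v).mean j y) := by
    intro x
    have := T.hb v x
    unfold kap
    rw [show (fun j => ((T.D v).a x j : ℝ) - (T.D v).mean j y) = (fun j => ((T.D v).a x j : ℝ)) - 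
      (fun j => (T.D v).mean j y) from rfl, Matrix.mulVec_sub, ← this]
    abel
  have e2 : ∀ x, Real.exp (dotProduct u (T.b x)) • (T.b x - T.kap v y) =
      Real.exp (dotProduct u (T.b (T.D v).o)) • (T.W v).mulVec ((T.D v).mo x none y •
        (fun j => ((T.D v).a x j : ℝ) - (T.D v).mean j y)) := by
    intro x
    rw [e, T.exp_dot v u y hy, mul_smul, Matrix.mulVec_smul]
  rw [Finset.sum_congr rfl fun x _ => e2 x, ← Finset.smul_sum, ← Matrix.mulVec_sum]
  have : ∑ x, (T.D v).mo x none y • (fun j => ((T.D v).a x j : ℝ) - (T.D v).mean j y) = 0 := by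
    funext k
    rw [Finset.sum_apply]
    simp only [Pi.smul_apply, smul_eq_mul, Pi.zero_apply, mul_sub, Finset.sum_sub_distrib]
    rw [← Finset.sum_mul]
    have : (∑ x, (T.D v).mo x none y) * (T.D v).mean k y = ∑ x, ((T.D v).a x k : ℝ) * (T.D v).mo x none y := by
      unfold Loc.mean
      exact mul_div_cancel₀ _ ht.ne'
    rw [this, sub_eq_zero]
    exact Finset.sum_congr rfl fun x _ => mul_comm _ _
  rw [this]; simp

theorem gib_p [Nonempty S] (u p q : Fin d → ℝ) (hp : T.Gib u p) (hq : T.Gib u q) : p = q := by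
  unfold Gib at hp hq
  simp_rw [smul_sub, Finset.sum_sub_distrib, ← Finset.sum_smul] at hp hq
  rw [sub_eq_zero] at hp hq
  have h := hp.symm.trans hq
  have hpos : 0 < ∑ x, Real.exp (dotProduct u (T.b x)) :=
    Finset.sum_pos (fun x _ => Real.exp_pos _) Finset.univ_nonempty
  exact smul_right_injective _ hpos.ne' h

theorem span (v : ι) (w : Fin d → ℝ) (h : ∀ x y, dotProduct w (T.b x) = dotProduct w (T.b y)) : w = 0 := by
  have h2 : Matrix.vecMul w (T.W v) = 0 := by
    funext i
    have := T.dot_b v w ((T.D v).e i)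
    rw [h _ (T.D v).o] at this
    simpa [(T.D v).he] using this
  have : Matrix.vecMul (Matrix.vecMul w (T.W v)) (T.W v)⁻¹ = w := by
    rw [Matrix.vecMul_vecMul, Matrix.mul_nonsing_inv _ (T.detW v), Matrix.vecMul_one]
  rw [h2, Matrix.zero_vecMul] at this
  exact this.symm

theorem gib_u (v : ι) (u u' p : Fin d → ℝ) (h : T.Gib u p) (h' : T.Gib u' p) : u = u' := by
  have key : ∀ u'' : Fin d → ℝ, T.Gib u'' p → ∀ w : Fin d → ℝ,
      ∑ x, Real.exp (dotProduct u'' (T.b x - p)) * dotProduct w (T.b x - p) = 0 := by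
    intro u'' hu w
    have := congrArg (dotProduct (Real.exp (- dotProduct u'' p) • w)) hu
    rw [dotProduct_zero, dotProduct_sum] at this
    rw [← this]
    refine Finset.sum_congr rfl fun x _ => ?_
    rw [dotProduct_sub u'', sub_eq_add_neg, Real.exp_add, smul_dotProduct, dotProduct_smul]
    simp only [smul_eq_mul]; ring
  have k1 := key u h (u - u')
  have k2 := key u' h' (u - u')
  have k3 : ∑ x, (Real.exp (dotProduct u (T.b x - p)) - Real.exp (dotProduct u' (T.b x - p))) *
      dotProduct (u - u') (T.b x - p) = 0 := by
    simp_rw [sub_mul, Finset.sum_sub_distrib]; rw [k1, k2, sub_zero]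
  have nn : ∀ a b : ℝ, 0 ≤ (Real.exp a - Real.exp b) * (a - b) := by
    intro a b
    rcases le_total a b with hab | hab
    · exact mul_nonneg_of_nonpos_of_nonpos (by have := Real.exp_le_exp.mpr hab; linarith) (by linarith)
    · exact mul_nonneg (by have := Real.exp_le_exp.mpr hab; linarith) (by linarith)
  rw [Finset.sum_eq_zero_iff_of_nonneg (fun x _ => by rw [sub_dotProduct]; exact nn _ _)] at k3
  have k4 : ∀ x, dotProduct (u - u') (T.b x - p) = 0 := by
    intro x
    rcases mul_eq_zero.mp (k3 x (Finset.mem_univ _)) with h | h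
    · rw [sub_eq_zero, Real.exp_eq_exp] at h
      rw [sub_dotProduct, h, sub_self]
    · exact h
  have := T.span v (u - u') fun x y => by
    have h1 := k4 x; have h2 := k4 y
    rw [dotProduct_sub] at h1 h2; linarith
  exact sub_eq_zero.mp this

theorem gib_exists (p : Fin d → ℝ) (hp : p ∈ interior (convexHull ℝ (Set.range T.b))) :
    ∃ u, T.Gib u p := by
  obtain ⟨ε, hε, hball⟩ := Metric.isOpen_iff.mp isOpen_interior p hp
  set f : (Fin d → ℝ) → ℝ := fun u => ∑ x, Real.exp (dotProduct u (T.b x - p)) with hf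
  have hfc : Continuous f := by
    refine continuous_finsetSum _ fun x _ => Real.continuous_exp.comp ?_
    exact continuous_finsetSum _ fun i _ => (continuous_apply i).mul continuous_const
  have hlow : ∀ u, ε / 2 * ‖u‖ ≤ f u := by
    intro u
    set q : Fin d → ℝ := fun i => p i + ε / 2 * SignType.sign (u i) with hq
    have hqm : q ∈ convexHull ℝ (Set.range T.b) := by
      refine interior_subset (hball ?_)
      rw [Metric.mem_ball, dist_pi_lt_iff hε]
      intro i
      rw [hq, Real.dist_eq]
      simp only [add_sub_cancel_left]
      rw [abs_mul, abs_of_pos (half_pos hε)]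
      have : |((SignType.sign (u i) : SignType) : ℝ)| ≤ 1 := by
        rcases SignType.sign (u i) <;> simp
      nlinarith
    have hconv : ConvexOn ℝ Set.univ (fun z : Fin d → ℝ => dotProduct u z) := by
      refine ⟨convex_univ, fun x _ y _ a b _ _ _ => ?_⟩
      simp [dotProduct_add, dotProduct_smul]
    obtain ⟨_, ⟨x, rfl⟩, hx⟩ := hconv.exists_ge_of_mem_convexHull (Set.subset_univ _) hqm
    have h1 : dotProduct u q - dotProduct u p = ε / 2 * ∑ i, |u i| := by
      simp only [dotProduct, hq, mul_add, Finset.sum_add_distrib, Finset.mul_sum, add_sub_cancel_left]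
      refine Finset.sum_congr rfl fun i _ => ?_
      rw [mul_left_comm, self_mul_sign]
    have h2 : ‖u‖ ≤ ∑ i, |u i| := by
      refine (pi_norm_le_iff_of_nonneg (Finset.sum_nonneg fun i _ => abs_nonneg _)).mpr fun i => ?_
      exact Finset.single_le_sum (f := fun i => |u i|) (fun i _ => abs_nonneg _) (Finset.mem_univ i)
    have h3 : ε / 2 * ‖u‖ ≤ dotProduct u (T.b x - p) := by
      rw [dotProduct_sub]
      have : ε / 2 * ‖u‖ ≤ ε / 2 * ∑ i, |u i| := by gcongr
      linarith
    have h4 : Real.exp (dotProduct u (T.b x - p)) ≤ f u :=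
      Finset.single_le_sum (f := fun x => Real.exp (dotProduct u (T.b x - p)))
        (fun i _ => (Real.exp_pos _).le) (Finset.mem_univ x)
    have h5 := Real.add_one_le_exp (dotProduct u (T.b x - p))
    linarith
  have hlim : Filter.Tendsto f (Filter.cocompact _) Filter.atTop :=
    Filter.tendsto_atTop_mono hlow
      ((tendsto_norm_cocompact_atTop).const_mul_atTop (half_pos hε))
  obtain ⟨u, hu⟩ := hfc.exists_forall_le hlim
  refine ⟨u, ?_⟩
  have hder : ∀ w : Fin d → ℝ, ∑ x, Real.exp (dotProduct u (T.b x - p)) * dotProduct w (T.b x - p) = 0 := by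
    intro w
    have hd : HasDerivAt (fun t : ℝ => f (u + t • w))
        (∑ x, Real.exp (dotProduct u (T.b x - p)) * dotProduct w (T.b x - p)) 0 := by
      refine HasDerivAt.fun_sum fun x _ => ?_
      have : HasDerivAt (fun t : ℝ => dotProduct (u + t • w) (T.b x - p)) (dotProduct w (T.b x - p)) 0 := by
        simp_rw [add_dotProduct, smul_dotProduct, smul_eq_mul]
        simpa using ((hasDerivAt_id (0:ℝ)).mul_const (dotProduct w (T.b x - p))).const_add (dotProduct u (T.b x - p))
      simpa using this.exp
    refine IsLocalMin.hasDerivAt_eq_zero (Filter.Eventually.of_forall fun t => ?_) hd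
    simpa using hu (u + t • w)
  unfold Gib
  funext i
  have h := hder (Pi.single i 1)
  simp only [single_one_dotProduct] at h
  rw [Finset.sum_apply]
  have : ∀ x, (Real.exp (dotProduct u (T.b x)) • (T.b x - p)) i = Real.exp (dotProduct u p) *
      (Real.exp (dotProduct u (T.b x - p)) * (T.b x - p) i) := by
    intro x
    rw [← mul_assoc, ← Real.exp_add, ← dotProduct_add]; simp
  simp_rw [this, ← Finset.mul_sum]; rw [h]; simp

def oc (d : ℕ) : Set (Fin d → ℝ) := Set.univ.pi fun _ => Set.Ioo 0 1
def hc (d : ℕ) : Set (Fin d → ℝ) := Set.univ.pi fun _ => Set.Ioc 0 1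

theorem mem_oc {y : Fin d → ℝ} : y ∈ oc d ↔ ∀ j, 0 < y j ∧ y j < 1 := by simp [oc, Set.mem_pi]
theorem mem_hc {y : Fin d → ℝ} : y ∈ hc d ↔ ∀ j, 0 < y j ∧ y j ≤ 1 := by simp [hc, Set.mem_pi]

theorem oc_ae : oc d =ᵐ[volume] cube d := by
  have := Measure.univ_pi_Ioo_ae_eq_Icc (ι := Fin d) (α := fun _ => ℝ) (μ := fun _ => volume) (f := 0) (g := 1)
  exact this
theorem hc_ae : hc d =ᵐ[volume] cube d := by
  have := Measure.univ_pi_Ioc_ae_eq_Icc (ι := Fin d) (α := fun _ => ℝ) (μ := fun _ => volume) (f := 0) (g := 1)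
  exact this

theorem exp_uu (v : ι) (y : Fin d → ℝ) (hy : ∀ j, 0 < y j) (j) :
    y j = Real.exp (Matrix.vecMul (T.uu v y) (T.W v) j) := by
  rw [T.uu_W, Real.exp_log (hy j)]

theorem disj (v v' : ι) (y y' : Fin d → ℝ) (hy : y ∈ oc d) (hy' : y' ∈ oc d)
    (h : T.kap v y = T.kap v' y') : v = v' := by
  rw [mem_oc] at hy hy'
  have g := T.gibbs v _ y (T.exp_uu v y fun j => (hy j).1)
  have g' := T.gibbs v' _ y' (T.exp_uu v' y' fun j => (hy' j).1)
  rw [← h] at g'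
  have e := T.gib_u v _ _ _ g g'
  have neg : ∀ (v : ι) (y : Fin d → ℝ), (∀ j, 0 < y j ∧ y j < 1) → ∀ x,
      dotProduct (T.uu v y) (T.b x) ≤ dotProduct (T.uu v y) (T.b (T.D v).o) := by
    intro v y hy x
    rw [T.dot_b v, T.uu_W]
    have : ∑ j, Real.log (y j) * ((T.D v).a x j : ℝ) ≤ 0 := Finset.sum_nonpos fun j _ =>
      mul_nonpos_of_nonpos_of_nonneg (Real.log_neg (hy j).1 (hy j).2).le (Nat.cast_nonneg _)
    linarith
  have h1 := neg v y hy (T.D v').o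
  have h2 := neg v' y' hy' (T.D v).o
  rw [← e] at h2
  have h3 := T.dot_b v (T.uu v y) (T.D v').o
  rw [T.uu_W] at h3
  have h4 : ∑ j, Real.log (y j) * ((T.D v).a (T.D v').o j : ℝ) = 0 := by linarith
  rw [Finset.sum_eq_zero_iff_of_nonpos (fun j _ =>
      mul_nonpos_of_nonpos_of_nonneg (Real.log_neg (hy j).1 (hy j).2).le (Nat.cast_nonneg _))] at h4
  have h5 : (fun j => ((T.D v).a (T.D v').o j : ℝ)) = 0 := by
    funext j
    rcases mul_eq_zero.mp (h4 j (Finset.mem_univ j)) with h | h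
    · exact absurd h (Real.log_neg (hy j).1 (hy j).2).ne
    · exact h
  have h6 := T.hb v (T.D v').o
  rw [h5, Matrix.mulVec_zero, sub_eq_zero] at h6
  exact T.inj _ _ h6.symm

theorem injOn (v : ι) : Set.InjOn (T.kap v) (oc d) := by
  intro y hy y' hy' h
  rw [mem_oc] at hy hy'
  have g := T.gibbs v _ y (T.exp_uu v y fun j => (hy j).1)
  have g' := T.gibbs v _ y' (T.exp_uu v y' fun j => (hy' j).1)
  rw [← h] at g'
  have e := T.gib_u v _ _ _ g g'
  funext j
  rw [T.exp_uu v y (fun j => (hy j).1) j, T.exp_uu v y' (fun j => (hy' j).1) j, e]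

theorem cover [Nonempty S] (p : Fin d → ℝ) (hp : p ∈ interior (convexHull ℝ (Set.range T.b))) :
    ∃ v, ∃ y ∈ hc d, T.kap v y = p := by
  obtain ⟨u, hu⟩ := T.gib_exists p hp
  obtain ⟨v, hv⟩ := T.hmax u
  refine ⟨v, fun j => Real.exp (Matrix.vecMul u (T.W v) j), ?_, ?_⟩
  · rw [mem_hc]
    intro j
    refine ⟨Real.exp_pos _, Real.exp_le_one_iff.mpr ?_⟩
    have h1 := hv ((T.D v).e j)
    rw [T.dot_b v] at h1
    simpa [(T.D v).he] using h1
  · exact T.gib_p u _ _ (T.gibbs v u _ fun j => rfl) hu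

theorem kap_mem (v : ι) (y : Fin d → ℝ) (hy : ∀ j, 0 ≤ y j) :
    T.kap v y ∈ convexHull ℝ (Set.range T.b) := by
  have ht := (T.D v).tot_pos y hy
  have e : T.kap v y = ∑ x, ((T.D v).mo x none y / (T.D v).tot y) • T.b x := by
    have h1 : ∑ x, (T.D v).mo x none y / (T.D v).tot y = 1 := by
      rw [← Finset.sum_div]; exact div_self ht.ne'
    have h2 : ∑ x, ((T.D v).mo x none y / (T.D v).tot y) • (T.b x - T.b (T.D v).o)
        = (T.W v).mulVec (fun k => (T.D v).mean k y) := by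
      simp_rw [T.hb v, ← Matrix.mulVec_smul, ← Matrix.mulVec_sum]
      congr 1
      funext k
      rw [Finset.sum_apply]
      simp only [Pi.smul_apply, smul_eq_mul]
      unfold Loc.mean
      rw [Finset.sum_div]
      exact Finset.sum_congr rfl fun x _ => by ring
    simp_rw [smul_sub, Finset.sum_sub_distrib, ← Finset.sum_smul, h1, one_smul] at h2
    unfold kap
    rw [← h2]; abel
  rw [e]
  refine (convex_convexHull ℝ _).sum_mem (fun x _ => ?_) ?_ fun x _ => subset_convexHull ℝ _ ⟨x, rfl⟩
  · exact div_nonneg ((T.D v).mo_nonneg x _ y hy) ht.le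
  · rw [← Finset.sum_div]; exact div_self ht.ne'

def kd (v : ι) (y : Fin d → ℝ) : (Fin d → ℝ) →L[ℝ] (Fin d → ℝ) :=
  LinearMap.toContinuousLinearMap (Matrix.toLin' (T.W v * ((T.D v).jac y).transpose))

theorem kap_deriv (v : ι) (y : Fin d → ℝ) (hy : ∀ j, 0 ≤ y j) : HasFDerivAt (T.kap v) (T.kd v y) y := by
  have ht := (T.D v).tot_pos y hy
  have h1 : HasFDerivAt (fun y k => (T.D v).mean k y)
      (ContinuousLinearMap.pi fun k => fderiv ℝ ((T.D v).mean k) y) y :=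
    hasFDerivAt_pi.mpr fun k => (T.D v).mean_hasFDerivAt k y ht.ne'
  have h2 := ((LinearMap.toContinuousLinearMap (Matrix.toLin' (T.W v))).hasFDerivAt
    (x := fun k => (T.D v).mean k y)).comp y h1
  have h3 := h2.const_add (T.b (T.D v).o)
  refine h3.congr_fderiv ?_
  ext w : 1
  change (T.W v).mulVec (fun k => fderiv ℝ ((T.D v).mean k) y w) = (T.W v * ((T.D v).jac y).transpose).mulVec w
  rw [← Matrix.mulVec_mulVec]
  congr 1
  funext k
  rw [(T.D v).fderiv_eq]
  exact Finset.sum_congr rfl fun j _ => mul_comm _ _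

theorem kd_det (v : ι) (y : Fin d → ℝ) (hy : ∀ j, 0 < y j) : |(T.kd v y).det| = ((T.D v).jac y).det := by
  have : (T.kd v y).det = (T.W v * ((T.D v).jac y).transpose).det := by
    unfold kd ContinuousLinearMap.det
    exact LinearMap.det_toLin' _
  rw [this, Matrix.det_mul, Matrix.det_transpose, abs_mul, T.hW, one_mul,
    abs_of_nonneg ((T.D v).jac_nonneg y hy)]

theorem oc_meas : MeasurableSet (oc d) := MeasurableSet.univ_pi fun _ => measurableSet_Ioo

theorem volume_eq : ∑ v, ∫ y in cube d, ((T.D v).jac y).det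
    = (volume (convexHull ℝ (Set.range T.b))).toReal := by
  obtain ⟨v0, _⟩ := T.hmax 0
  have : Nonempty S := ⟨(T.D v0).o⟩
  set H := convexHull ℝ (Set.range T.b) with hH
  have h1 : ∀ v, ∫ y in cube d, ((T.D v).jac y).det = volume.real (T.kap v '' oc d) := by
    intro v
    rw [← setIntegral_congr_set oc_ae]
    have h := integral_image_eq_integral_abs_det_fderiv_smul volume (oc_meas (d := d))
      (fun y hy => (T.kap_deriv v y fun j => ((mem_oc.mp hy) j).1.le).hasFDerivWithinAt) (T.injOn v)
      (fun _ => (1 : ℝ))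
    simp only [integral_const, smul_eq_mul, mul_one, measureReal_restrict_apply_univ] at h
    rw [h]
    refine setIntegral_congr_fun oc_meas fun y hy => ?_
    exact (T.kd_det v y fun j => ((mem_oc.mp hy) j).1).symm
  have hmeas : ∀ v, MeasurableSet (T.kap v '' oc d) := fun v =>
    measurable_image_of_fderivWithin oc_meas
      (fun y hy => (T.kap_deriv v y fun j => ((mem_oc.mp hy) j).1.le).hasFDerivWithinAt) (T.injOn v)
  have hsub : ∀ v, T.kap v '' oc d ⊆ H := by
    rintro v _ ⟨y, hy, rfl⟩
    exact T.kap_mem v y fun j => ((mem_oc.mp hy) j).1.le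
  have hfin : volume H ≠ ⊤ := by
    have : IsCompact H := (Set.finite_range T.b).isCompact_convexHull ℝ
    exact this.measure_lt_top.ne
  simp_rw [h1]
  rw [← Measure.real]
  have hdis : Pairwise (Function.onFun Disjoint fun v => T.kap v '' oc d) := by
    intro v v' hvv
    refine Set.disjoint_left.mpr ?_
    rintro _ ⟨y, hy, rfl⟩ ⟨y', hy', h⟩
    exact hvv (T.disj v v' y y' hy hy' h.symm)
  have h2 : ∑ v, volume.real (T.kap v '' oc d) = volume.real (⋃ v, T.kap v '' oc d) := by
    have := measureReal_biUnion_finset (μ := volume) (s := Finset.univ) (f := fun v => T.kap v '' oc d)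
      (fun v _ v' _ h => hdis h) (fun v _ => hmeas v) (fun v _ => ne_top_of_le_ne_top hfin (measure_mono (hsub v)))
    rw [← this]; simp
  rw [h2]
  refine le_antisymm (measureReal_mono (Set.iUnion_subset hsub) hfin) ?_
  have hnull : ∀ v, volume (T.kap v '' (hc d \ oc d)) = 0 := by
    intro v
    refine addHaar_image_eq_zero_of_differentiableOn_of_addHaar_eq_zero volume (fun y hy => ?_) ?_
    · exact (T.kap_deriv v y fun j => ((mem_hc.mp hy.1) j).1.le).differentiableAt.differentiableWithinAt
    · exact ae_le_set.mp (hc_ae.trans oc_ae.symm).le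
  have hcov : H ⊆ (⋃ v, T.kap v '' oc d) ∪ ((⋃ v, T.kap v '' (hc d \ oc d)) ∪ frontier H) := by
    intro p hp
    by_cases hi : p ∈ interior H
    · obtain ⟨v, y, hy, rfl⟩ := T.cover p hi
      by_cases ho : y ∈ oc d
      · exact Or.inl (Set.mem_iUnion.mpr ⟨v, y, ho, rfl⟩)
      · exact Or.inr (Or.inl (Set.mem_iUnion.mpr ⟨v, y, ⟨hy, ho⟩, rfl⟩))
    · exact Or.inr (Or.inr ⟨subset_closure hp, hi⟩)
  have hz : volume ((⋃ v, T.kap v '' (hc d \ oc d)) ∪ frontier H) = 0 := by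
    refine measure_union_null (measure_iUnion_null hnull) ?_
    exact (convex_convexHull ℝ _).addHaar_frontier volume
  refine ENNReal.toReal_mono (ne_top_of_le_ne_top hfin (measure_mono (Set.iUnion_subset hsub))) ?_
  calc volume H ≤ _ := measure_mono hcov
    _ ≤ _ := measure_union_le _ _
    _ = _ := by rw [hz, add_zero]

end Tiling
end

noncomputable section
open MeasureTheory Pointwise
set_option linter.unusedSectionVars false

attribute [local instance] Matrix.normedAddCommGroup Matrix.normedSpace

theorem cube_eps {n d : ℕ} (ε : Fin d → Fin n) (hε : Function.Injective ε) (f : (Fin d → ℝ) → ℝ)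
    (hf : ContinuousOn f (cube d)) :
    ∫ y in cube n, f (fun i => y (ε i)) = ∫ y in cube d, f y := by
  classical
  set μ : Measure ℝ := volume.restrict (Set.Icc 0 1) with hμ
  have hp : IsProbabilityMeasure μ := ⟨by simp [hμ]⟩
  have hc : ∀ m, (volume : Measure (Fin m → ℝ)).restrict (cube m) = Measure.pi (fun _ => μ) := by
    intro m
    have : cube m = Set.univ.pi (fun _ => Set.Icc (0:ℝ) 1) := by
      unfold cube; rw [Set.pi_univ_Icc]; rfl
    rw [this, volume_pi, Measure.restrict_pi_pi]
  have hmeas : Measurable (fun (y : Fin n → ℝ) i => y (ε i)) := measurable_pi_lambda _ fun i => measurable_pi_apply _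
  have hmap : Measure.map (fun (y : Fin n → ℝ) i => y (ε i)) (Measure.pi (fun _ => μ)) =
      Measure.pi (fun _ : Fin d => μ) := by
    symm
    refine Measure.pi_eq fun s hs => ?_
    rw [Measure.map_apply hmeas (MeasurableSet.univ_pi hs)]
    set t : Fin n → Set ℝ := fun j => if h : ∃ i, ε i = j then s h.choose else Set.univ with ht
    have htε : ∀ i, t (ε i) = s i := by
      intro i
      have h : ∃ i', ε i' = ε i := ⟨i, rfl⟩
      rw [ht]; simp only [dif_pos h]
      rw [hε h.choose_spec]
    have htn : ∀ j, j ∉ Finset.univ.map ⟨ε, hε⟩ → t j = Set.univ := by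
      intro j hj
      rw [ht]; simp only
      rw [dif_neg]
      rintro ⟨i, rfl⟩
      exact hj (by simp)
    have : (fun (y : Fin n → ℝ) i => y (ε i)) ⁻¹' (Set.univ.pi s) = Set.univ.pi t := by
      ext y
      simp only [Set.mem_preimage, Set.mem_pi, Set.mem_univ, true_imp_iff]
      refine ⟨fun h j => ?_, fun h i => htε i ▸ h (ε i)⟩
      by_cases hj : j ∈ Finset.univ.map ⟨ε, hε⟩
      · obtain ⟨i, _, rfl⟩ := Finset.mem_map.mp hj
        exact (htε i).symm ▸ h i
      · rw [htn j hj]; trivial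
    rw [this, Measure.pi_pi]
    rw [← Finset.prod_subset (Finset.subset_univ (Finset.univ.map ⟨ε, hε⟩))
      (fun j _ hj => by rw [htn j hj]; simp), Finset.prod_map]
    exact Finset.prod_congr rfl fun i _ => by rw [Function.Embedding.coeFn_mk, htε]
  rw [hc n, hc d, ← hmap, integral_map hmeas.aemeasurable]
  rw [hmap, ← hc d]
  exact hf.aestronglyMeasurable (cube_meas d)

namespace Loc
variable {n : ℕ} {S : Type*} [Fintype S] (D : Loc n S)

theorem pd_m (j k : Fin n) (y : Fin n → ℝ) (hyU : y ∈ D.tile.U) :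
    pd j (D.tile.m k) y = pd j (D.mean k) y • (1 : Matrix (Option (Fin n)) (Option (Fin n)) ℝ) := by
  have hd : DifferentiableAt ℝ (D.mean k) y := (D.mean_contDiffAt k y hyU.2).differentiableAt (by simp)
  unfold pd
  have : D.tile.m k = fun y => D.mean k y • (1 : Matrix (Option (Fin n)) (Option (Fin n)) ℝ) := rfl
  rw [this, fderiv_smul_const hd]
  rfl

def JG (G : Finset (Fin n)) (y : Fin n → ℝ) : Matrix (Fin n) (Fin n) ℝ :=
  Matrix.of fun j k => if j ∈ G then (if k = j then 1 else 0) else pd j (D.mean k) y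

theorem FF0 (G : Finset (Fin n)) (y : Fin n → ℝ) (hyU : y ∈ D.tile.U) (hy : ∀ j ∈ G, y j = 0) :
    D.tile.FF (Lam n) 0 G y = (n + 1 - G.card).factorial * (D.JG G y).det := by
  classical
  unfold TileFns.FF
  rw [alt_apply, ← Matrix.det_transpose, Matrix.det_apply', Finset.mul_sum]
  refine Finset.sum_congr rfl fun σ _ => ?_
  have e : (fun j => D.tile.Mrow 0 G y j (σ j)) = fun j => (D.JG G y j (σ j)) •
      (if j ∈ G then D.tile.A j y else 1 : Matrix (Option (Fin n)) (Option (Fin n)) ℝ) := by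
    funext j
    unfold TileFns.Mrow JG
    by_cases hj : j ∈ G
    · simp only [hj, if_true, Matrix.of_apply]
      split_ifs <;> simp
    · simp only [hj, if_false, Matrix.of_apply, zero_smul, add_zero]
      rw [D.pd_m j _ y hyU]
  have hL : Lam n (fun j => (if j ∈ G then D.tile.A j y else 1 : Matrix (Option (Fin n)) (Option (Fin n)) ℝ))
      = (n + 1 - G.card).factorial := by
    rw [Lam_apply]
    have h1 := MD_ones (O := Option (Fin n)) (G.map Function.Embedding.some)
      (fun o => o.elim 1 (fun j => D.tile.A j y)) ?_ ?_ ?_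
    · rw [Finset.card_map, Fintype.card_option, Fintype.card_fin] at h1
      rw [← h1]
      congr 1
      funext o
      cases o with
      | none => simp
      | some j => simp
    · intro i hi
      obtain ⟨j, hj, rfl⟩ := Finset.mem_map.mp hi
      exact D.A_row j y hyU (hy j hj)
    · intro i hi
      obtain ⟨j, hj, rfl⟩ := Finset.mem_map.mp hi
      exact D.A_one j y hyU (hy j hj)
    · intro i hi i' hi'
      obtain ⟨j, hj, rfl⟩ := Finset.mem_map.mp hi
      obtain ⟨j', hj', rfl⟩ := Finset.mem_map.mp hi'
      exact D.A_col j' j y hyU (hy j hj)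
  rw [e, MultilinearMap.map_smul_univ, hL, smul_eq_mul]
  simp only [Matrix.transpose_apply]
  ring

/-- restriction of the chart to a face -/
def restr {d : ℕ} (ε : Fin d → Fin n) (hε : Function.Injective ε) (G : Finset (Fin n))
    (hG : ∀ j, j ∉ G ↔ ∃ i, ε i = j) (p : S → Prop) (hp : ∀ x, p x ↔ ∀ j ∈ G, D.a x j = 0) :
    Loc d {x // p x} where
  a x i := D.a x.1 (ε i)
  o := ⟨D.o, (hp _).mpr fun j _ => D.ho j⟩
  e i := ⟨D.e (ε i), (hp _).mpr fun j hj => by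
    rw [D.he, if_neg]
    rintro rfl
    exact (hG (ε i)).mpr ⟨i, rfl⟩ hj⟩
  ho j := D.ho _
  he i j := by rw [D.he]; simp [hε.eq_iff]

section restr
variable {d : ℕ} (ε : Fin d → Fin n) (hε : Function.Injective ε) (G : Finset (Fin n))
    (hG : ∀ j, j ∉ G ↔ ∃ i, ε i = j) (p : S → Prop) [Fintype {x // p x}]
    (hp : ∀ x, p x ↔ ∀ j ∈ G, D.a x j = 0)

theorem restr_mo (x : {x // p x}) (z : Fin n → ℝ) :
    (D.restr ε hε G hG p hp).mo x none (fun i => z (ε i)) = D.mo x.1 none z := by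
  classical
  rw [mo_none, mo_none]
  have : ∏ j, z j ^ D.a x.1 j = ∏ j ∈ Finset.univ.map ⟨ε, hε⟩, z j ^ D.a x.1 j := by
    symm
    refine Finset.prod_subset (Finset.subset_univ _) fun j _ hj => ?_
    have : j ∈ G := by
      by_contra h
      obtain ⟨i, rfl⟩ := (hG j).mp h
      exact hj (by simp)
    rw [(hp x.1).mp x.2 j this, pow_zero]
  rw [this, Finset.prod_map]
  rfl

theorem restr_sum (z : Fin n → ℝ) (hz : ∀ j ∈ G, z j = 0) (f : S → ℝ) :
    ∑ x : {x // p x}, f x.1 * (D.restr ε hε G hG p hp).mo x none (fun i => z (ε i))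
      = ∑ x, f x * D.mo x none z := by
  classical
  simp_rw [D.restr_mo]
  have h := Finset.sum_filter_add_sum_filter_not (Finset.univ : Finset S) (fun x => p x) (fun x => f x * D.mo x none z)
  rw [← h]
  have h2 : ∑ x ∈ Finset.univ.filter (fun x => ¬ p x), f x * D.mo x none z = 0 := by
    refine Finset.sum_eq_zero fun x hx => ?_
    rw [Finset.mem_filter, hp] at hx
    have := hx.2
    push Not at this
    obtain ⟨j, hj, hne⟩ := this
    rw [D.mo_zero x none j z (hz j hj) (by simpa [ex] using hne), mul_zero]
  rw [h2, add_zero]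
  rw [← Finset.sum_subtype (p := p) (Finset.univ.filter (fun x => p x)) (by simp) (fun x => f x * D.mo x none z)]

theorem restr_mean (z : Fin n → ℝ) (hz : ∀ j ∈ G, z j = 0) (l : Fin d) :
    (D.restr ε hε G hG p hp).mean l (fun i => z (ε i)) = D.mean (ε l) z := by
  unfold mean tot
  have h1 := D.restr_sum ε hε G hG p hp z hz (fun x => (D.a x (ε l) : ℝ))
  have h2 := D.restr_sum ε hε G hG p hp z hz (fun x => 1)
  simp only [one_mul] at h2
  rw [h2, ← h1]
  rfl

theorem restr_pd (z : Fin n → ℝ) (hz : ∀ j ∈ G, z j = 0) (hz0 : ∀ j, 0 ≤ z j) (i l : Fin d) :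
    pd i ((D.restr ε hε G hG p hp).mean l) (fun i => z (ε i)) = pd (ε i) (D.mean (ε l)) z := by
  have h1 := pd_hasDerivAt i ((D.restr ε hε G hG p hp).mean l) (fun i => z (ε i))
    (((D.restr ε hε G hG p hp).mean_contDiffAt l _ ((D.restr ε hε G hG p hp).tot_pos _
      fun j => hz0 _).ne').differentiableAt (by simp))
  have h2 := pd_hasDerivAt (ε i) (D.mean (ε l)) z
    ((D.mean_contDiffAt (ε l) _ (D.tot_pos _ hz0).ne').differentiableAt (by simp))
  refine h1.unique (h2.congr_of_eventuallyEq (Filter.Eventually.of_forall fun t => ?_))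
  simp only
  rw [← D.restr_mean ε hε G hG p hp]
  · congr 1
    funext m
    by_cases hm : m = i
    · subst hm; simp
    · rw [Function.update_of_ne hm, Function.update_of_ne (hε.ne hm)]
  · intro j hj
    rw [Function.update_of_ne, hz j hj]
    rintro rfl
    exact (hG (ε i)).mpr ⟨i, rfl⟩ hj

theorem JG_det (z : Fin n → ℝ) (hz : ∀ j ∈ G, z j = 0) (hz0 : ∀ j, 0 ≤ z j) :
    (D.JG G z).det = ((D.restr ε hε G hG p hp).jac (fun i => z (ε i))).det := by
  classical
  rw [Matrix.twoBlockTriangular_det' (D.JG G z) (fun j => j ∈ G) (by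
    intro i hi j hj
    simp only [JG, Matrix.of_apply, hi, if_true]
    rw [if_neg]; rintro rfl; exact hj hi)]
  have h1 : (D.JG G z).toSquareBlockProp (fun j => j ∈ G) = 1 := by
    ext i j
    simp only [Matrix.toSquareBlockProp, Matrix.toBlock_apply, JG, Matrix.of_apply, i.2, if_true,
      Matrix.one_apply, Subtype.ext_iff, eq_comm, Matrix.of_apply]
  have h1' : ((D.JG G z).toSquareBlockProp (fun j => j ∈ G)).det = 1 := by
    rw [h1]; exact Matrix.det_one
  have h2 : ∀ a b c : ℝ, a = 1 → b = c → a * b = c := fun a b c h h' => by rw [h, h', one_mul]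
  refine h2 _ _ _ (by convert h1') ?_
  set q : Fin d ≃ {j // ¬ j ∈ G} := Equiv.ofBijective (fun i => ⟨ε i, (hG _).mpr ⟨i, rfl⟩⟩)
    ⟨fun i j h => hε (Subtype.ext_iff.mp h), fun j => by
      obtain ⟨i, hi⟩ := (hG j.1).mp j.2
      exact ⟨i, Subtype.ext hi⟩⟩ with hq
  rw [← Matrix.det_submatrix_equiv_self q]
  congr 1
  ext i l
  have hi : ε i ∉ G := (hG _).mpr ⟨i, rfl⟩
  rw [jac, Matrix.of_apply, D.restr_pd ε hε G hG p hp z hz hz0]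
  change (if ε i ∈ G then (if ε l = ε i then (1:ℝ) else 0) else pd (ε i) (D.mean (ε l)) z) = _
  rw [if_neg hi]

theorem jac_cont : ContinuousOn (fun y => (D.jac y).det) (cube n) := by
  intro y hy
  refine ContDiffAt.continuousAt (n := (⊤ : ℕ∞)) (𝕜 := ℝ) ?_ |>.continuousWithinAt
  refine det_contDiffAt _ _ fun j k => ?_
  exact pd_contDiffAt j _ y (D.mean_contDiffAt k y (D.tot_pos y fun j => ((mem_cube.mp hy) j).1).ne')

theorem IG0 : ∫ y in cube n, D.tile.FF (Lam n) 0 G (zG G y) =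
    (n + 1 - G.card).factorial * ∫ y in cube d, ((D.restr ε hε G hG p hp).jac y).det := by
  rw [← cube_eps ε hε _ (jac_cont _), ← integral_const_mul]
  refine setIntegral_congr_fun (cube_meas n) fun y hy => ?_
  have hz := zG_mem G hy
  have hz1 : ∀ j ∈ G, zG G y j = 0 := fun j hj => by simp [zG, hj]
  rw [D.FF0 G _ (D.cube_sub hz) hz1, D.JG_det ε hε G hG p hp _ hz1 fun j => ((mem_cube.mp hz) j).1]
  congr 3
  funext i
  have hi : ε i ∉ G := (hG _).mpr ⟨i, rfl⟩
  simp [zG, hi]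

end restr
end Loc
end

noncomputable section
open MeasureTheory Pointwise
set_option linter.unusedSectionVars false

section quad
variable {n : ℕ} {S : Type*} [Fintype S] [DecidableEq S]

/-- determinant with the `none` row fixed -/
def Det1 (u : Option (Fin n) → ℝ) : MultilinearMap ℝ (fun _ : Fin n => (Option (Fin n) → ℝ)) ℝ :=
  MultilinearMap.mk' (fun X => Matrix.det (Matrix.of fun o : Option (Fin n) => o.elim u X))
    (by
      intro X i x y
      have : ∀ z, (Matrix.of fun o : Option (Fin n) => o.elim u (Function.update X i z)) =
          Matrix.updateRow (Matrix.of fun o : Option (Fin n) => o.elim u X) (some i) z := by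
        intro z; ext o p
        cases o with
        | none => simp [Matrix.updateRow_apply]
        | some j =>
          by_cases h : j = i
          · subst h; simp
          · simp [Matrix.updateRow_apply, h]
      rw [this, this, this, Matrix.det_updateRow_add])
    (by
      intro X i c x
      have : ∀ z, (Matrix.of fun o : Option (Fin n) => o.elim u (Function.update X i z)) =
          Matrix.updateRow (Matrix.of fun o : Option (Fin n) => o.elim u X) (some i) z := by
        intro z; ext o p
        cases o with
        | none => simp [Matrix.updateRow_apply]
        | some j =>
          by_cases h : j = i
          · subst h; simp
          · simp [Matrix.updateRow_apply, h]
      rw [this, this, Matrix.det_updateRow_smul, smul_eq_mul])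

theorem Det1_apply (u : Option (Fin n) → ℝ) (X) :
    Det1 u X = Matrix.det (Matrix.of fun o : Option (Fin n) => o.elim u X) := rfl

theorem Det1_perm (u : Option (Fin n) → ℝ) (X : Fin n → Option (Fin n) → ℝ) (ρ : Equiv.Perm (Fin n)) :
    Det1 u (fun j => X (ρ j)) = (Equiv.Perm.sign ρ : ℝ) * Det1 u X := by
  rw [Det1_apply, Det1_apply]
  have : (Matrix.of fun o : Option (Fin n) => o.elim u (fun j => X (ρ j))) =
      (Matrix.of fun o : Option (Fin n) => o.elim u X).submatrix (Equiv.optionCongr ρ) id := by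
    ext o p; cases o <;> rfl
  rw [this, Matrix.det_permute, Equiv.optionCongr_sign]

def fC (u : Option (Fin n) → ℝ) (C : Fin n → Matrix S (Option (Fin n)) ℝ) :
    MultilinearMap ℝ (fun _ : Fin n => (S → ℝ)) ℝ :=
  ∑ σ : Equiv.Perm (Fin n), (Equiv.Perm.sign σ : ℝ) •
    (Det1 u).compLinearMap (fun j => (C (σ j)).vecMulLinear)

theorem fC_apply (u : Option (Fin n) → ℝ) (C : Fin n → Matrix S (Option (Fin n)) ℝ) (κ : Fin n → S → ℝ) :
    fC u C κ = ∑ σ : Equiv.Perm (Fin n), (Equiv.Perm.sign σ : ℝ) *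
      Det1 u (fun j => Matrix.vecMul (κ j) (C (σ j))) := by
  unfold fC
  rw [MultilinearMap.sum_apply]
  rfl

theorem fC_perm (u : Option (Fin n) → ℝ) (C : Fin n → Matrix S (Option (Fin n)) ℝ) (κ : Fin n → S → ℝ)
    (ρ : Equiv.Perm (Fin n)) : fC u C (fun j => κ (ρ j)) = fC u C κ := by
  rw [fC_apply, fC_apply]
  rw [← Equiv.sum_comp (Equiv.mulRight ρ)]
  refine Finset.sum_congr rfl fun σ _ => ?_
  have := Det1_perm u (fun j => Matrix.vecMul (κ j) (C (σ j))) ρ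
  simp only [Equiv.coe_mulRight, Equiv.Perm.mul_apply, Equiv.Perm.sign_mul]
  rw [this]
  have hs : ((Equiv.Perm.sign ρ : ℤ) : ℝ) * ((Equiv.Perm.sign ρ : ℤ) : ℝ) = 1 := by
    rcases Int.units_eq_one_or (Equiv.Perm.sign ρ) with h | h <;> rw [h] <;> simp
  push_cast
  linear_combination ((Equiv.Perm.sign σ : ℤ) : ℝ) * (Det1 u (fun j => Matrix.vecMul (κ j) (C (σ j)))) * hs

theorem fC_diag (u : Option (Fin n) → ℝ) (C : Fin n → Matrix S (Option (Fin n)) ℝ) (κ : S → ℝ) :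
    fC u C (fun _ => κ) = (n.factorial : ℝ) * Det1 u (fun j => Matrix.vecMul κ (C j)) := by
  rw [fC_apply]
  have : ∀ σ : Equiv.Perm (Fin n), (Equiv.Perm.sign σ : ℝ) * Det1 u (fun j => Matrix.vecMul κ (C (σ j)))
      = Det1 u (fun j => Matrix.vecMul κ (C j)) := by
    intro σ
    rw [Det1_perm u (fun j => Matrix.vecMul κ (C j)) σ, ← mul_assoc]
    rcases Int.units_eq_one_or (Equiv.Perm.sign σ) with h | h <;> rw [h] <;> simp
  simp_rw [this]
  rw [Finset.sum_const, Finset.card_univ, Fintype.card_perm, Fintype.card_fin, nsmul_eq_mul]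

theorem quad_sum (U : Matrix S (Option (Fin n)) ℝ) (C : Fin n → Matrix S (Option (Fin n)) ℝ) :
    (n.factorial : ℝ) * ∑ σ : Equiv.Perm (Fin n), (Equiv.Perm.sign σ : ℝ) *
      MD (Option (Fin n)) (fun o => o.elim (U.transpose * U) (fun j => (C j).transpose * C (σ j)))
    = ∑ α : Option (Fin n) → S, (fC (U (α none)) C (fun j => Pi.single (α (some j)) 1))^2 := by
  set d : (Option (Fin n) → S) → Equiv.Perm (Fin n) → ℝ := fun α σ =>
    Det1 (U (α none)) (fun j => C (σ j) (α (some j))) with hd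
  have hQ : ∀ α : Option (Fin n) → S, fC (U (α none)) C (fun j => Pi.single (α (some j)) 1)
      = ∑ σ : Equiv.Perm (Fin n), (Equiv.Perm.sign σ : ℝ) * d α σ := by
    intro α
    rw [fC_apply]
    refine Finset.sum_congr rfl fun σ _ => ?_
    simp only [Matrix.single_one_vecMul, hd]
    rfl
  have h1 : ∀ σ : Equiv.Perm (Fin n), MD (Option (Fin n)) (fun o => o.elim (U.transpose * U)
      (fun j => (C j).transpose * C (σ j))) = ∑ α, d α 1 * d α σ := by
    intro σ
    have : (fun o : Option (Fin n) => o.elim (U.transpose * U) (fun j => (C j).transpose * C (σ j))) =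
        fun o => ∑ x : S, Matrix.vecMulVec (o.elim (U x) (fun j => C j x)) (o.elim (U x) (fun j => C (σ j) x)) := by
      funext o
      ext p q
      rw [Matrix.sum_apply]
      cases o <;> simp [Matrix.mul_apply, Matrix.vecMulVec_apply]
    rw [this, MultilinearMap.map_sum]
    refine Finset.sum_congr rfl fun α _ => ?_
    rw [MD_rankone, hd]
    simp only [Det1_apply]
    congr 2 <;> (ext o p; cases o <;> rfl)
  set Q : (Option (Fin n) → S) → ℝ := fun α => ∑ σ : Equiv.Perm (Fin n), (Equiv.Perm.sign σ : ℝ) * d α σ with hQd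
  have h2 : ∑ σ : Equiv.Perm (Fin n), (Equiv.Perm.sign σ : ℝ) *
      MD (Option (Fin n)) (fun o => o.elim (U.transpose * U) (fun j => (C j).transpose * C (σ j)))
      = ∑ α, d α 1 * Q α := by
    simp_rw [h1, hQd, Finset.mul_sum]
    rw [Finset.sum_comm]
    exact Finset.sum_congr rfl fun α _ => Finset.sum_congr rfl fun σ _ => by ring
  have h3 : ∀ ρ : Equiv.Perm (Fin n), ∑ α, d α 1 * Q α = ∑ α, (Equiv.Perm.sign ρ : ℝ) * d α ρ * Q α := by
    intro ρ
    rw [← Equiv.sum_comp (Equiv.arrowCongr (Equiv.optionCongr ρ) (Equiv.refl S)) (fun α => d α 1 * Q α)]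
    refine Finset.sum_congr rfl fun α _ => ?_
    set β := (Equiv.arrowCongr (Equiv.optionCongr ρ) (Equiv.refl S)) α with hβ
    have hb0 : β none = α none := rfl
    have hb : ∀ j, β (some j) = α (some (ρ.symm j)) := fun j => rfl
    have e1 : Q β = Q α := by
      simp only [hQd]
      rw [← hQ, ← hQ, hb0]
      simp only [hb]
      exact fC_perm (U (α none)) C (fun j => Pi.single (α (some j)) 1) ρ.symm
    have e2 : d β 1 = (Equiv.Perm.sign ρ : ℝ) * d α ρ := by
      simp only [hd, hb0, hb, Equiv.Perm.one_apply]
      have := Det1_perm (U (α none)) (fun j => C (ρ j) (α (some j))) ρ.symm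
      simp only [Equiv.apply_symm_apply, Equiv.Perm.sign_symm] at this
      exact this
    rw [e1, e2]
  rw [h2]
  have h4 : (n.factorial : ℝ) * ∑ α, d α 1 * Q α = ∑ ρ : Equiv.Perm (Fin n), ∑ α, (Equiv.Perm.sign ρ : ℝ) * d α ρ * Q α := by
    rw [← Finset.sum_congr rfl fun ρ _ => h3 ρ]
    rw [Finset.sum_const, Finset.card_univ, Fintype.card_perm, Fintype.card_fin, nsmul_eq_mul]
  rw [h4, Finset.sum_comm]
  refine Finset.sum_congr rfl fun α _ => ?_
  rw [hQ, ← Finset.sum_mul, pow_two]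

/-- the quadratic expression vanishes iff all diagonal values vanish -/
theorem quad_zero (U : Matrix S (Option (Fin n)) ℝ) (C : Fin n → Matrix S (Option (Fin n)) ℝ) :
    (∀ α : Option (Fin n) → S, fC (U (α none)) C (fun j => Pi.single (α (some j)) 1) = 0) ↔
    ∀ x κ, Det1 (U x) (fun j => Matrix.vecMul κ (C j)) = 0 := by
  constructor
  · intro h x κ
    have h0 : fC (U x) C = 0 := by
      refine Module.Basis.ext_multilinear (fun _ => Pi.basisFun ℝ S) fun v => ?_
      have := h (fun o => o.elim x v)
      simpa [Pi.basisFun_apply] using this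
    have := fC_diag (U x) C κ
    rw [h0] at this
    have hn : (n.factorial : ℝ) ≠ 0 := by exact_mod_cast n.factorial_ne_zero
    simpa [hn] using this.symm
  · intro h α
    refine polar_zero _ (fC_perm _ _) (fun κ => ?_) _
    rw [fC_diag, h, mul_zero]

end quad
end

noncomputable section
open MeasureTheory Pointwise
set_option linter.unusedSectionVars false

attribute [local instance] Matrix.normedAddCommGroup Matrix.normedSpace

theorem det_option {n : ℕ} (M : Matrix (Option (Fin n)) (Option (Fin n)) ℝ) (h : ∀ j, M (some j) none = 0) :
    M.det = M none none * (Matrix.of fun j k => M (some j) (some k)).det := by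
  let e : Option (Fin n) ≃ Fin n ⊕ PUnit.{1} := Equiv.optionEquivSumPUnit.{0} (Fin n)
  rw [← Matrix.det_submatrix_equiv_self e.symm M]
  have : M.submatrix e.symm e.symm
      = Matrix.fromBlocks (Matrix.of fun j k => M (some j) (some k)) 0
        (Matrix.of fun (_ : PUnit.{1}) k => M none (some k)) (Matrix.of fun (_ : PUnit.{1}) (_ : PUnit.{1}) => M none none) := by
    ext p q
    rcases p with p | p <;> rcases q with q | q <;> simp [h, e]
  rw [this, Matrix.det_fromBlocks_zero₁₂, mul_comm]
  congr 1
  rw [Matrix.det_unique]; rfl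

namespace Loc
variable {n : ℕ} {S : Type*} [Fintype S] [DecidableEq S] (D : Loc n S)

/-- all second order relations are singular -/
def Sing : Prop := ∀ u : S → ℝ, (∀ p, ∑ x, u x * D.la x p = 0) →
  (Matrix.of fun j k => ∑ x, u x * D.a x j * D.a x k : Matrix (Fin n) (Fin n) ℝ).det = 0

/-- weighted second moment matrix -/
def wm (b : S → ℝ) (y : Fin n → ℝ) : Matrix (Option (Fin n)) (Option (Fin n)) ℝ :=
  Matrix.of fun p q => ∑ x, (b x * D.la x p * D.la x q) * D.mo x none y

def yy (y : Fin n → ℝ) : Option (Fin n) → ℝ := fun o => o.elim 1 y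

theorem yy_mo (x : S) (p : Option (Fin n)) (y : Fin n → ℝ) :
    yy y p * (D.la x p * D.mo x p y) = D.la x p * D.mo x none y := by
  cases p with
  | none => simp [yy]
  | some j => exact D.a_mo x j y

theorem wm_one (y : Fin n → ℝ) : D.wm (fun _ => 1) y = Matrix.diagonal (yy y) * D.sm y := by
  ext p q
  rw [Matrix.diagonal_mul, wm, sm, Matrix.of_apply, Matrix.of_apply, Finset.mul_sum]
  refine Finset.sum_congr rfl fun x _ => ?_
  rw [← mul_assoc, D.yy_mo]; ring

theorem wm_k (k : Fin n) (y : Fin n → ℝ) : D.wm (fun x => D.a x k) y = Matrix.diagonal (yy y) * D.smk k y := by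
  ext p q
  rw [Matrix.diagonal_mul, wm, smk, Matrix.of_apply, Matrix.of_apply, Finset.mul_sum]
  refine Finset.sum_congr rfl fun x _ => ?_
  have := D.yy_mo x p y
  linear_combination (- (D.a x k : ℝ) * D.la x q) * this

theorem wm_A (k : Fin n) (y : Fin n → ℝ) (hy : y ∈ D.tile.U) :
    D.wm (fun _ => 1) y * D.tile.A k y = D.wm (fun x => D.a x k) y := by
  rw [wm_one, wm_k]
  change Matrix.diagonal (yy y) * D.sm y * ((D.sm y)⁻¹ * D.smk k y) = _
  rw [Matrix.mul_assoc, Matrix.mul_nonsing_inv_cancel_left _ _ (isUnit_iff_ne_zero.mpr hy.1)]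

theorem wm_deriv (b : S → ℝ) (j : Fin n) (y : Fin n → ℝ) (p q) : ∃ c, HasDerivAt
    (fun t => D.wm b (Function.update y j t) p q) c (y j) ∧ y j * c = D.wm (fun x => D.a x j * b x) y p q := by
  refine ⟨_, D.sum_hasDerivAt (fun x => b x * D.la x p * D.la x q) j y, ?_⟩
  rw [wm, Matrix.of_apply, Finset.mul_sum]
  refine Finset.sum_congr rfl fun x _ => ?_
  have := D.a_mo x j y
  linear_combination (b x * D.la x p * D.la x q) * this

theorem wm_pdA (j k : Fin n) (y : Fin n → ℝ) (hy : y ∈ D.tile.U) :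
    D.wm (fun x => D.a x j) y * D.tile.A k y + D.wm (fun _ => 1) y * (y j • pd j (D.tile.A k) y)
      = D.wm (fun x => D.a x j * D.a x k) y := by
  ext p q
  have hA : ∀ r, HasDerivAt (fun t => D.tile.A k (Function.update y j t) r q) (pd j (D.tile.A k) y r q) (y j) := by
    intro r
    have h := pd_hasDerivAt j (D.tile.A k) y (D.A_diff k y hy)
    exact hasDerivAt_pi.mp (hasDerivAt_pi.mp h r) q
  choose c hc hc' using fun r => D.wm_deriv (fun _ => 1) j y p r
  obtain ⟨e, he, he'⟩ := D.wm_deriv (fun x => D.a x k) j y p q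
  have h1 := HasDerivAt.fun_sum (u := Finset.univ) fun r _ => (hc r).mul (hA r)
  have h2 : HasDerivAt (fun t => D.wm (fun x => D.a x k) (Function.update y j t) p q)
      (∑ r, (c r * D.tile.A k (Function.update y j (y j)) r q +
        D.wm (fun _ => 1) (Function.update y j (y j)) p r * pd j (D.tile.A k) y r q)) (y j) := by
    refine h1.congr_of_eventuallyEq ?_
    have hev : ∀ᶠ t in nhds (y j), Function.update y j t ∈ D.tile.U := by
      have hcont : Continuous (fun t => Function.update y j t) := continuous_const.update j continuous_id
      refine hcont.continuousAt.eventually_mem ?_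
      rw [Function.update_eq_self]
      exact D.tile.hU.mem_nhds hy
    filter_upwards [hev] with t ht
    rw [← D.wm_A k _ ht, Matrix.mul_apply]
    rfl
  have h3 := he.unique h2
  rw [Function.update_eq_self] at h3
  rw [← he', h3, Finset.mul_sum, Matrix.add_apply, Matrix.mul_apply, Matrix.mul_apply, ← Finset.sum_add_distrib]
  refine Finset.sum_congr rfl fun r _ => ?_
  have h4 := hc' r
  simp only [mul_one] at h4
  rw [← h4, Matrix.smul_apply, smul_eq_mul]
  ring

def UU (y : Fin n → ℝ) : Matrix S (Option (Fin n)) ℝ :=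
  Matrix.of fun x p => Real.sqrt (D.mo x none y) * D.la x p

theorem wm_UU (b : S → ℝ) (y : Fin n → ℝ) (hy : ∀ j, 0 ≤ y j) :
    D.wm b y = (D.UU y).transpose * Matrix.diagonal b * D.UU y := by
  ext p q
  rw [Matrix.mul_apply, wm, Matrix.of_apply]
  refine Finset.sum_congr rfl fun x _ => ?_
  rw [Matrix.mul_diagonal, UU, Matrix.transpose_apply, Matrix.of_apply, Matrix.of_apply]
  have := Real.mul_self_sqrt (D.mo_nonneg x none y hy)
  linear_combination (- b x * D.la x p * D.la x q) * this

def PP (y : Fin n → ℝ) : Matrix S S ℝ := 1 - D.UU y * (D.wm (fun _ => 1) y)⁻¹ * (D.UU y).transpose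

def CC (y : Fin n → ℝ) (j : Fin n) : Matrix S (Option (Fin n)) ℝ :=
  D.PP y * Matrix.diagonal (fun x => (D.a x j : ℝ)) * D.UU y

section pos

theorem wm1 (y : Fin n → ℝ) (hy : ∀ j, 0 < y j) : D.wm (fun _ => 1) y = (D.UU y).transpose * D.UU y := by
  rw [D.wm_UU _ y fun j => (hy j).le]
  simp


theorem wm_det (y : Fin n → ℝ) (hy : ∀ j, 0 < y j) (hU : y ∈ D.tile.U) : 0 < (D.wm (fun _ => 1) y).det := by
  have h1 : 0 ≤ (D.wm (fun _ => 1) y).det := by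
    rw [D.wm1 y hy]
    have := (Matrix.posSemidef_conjTranspose_mul_self (D.UU y)).det_nonneg
    rwa [Matrix.conjTranspose_eq_transpose_of_trivial] at this
  refine lt_of_le_of_ne h1 (Ne.symm ?_)
  rw [D.wm_one, Matrix.det_mul, Matrix.det_diagonal]
  refine mul_ne_zero (Finset.prod_ne_zero_iff.mpr fun p _ => ?_) hU.1
  cases p with
  | none => simp [yy]
  | some j => exact (hy j).ne'

theorem PP_UU (y : Fin n → ℝ) (hy : ∀ j, 0 < y j) (hU : y ∈ D.tile.U) : D.PP y * D.UU y = 0 := by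
  have hd := isUnit_iff_ne_zero.mpr (D.wm_det y hy hU).ne'
  unfold PP
  rw [Matrix.sub_mul, Matrix.mul_assoc, ← D.wm1 y hy, Matrix.mul_assoc, Matrix.nonsing_inv_mul _ hd]
  simp

theorem PP_tr (y : Fin n → ℝ) (hy : ∀ j, 0 < y j) (hU : y ∈ D.tile.U) : (D.PP y).transpose = D.PP y := by
  unfold PP
  have h : (D.wm (fun _ => 1) y).transpose = D.wm (fun _ => 1) y := by
    rw [D.wm1 y hy]; simp
  simp [Matrix.transpose_sub, Matrix.transpose_mul, Matrix.transpose_nonsing_inv, h, Matrix.mul_assoc]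

theorem PP_PP (y : Fin n → ℝ) (hy : ∀ j, 0 < y j) (hU : y ∈ D.tile.U) : D.PP y * D.PP y = D.PP y := by
  conv_lhs => rw [show D.PP y * D.PP y = D.PP y * (1 - D.UU y * (D.wm (fun _ => 1) y)⁻¹ * (D.UU y).transpose) from rfl]
  rw [Matrix.mul_sub, Matrix.mul_assoc, ← Matrix.mul_assoc, D.PP_UU y hy hU]
  simp

theorem CC_CC (y : Fin n → ℝ) (hy : ∀ j, 0 < y j) (hU : y ∈ D.tile.U) (j k : Fin n) : (D.CC y j).transpose * D.CC y k =
    D.wm (fun x => D.a x j * D.a x k) y - D.wm (fun x => D.a x j) y * D.tile.A k y := by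
  have hd := isUnit_iff_ne_zero.mpr (D.wm_det y hy hU).ne'
  have hA : D.tile.A k y = (D.wm (fun _ => 1) y)⁻¹ * D.wm (fun x => D.a x k) y := by
    rw [← D.wm_A k y hU, Matrix.nonsing_inv_mul_cancel_left _ _ hd]
  have hn : ∀ j, 0 ≤ y j := fun j => (hy j).le
  rw [hA, D.wm_UU (fun x => D.a x j * D.a x k) y hn, D.wm_UU (fun x => D.a x j) y hn,
    D.wm_UU (fun x => D.a x k) y hn]
  unfold CC
  rw [Matrix.transpose_mul, Matrix.transpose_mul, D.PP_tr y hy hU, Matrix.diagonal_transpose]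
  have e : (D.UU y).transpose * (Matrix.diagonal (fun x => (D.a x j : ℝ)) * D.PP y) *
      (D.PP y * Matrix.diagonal (fun x => (D.a x k : ℝ)) * D.UU y) =
      (D.UU y).transpose * Matrix.diagonal (fun x => (D.a x j : ℝ)) * (D.PP y * D.PP y) *
       (Matrix.diagonal (fun x => (D.a x k : ℝ)) * D.UU y) := by
    simp only [Matrix.mul_assoc]
  rw [e, D.PP_PP y hy hU]
  unfold PP
  rw [Matrix.mul_sub, Matrix.sub_mul, Matrix.mul_one]
  rw [← Matrix.diagonal_mul_diagonal]
  simp only [Matrix.mul_assoc]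

theorem FF1_eq (y : Fin n → ℝ) (hy : ∀ j, 0 < y j) (hU : y ∈ D.tile.U) : D.tile.FF (Lam n) 1 ∅ y = (∏ j, (y j)⁻¹) * ((D.wm (fun _ => 1) y).det)⁻¹ *
    ∑ σ : Equiv.Perm (Fin n), (Equiv.Perm.sign σ : ℝ) *
      MD (Option (Fin n)) (fun o => o.elim ((D.UU y).transpose * D.UU y)
        (fun j => (D.CC y j).transpose * D.CC y (σ j))) := by
  have hd := isUnit_iff_ne_zero.mpr (D.wm_det y hy hU).ne'
  set h := D.wm (fun _ => 1) y with hh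
  unfold TileFns.FF
  rw [alt_apply, Finset.mul_sum]
  refine Finset.sum_congr rfl fun σ _ => ?_
  have e : (fun j => D.tile.Mrow 1 ∅ y j (σ j)) = fun j => (y j)⁻¹ • (h⁻¹ *
      ((D.CC y j).transpose * D.CC y (σ j)) * 1) := by
    funext j
    unfold TileFns.Mrow
    simp only [Finset.notMem_empty, if_false, one_smul]
    rw [D.pd_N j _ y hU, add_sub_cancel, D.CC_CC y hy hU, ← D.wm_pdA j (σ j) y hU, add_sub_cancel_left,
      Matrix.mul_one, Matrix.nonsing_inv_mul_cancel_left _ _ hd, smul_smul, inv_mul_cancel₀ (hy j).ne', one_smul]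
  rw [e, MultilinearMap.map_smul_univ, Lam_apply]
  have e2 : (fun o : Option (Fin n) => o.elim 1 (fun j => h⁻¹ * ((D.CC y j).transpose * D.CC y (σ j)) * 1))
      = fun o => h⁻¹ * (o.elim ((D.UU y).transpose * D.UU y)
        (fun j => (D.CC y j).transpose * D.CC y (σ j)) : Matrix (Option (Fin n)) (Option (Fin n)) ℝ) * 1 := by
    funext o
    cases o with
    | none =>
      simp only [Option.elim_none]
      rw [← D.wm1 y hy, ← hh, Matrix.nonsing_inv_mul _ hd, Matrix.mul_one]
    | some j => rfl
  rw [e2, MD_mul, Matrix.det_nonsing_inv, Ring.inverse_eq_inv', Matrix.det_one, smul_eq_mul]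
  ring

theorem Det1_CC (y : Fin n → ℝ) (hy : ∀ j, 0 < y j) (hU : y ∈ D.tile.U) (x : S) (κ : S → ℝ) : Det1 (D.UU y x) (fun j => Matrix.vecMul κ (D.CC y j)) =
    Real.sqrt (D.mo x none y) * (Matrix.of fun j k => ∑ x', (Matrix.vecMul κ (D.PP y) x' *
      Real.sqrt (D.mo x' none y)) * D.a x' j * D.a x' k : Matrix (Fin n) (Fin n) ℝ).det := by
  have hv : ∀ j p, Matrix.vecMul κ (D.CC y j) p = ∑ x', (Matrix.vecMul κ (D.PP y) x' *
      Real.sqrt (D.mo x' none y)) * D.a x' j * D.la x' p := by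
    intro j p
    unfold CC
    rw [← Matrix.vecMul_vecMul, ← Matrix.vecMul_vecMul]
    change ∑ x', Matrix.vecMul (Matrix.vecMul κ (D.PP y)) (Matrix.diagonal (fun x => (D.a x j : ℝ))) x' * D.UU y x' p = _
    refine Finset.sum_congr rfl fun x' _ => ?_
    rw [Matrix.vecMul_diagonal]
    simp only [UU, Matrix.of_apply]
    ring
  have h0 : Matrix.vecMul (Matrix.vecMul κ (D.PP y)) (D.UU y) = 0 := by
    rw [Matrix.vecMul_vecMul, D.PP_UU y hy hU, Matrix.vecMul_zero]
  rw [Det1_apply, det_option]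
  · congr 1
    · simp [UU, la]
    · congr 1
      ext j k
      exact hv j (some k)
  · intro j
    change Matrix.vecMul κ (D.CC y j) none = 0
    rw [hv]
    have := congrFun h0 (some j)
    rw [← show Matrix.vecMul (Matrix.vecMul κ (D.PP y)) (D.UU y) (some j) = 0 from this]
    refine Finset.sum_congr rfl fun x' _ => ?_
    simp only [UU, la, Matrix.of_apply, Option.elim_none, Option.elim_some]
    ring

theorem FF1 (y : Fin n → ℝ) (hy : ∀ j, 0 < y j) (hU : y ∈ D.tile.U) : 0 ≤ D.tile.FF (Lam n) 1 ∅ y ∧ (D.tile.FF (Lam n) 1 ∅ y = 0 ↔ D.Sing) := by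
  have hd := D.wm_det y hy hU
  have hn : (0:ℝ) < n.factorial := by exact_mod_cast n.factorial_pos
  have hq := quad_sum (D.UU y) (D.CC y)
  set X := ∑ σ : Equiv.Perm (Fin n), (Equiv.Perm.sign σ : ℝ) *
      MD (Option (Fin n)) (fun o => o.elim ((D.UU y).transpose * D.UU y)
        (fun j => (D.CC y j).transpose * D.CC y (σ j))) with hX
  have hc : 0 < (∏ j, (y j)⁻¹) * ((D.wm (fun _ => 1) y).det)⁻¹ :=
    mul_pos (Finset.prod_pos fun j _ => inv_pos.mpr (hy j)) (inv_pos.mpr hd)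
  have hsq : 0 ≤ (n.factorial : ℝ) * X := by rw [hq]; exact Finset.sum_nonneg fun α _ => sq_nonneg _
  rw [D.FF1_eq y hy hU, ← hX]
  refine ⟨mul_nonneg hc.le (nonneg_of_mul_nonneg_right hsq hn), ?_⟩
  have h1 : (∏ j, (y j)⁻¹) * ((D.wm (fun _ => 1) y).det)⁻¹ * X = 0 ↔ (n.factorial : ℝ) * X = 0 := by
    exact (mul_eq_zero_iff_left hc.ne').trans (mul_eq_zero_iff_left hn.ne').symm
  rw [h1, hq, Finset.sum_eq_zero_iff_of_nonneg (fun α _ => sq_nonneg _)]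
  simp only [Finset.mem_univ, true_imp_iff, sq_eq_zero_iff]
  rw [quad_zero]
  simp_rw [D.Det1_CC y hy hU]
  have hmo : ∀ x, 0 < Real.sqrt (D.mo x none y) := fun x => Real.sqrt_pos.mpr (D.mo_pos x none y fun j _ => hy j)
  constructor
  · intro h u hu
    have := h D.o (fun x => u x / Real.sqrt (D.mo x none y))
    rw [mul_eq_zero] at this
    have h2 := this.resolve_left (hmo _).ne'
    have h3 : Matrix.vecMul (fun x => u x / Real.sqrt (D.mo x none y)) (D.PP y) =
        (fun x => u x / Real.sqrt (D.mo x none y)) := by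
      unfold PP
      rw [Matrix.vecMul_sub, Matrix.vecMul_one, ← Matrix.vecMul_vecMul, ← Matrix.vecMul_vecMul]
      have : Matrix.vecMul (fun x => u x / Real.sqrt (D.mo x none y)) (D.UU y) = 0 := by
        funext p
        rw [Pi.zero_apply, ← hu p]
        refine Finset.sum_congr rfl fun x _ => ?_
        simp only [UU, Matrix.of_apply]
        rw [← mul_assoc, div_mul_cancel₀ _ (hmo x).ne']
      rw [this]; simp
    rw [h3] at h2
    rw [← h2]
    congr 1
    ext j k
    simp only [Matrix.of_apply]
    exact Finset.sum_congr rfl fun x _ => by rw [div_mul_cancel₀ _ (hmo x).ne']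
  · intro h x κ
    rw [h _ ?_, mul_zero]
    intro p
    have h0 : Matrix.vecMul (Matrix.vecMul κ (D.PP y)) (D.UU y) = 0 := by
      rw [Matrix.vecMul_vecMul, D.PP_UU y hy hU, Matrix.vecMul_zero]
    rw [← show Matrix.vecMul (Matrix.vecMul κ (D.PP y)) (D.UU y) p = 0 from congrFun h0 p]
    refine Finset.sum_congr rfl fun x' _ => ?_
    simp only [UU, Matrix.of_apply]
    ring

end pos

theorem IG1 : 0 ≤ ∫ y in cube n, D.tile.FF (Lam n) 1 ∅ (zG ∅ y) ∧
    ((∫ y in cube n, D.tile.FF (Lam n) 1 ∅ (zG ∅ y)) = 0 ↔ D.Sing) := by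
  have hz : ∀ y : Fin n → ℝ, zG ∅ y = y := fun y => by funext j; simp [zG]
  simp_rw [hz]
  have hintg : IntegrableOn (fun y => D.tile.FF (Lam n) 1 ∅ y) (Tiling.oc n) :=
    (((D.tile.FF_continuousOn (Lam n) (Lam_continuous n) 1 ∅).mono D.cube_sub).integrableOn_compact
      (cube_compact n)).congr_set_ae Tiling.oc_ae
  rw [← setIntegral_congr_set Tiling.oc_ae]
  have hsub : Tiling.oc n ⊆ cube n := fun y hy => mem_cube.mpr fun j =>
    ⟨((Tiling.mem_oc.mp hy) j).1.le, ((Tiling.mem_oc.mp hy) j).2.le⟩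
  have hpos : ∀ y ∈ Tiling.oc n, 0 ≤ D.tile.FF (Lam n) 1 ∅ y ∧ (D.tile.FF (Lam n) 1 ∅ y = 0 ↔ D.Sing) :=
    fun y hy => D.FF1 y (fun j => ((Tiling.mem_oc.mp hy) j).1) (D.cube_sub (hsub hy))
  refine ⟨setIntegral_nonneg Tiling.oc_meas fun y hy => (hpos y hy).1, ?_⟩
  constructor
  · intro h
    rw [setIntegral_eq_zero_iff_of_nonneg_ae ((ae_restrict_iff' Tiling.oc_meas).mpr
      (Filter.Eventually.of_forall fun y hy => (hpos y hy).1)) hintg] at h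
    have h2 := (ae_restrict_iff' Tiling.oc_meas).mp h
    by_contra hns
    have h3 : volume (Tiling.oc n) = 0 := by
      refine measure_mono_null (fun y hy => ?_) (mem_ae_iff.mp h2)
      intro h4
      exact hns ((hpos y hy).2.mp (h4 hy))
    rw [measure_congr Tiling.oc_ae] at h3
    have : volume (cube n) = 1 := by
      unfold cube
      rw [Real.volume_Icc_pi]; simp
    rw [this] at h3
    exact one_ne_zero h3
  · intro h
    exact setIntegral_eq_zero_of_forall_eq_zero fun y hy => (hpos y hy).2.mpr h

end Loc
end

noncomputable section
open MeasureTheory Pointwise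
set_option linter.unusedSectionVars false

section sing
variable {n : ℕ} {E : Type*} [Fintype E] [DecidableEq E]

theorem sing_poly (T : E → Matrix (Fin n) (Fin n) ℝ) (hT : ∀ e, (T e).transpose = T e)
    (hdet : ∀ t : E → ℝ, (∑ e, t e • T e).det = 0) :
    ∃ (x : Fin n → ℝ) (d : E → Fin n → ℝ) (S : Matrix (Fin n) (Fin n) ℝ), x ≠ 0 ∧ S.transpose = S ∧
      S.mulVec x = 0 ∧ (∀ e, (T e).mulVec x = - S.mulVec (d e)) ∧ (∀ e, x ⬝ᵥ (T e).mulVec x = 0) ∧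
      ∀ e f, d e ⬝ᵥ S.mulVec (d f) = 0 := by
  let TC : E → Matrix (Fin n) (Fin n) (MvPolynomial E ℝ) := fun e => (T e).map MvPolynomial.C
  let S : Matrix (Fin n) (Fin n) (MvPolynomial E ℝ) := ∑ e, (MvPolynomial.X e : MvPolynomial E ℝ) • TC e
  have hev : ∀ t : E → ℝ, S.map (MvPolynomial.eval t) = ∑ e, t e • T e := by
    intro t
    ext i j
    simp [S, TC, Matrix.sum_apply]
  have hS0 : S.det = 0 := by
    refine MvPolynomial.funext fun t => ?_
    have h1 := RingHom.map_det (MvPolynomial.eval t) S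
    rw [h1, map_zero, RingHom.mapMatrix_apply, hev, hdet]
  obtain ⟨x, hx0, hx⟩ := Matrix.exists_mulVec_eq_zero_iff.mpr hS0
  have hTC : ∀ e i j, TC e i j = TC e j i := fun e i j => by
    simp only [TC, Matrix.map_apply]
    rw [← Matrix.transpose_apply (T e) j i, hT]
  have hSs : ∀ i j, S i j = S j i := fun i j => by
    simp only [S, Matrix.sum_apply, Matrix.smul_apply]
    exact Finset.sum_congr rfl fun e _ => by rw [hTC]
  let d : E → Fin n → MvPolynomial E ℝ := fun e i => MvPolynomial.pderiv e (x i)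
  have hpS : ∀ e i j, MvPolynomial.pderiv e (S i j) = TC e i j := by
    intro e i j
    simp only [S, Matrix.sum_apply, Matrix.smul_apply, smul_eq_mul, map_sum, Derivation.leibniz, TC, Matrix.map_apply,
      MvPolynomial.pderiv_C, MvPolynomial.pderiv_X, smul_zero, zero_add]
    rw [Finset.sum_eq_single e]
    · simp
    · intro b _ hb
      simp [Pi.single_apply, hb.symm, hb]
    · simp
  have hpT : ∀ e f i j, MvPolynomial.pderiv e (TC f i j) = 0 := by
    intro e f i j
    simp only [TC, Matrix.map_apply, MvPolynomial.pderiv_C]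
  have evT' : ∀ t e i j, MvPolynomial.eval t (TC e i j) = T e i j := fun t e i j => by simp [TC]
  clear hev
  clear_value S
  clear_value TC
  have h1 : ∀ e i, ∑ j, TC e i j * x j = - ∑ j, S i j * d e j := by
    intro e i
    have h := congrArg (MvPolynomial.pderiv e) (congrFun hx i)
    simp only [Matrix.mulVec, dotProduct, map_sum, Derivation.leibniz, smul_eq_mul, hpS, Pi.zero_apply, map_zero] at h
    rw [Finset.sum_add_distrib] at h
    rw [← eq_neg_iff_add_eq_zero] at h
    change ∑ j, S i j * d e j = _ at h
    rw [h, neg_neg]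
    exact Finset.sum_congr rfl fun j _ => mul_comm _ _
  have h0 : ∀ i, ∑ j, S i j * x j = 0 := fun i => congrFun hx i
  have h2 : ∀ e, ∑ i, x i * ∑ j, TC e i j * x j = 0 := by
    intro e
    simp_rw [h1, mul_neg, Finset.sum_neg_distrib, neg_eq_zero, Finset.mul_sum]
    rw [Finset.sum_comm]
    refine Finset.sum_eq_zero fun j _ => ?_
    have : ∑ i, x i * (S i j * d e j) = (∑ i, S j i * x i) * d e j := by
      rw [Finset.sum_mul]
      exact Finset.sum_congr rfl fun i _ => by rw [hSs i j]; ring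
    rw [this, h0, zero_mul]
  have h3 : ∀ e f, ∑ i, d e i * ∑ j, TC f i j * x j = 0 := by
    intro e f
    have h := congrArg (MvPolynomial.pderiv e) (h2 f)
    simp only [map_sum, Derivation.leibniz, smul_eq_mul, hpT, map_zero, mul_zero, add_zero] at h
    rw [Finset.sum_add_distrib] at h
    have e1 : ∑ i, x i * ∑ j, TC f i j * (MvPolynomial.pderiv e) (x j) = ∑ i, d e i * ∑ j, TC f i j * x j := by
      simp_rw [Finset.mul_sum]
      rw [Finset.sum_comm]
      refine Finset.sum_congr rfl fun j _ => Finset.sum_congr rfl fun i _ => ?_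
      rw [hTC f i j]
      change _ * (_ * d e j) = _
      ring
    have e2 : ∑ i, (∑ j, TC f i j * x j) * (MvPolynomial.pderiv e) (x i) = ∑ i, d e i * ∑ j, TC f i j * x j :=
      Finset.sum_congr rfl fun i _ => mul_comm _ _
    rw [e1, e2, ← two_mul] at h
    exact (mul_eq_zero.mp h).resolve_left two_ne_zero
  obtain ⟨i0, hi0⟩ := Function.ne_iff.mp hx0
  obtain ⟨t, ht⟩ : ∃ t, MvPolynomial.eval t (x i0) ≠ 0 := by
    by_contra hcon
    push Not at hcon
    exact hi0 (MvPolynomial.funext fun t => by rw [hcon t]; simp)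
  let ev := MvPolynomial.eval t
  have evT : ∀ e i j, ev (TC e i j) = T e i j := fun e i j => evT' t e i j
  refine ⟨fun i => ev (x i), fun e i => ev (d e i), S.map ev, ?_, ?_, ?_, ?_, ?_, ?_⟩
  · intro h; exact ht (congrFun h i0)
  · ext i j
    simp only [Matrix.transpose_apply, Matrix.map_apply]
    rw [hSs]
  · funext i
    have := congrArg ev (h0 i)
    simpa [Matrix.mulVec, dotProduct] using this
  · intro e
    funext i
    have := congrArg ev (h1 e i)
    simp only [map_sum, map_mul, map_neg, evT] at this
    simpa [Matrix.mulVec, dotProduct] using this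
  · intro e
    have := congrArg ev (h2 e)
    simp only [map_sum, map_mul, map_zero, evT] at this
    simpa [Matrix.mulVec, dotProduct] using this
  · intro e f
    have := congrArg ev (h3 e f)
    simp only [h1, mul_neg, Finset.sum_neg_distrib, map_neg, map_sum, map_mul, map_zero, neg_eq_zero] at this
    simpa [Matrix.mulVec, dotProduct] using this

theorem sing_space (T : E → Matrix (Fin n) (Fin n) ℝ) (hT : ∀ e, (T e).transpose = T e)
    (hdet : ∀ t : E → ℝ, (∑ e, t e • T e).det = 0) :
    ∃ x : Fin n → ℝ, x ≠ 0 ∧ (∀ e, x ⬝ᵥ (T e).mulVec x = 0) ∧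
      2 * Module.finrank ℝ (Submodule.span ℝ (Set.range fun e => (T e).mulVec x)) + 1 ≤ n := by
  obtain ⟨x, d, S, hx, hS, hSx, h1, h2, h3⟩ := sing_poly T hT hdet
  refine ⟨x, hx, h2, ?_⟩
  set W := Submodule.span ℝ (Set.range fun e => (T e).mulVec x) with hW
  set V := Submodule.span ℝ (insert x (Set.range d)) with hV
  -- S maps V onto W
  have hmap : V.map S.mulVecLin = W := by
    rw [hV, Submodule.map_span, Set.image_insert_eq, Matrix.mulVecLin_apply, hSx, Submodule.span_insert_zero,
      ← Set.range_comp, hW]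
    have : (S.mulVecLin ∘ d) = fun e => - (T e).mulVec x := by
      funext e
      rw [Function.comp, Matrix.mulVecLin_apply, h1, neg_neg]
    rw [this, show (Set.range fun e => - (T e).mulVec x) = -(Set.range fun e => (T e).mulVec x) by
      ext z; simp [neg_eq_iff_eq_neg], Submodule.span_neg]
  have hxV : x ∈ V := Submodule.subset_span (Set.mem_insert _ _)
  have hrank : Module.finrank ℝ W + 1 ≤ Module.finrank ℝ V := by
    have h := LinearMap.finrank_range_add_finrank_ker (S.mulVecLin.domRestrict V)
    rw [LinearMap.range_domRestrict, hmap] at h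
    have : 0 < Module.finrank ℝ (LinearMap.ker (S.mulVecLin.domRestrict V)) := by
      rw [pos_iff_ne_zero]
      intro h0
      have hm : (⟨x, hxV⟩ : V) ∈ LinearMap.ker (S.mulVecLin.domRestrict V) := by
        rw [LinearMap.mem_ker]; exact hSx
      rw [Submodule.finrank_eq_zero.mp h0, Submodule.mem_bot] at hm
      exact hx (congrArg Subtype.val hm)
    omega
  -- W is orthogonal to V
  have horth : ∀ w ∈ W, ∀ v ∈ V, v ⬝ᵥ w = 0 := by
    intro w hw v hv
    rw [hW] at hw; rw [hV] at hv
    induction hw using Submodule.span_induction with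
    | mem w hw =>
      obtain ⟨f, rfl⟩ := hw
      induction hv using Submodule.span_induction with
      | mem v hv =>
        rcases hv with rfl | ⟨e, rfl⟩
        · exact h2 f
        · simp only [h1, dotProduct_neg, h3, neg_zero]
      | zero => simp
      | add a b _ _ ha hb => rw [add_dotProduct, ha, hb, add_zero]
      | smul c a _ ha => rw [smul_dotProduct, ha, smul_zero]
    | zero => simp
    | add a b _ _ ha hb => rw [dotProduct_add, ha, hb, add_zero]
    | smul c a _ ha => rw [dotProduct_smul, ha, smul_zero]
  have hle : Module.finrank ℝ W + Module.finrank ℝ V ≤ n := by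
    let Q := Fintype.linearCombination ℝ (fun i : Fin n => (LinearMap.proj i : (Fin n → ℝ) →ₗ[ℝ] ℝ).domRestrict V)
    have hQ : ∀ w v, Q w v = w ⬝ᵥ v.1 := by
      intro w v
      simp [Q, Fintype.linearCombination_apply, dotProduct]
    have hsurj : Function.Surjective Q := by
      intro φ
      obtain ⟨ψ, hψ⟩ := LinearMap.exists_extend φ
      refine ⟨fun i => ψ (Pi.single i 1), ?_⟩
      ext v
      rw [hQ, ← hψ]
      simp only [LinearMap.comp_apply, Submodule.subtype_apply]
      conv_rhs => rw [pi_eq_sum_univ' v.1, map_sum]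
      simp only [map_smul, smul_eq_mul, dotProduct]
      refine Finset.sum_congr rfl fun i _ => ?_
      rw [mul_comm]
    have hker : W ≤ LinearMap.ker Q := by
      intro w hw
      rw [LinearMap.mem_ker]
      ext v
      rw [hQ, dotProduct_comm, horth w hw v.1 v.2]; rfl
    have h := LinearMap.finrank_range_add_finrank_ker Q
    rw [LinearMap.range_eq_top.mpr hsurj, finrank_top, Subspace.dual_finrank_eq, Module.finrank_fin_fun] at h
    have := Submodule.finrank_mono hker
    omega
  omega

end sing

namespace Loc
variable {n : ℕ} {S : Type*} [Fintype S] [DecidableEq S] (D : Loc n S)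

def TT (x : S) : Matrix (Fin n) (Fin n) ℝ := Matrix.of fun j k => D.a x j * D.a x k - if j = k then (D.a x j : ℝ) else 0

theorem sing_TT (hs : D.Sing) (t : S → ℝ) : (∑ x, t x • D.TT x).det = 0 := by
  let w : Fin n → ℝ := fun j => ∑ x, t x * D.a x j
  let u : S → ℝ := fun x => t x - (∑ j, w j * if x = D.e j then 1 else 0) +
    (∑ j, w j - ∑ x, t x) * if x = D.o then 1 else 0
  have key : ∀ f : S → ℝ, ∑ x, u x * f x = ∑ x, t x * f x - ∑ j, w j * f (D.e j) +
      (∑ j, w j - ∑ x, t x) * f D.o := by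
    intro f
    simp only [u, add_mul, sub_mul, Finset.sum_add_distrib, Finset.sum_sub_distrib, Finset.sum_mul]
    rw [Finset.sum_comm]
    simp [mul_assoc, Finset.sum_mul, ← Finset.mul_sum, sub_mul]
  have hu : ∀ p, ∑ x, u x * D.la x p = 0 := by
    intro p
    rw [key (fun x => D.la x p)]
    cases p with
    | none => simp [la]
    | some k => simp [la, D.ho, D.he, w]
  rw [← hs u hu]
  congr 1
  ext j k
  have := key (fun x => D.a x j * D.a x k)
  simp only [← mul_assoc] at this
  rw [Matrix.of_apply, this]
  simp only [D.ho, D.he, Matrix.sum_apply, TT, Matrix.smul_apply, Matrix.of_apply, smul_eq_mul, mul_sub, Finset.sum_sub_distrib]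
  by_cases h : j = k
  · subst h
    simp [w, mul_assoc]
  · simp [h, mul_assoc]

theorem TT_mulVec (p : S) (x : Fin n → ℝ) (k : Fin n) : (D.TT p).mulVec x k =
    D.a p k * (∑ j, D.a p j * x j) - D.a p k * x k := by
  simp only [Matrix.mulVec, dotProduct, TT, Matrix.of_apply, sub_mul, Finset.sum_sub_distrib, ite_mul, zero_mul,
    Finset.sum_ite_eq, Finset.mem_univ, if_true, Finset.mul_sum, mul_assoc]

theorem TT_quad (p : S) (x : Fin n → ℝ) : x ⬝ᵥ (D.TT p).mulVec x =
    (∑ j, D.a p j * x j) ^ 2 - ∑ j, D.a p j * x j ^ 2 := by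
  simp only [dotProduct, TT_mulVec]
  rw [sq, Finset.sum_mul, ← Finset.sum_sub_distrib]
  exact Finset.sum_congr rfl fun j _ => by ring

theorem sing_struct (hs : D.Sing) (L : Fin n → ℕ) (m : Fin n → Fin n → ℕ) (hL : ∀ i, 1 ≤ L i)
    (hE : ∀ i k, k ≤ L i → ∃ x, ∀ j, D.a x j = if j = i then k else 0)
    (hE2 : ∀ i l, l ≠ i → ∀ k ≤ m i l, ∃ x, ∀ j, D.a x j = if j = i then k else if j = l then 1 else 0) :
    ∃ i, L i = 1 ∧ (∀ l, l ≠ i → m i l ≤ 1) ∧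
      2 * (Finset.univ.filter fun l => l ≠ i ∧ m i l = 1).card + 1 ≤ n := by
  obtain ⟨x, hx, h1, h2⟩ := sing_space D.TT (by
    intro e; ext j k; simp only [TT, Matrix.transpose_apply, Matrix.of_apply]
    by_cases h : j = k
    · subst h; rfl
    · simp [h, Ne.symm h, mul_comm]) (D.sing_TT hs)
  obtain ⟨i, hi⟩ := Function.ne_iff.mp hx
  change x i ≠ 0 at hi
  have hsum2 : ∀ (l : Fin n), l ≠ i → ∀ k : ℕ, k ≤ m i l → ∃ p, (∀ j, D.a p j = if j = i then k else if j = l then 1 else 0)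
      ∧ (∑ j, D.a p j * x j = k * x i + x l) ∧ (∑ j, D.a p j * x j ^ 2 = k * x i ^ 2 + x l ^ 2) := by
    intro l hl k hk
    obtain ⟨p, hp⟩ := hE2 i l hl k hk
    have hg : ∀ f : Fin n → ℝ, ∑ j, D.a p j * f j = k * f i + f l := by
      intro f
      have : ∀ j, (D.a p j : ℝ) * f j = (if j = i then k * f j else 0) + (if j = l then f j else 0) := by
        intro j
        rw [hp]
        by_cases h : j = i
        · subst h; simp [hl.symm]
        · by_cases h' : j = l <;> simp [h, h', hl]
      simp only [this, Finset.sum_add_distrib, Finset.sum_ite_eq', Finset.mem_univ, if_true]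
    exact ⟨p, hp, hg x, hg fun j => x j ^ 2⟩
  have hm1 : ∀ l, l ≠ i → m i l ≤ 1 := by
    intro l hl
    by_contra hcon
    push Not at hcon
    obtain ⟨p, _, ha, hb⟩ := hsum2 l hl 1 (by omega)
    obtain ⟨q, _, hc, hd⟩ := hsum2 l hl 2 (by omega)
    have e1 := h1 p
    have e2 := h1 q
    rw [D.TT_quad, ha, hb] at e1
    rw [D.TT_quad, hc, hd] at e2
    push_cast at e1 e2
    have : x i ^ 2 = 0 := by nlinarith
    exact hi (pow_eq_zero_iff two_ne_zero |>.mp this)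
  refine ⟨i, ?_, hm1, ?_⟩
  · by_contra hcon
    have := hL i
    obtain ⟨p, hp⟩ := hE i 2 (by omega)
    have e := h1 p
    rw [D.TT_quad] at e
    have hg : ∀ f : Fin n → ℝ, ∑ j, D.a p j * f j = 2 * f i := by
      intro f; simp [hp]
    rw [hg x, hg fun j => x j ^ 2] at e
    have : x i ^ 2 = 0 := by nlinarith
    exact hi (pow_eq_zero_iff two_ne_zero |>.mp this)
  · set W := Submodule.span ℝ (Set.range fun e => (D.TT e).mulVec x) with hW
    set F := Finset.univ.filter fun l => l ≠ i ∧ m i l = 1 with hF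
    have hmem : ∀ l : F, (Pi.single l.1 1 : Fin n → ℝ) ∈ W := by
      intro ⟨l, hl⟩
      obtain ⟨hl, hml⟩ := (Finset.mem_filter.mp hl).2
      obtain ⟨p, hp, ha, hb⟩ := hsum2 l hl 1 (by omega)
      have e1 := h1 p
      rw [D.TT_quad, ha, hb] at e1
      push_cast at e1
      have hxl : x l = 0 := by
        have : x i * x l = 0 := by nlinarith
        exact (mul_eq_zero.mp this).resolve_left hi
      have : (D.TT p).mulVec x = x i • (Pi.single l 1 : Fin n → ℝ) := by
        funext k
        rw [D.TT_mulVec, ha, hxl, hp]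
        by_cases h : k = i
        · subst h; simp [Ne.symm hl]
        · by_cases h' : k = l
          · subst h'; simp [h, hxl]
          · simp [h, h']
      have h3 : (D.TT p).mulVec x ∈ W := Submodule.subset_span ⟨p, rfl⟩
      rw [this] at h3
      exact (Submodule.smul_mem_iff _ hi).mp h3
    have hli : LinearIndependent ℝ (fun l : F => (⟨Pi.single l.1 1, hmem l⟩ : W)) := by
      refine LinearIndependent.of_comp W.subtype ?_
      have := (Pi.basisFun ℝ (Fin n)).linearIndependent.comp (fun l : F => l.1) Subtype.val_injective
      convert this using 1
      funext l
      simp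
    have := hli.fintype_card_le_finrank
    rw [Fintype.card_coe] at this
    omega
end Loc
end

noncomputable section
open MeasureTheory Pointwise
set_option linter.unusedSectionVars false
set_option linter.unusedVariables false
set_option linter.unusedSimpArgs false

section geo
variable {n : ℕ}

theorem fin_ext_strict {Y : Set (Fin n → ℝ)} (hY : Y.Finite) {q : Fin n → ℝ}
    (hq : q ∈ Set.extremePoints ℝ (convexHull ℝ Y)) :
    ∃ h : (Fin n → ℝ) →ₗ[ℝ] ℝ, ∀ y ∈ Y, y ≠ q → h q < h y := by
  have hsub : convexHull ℝ (Y \ {q}) ⊆ convexHull ℝ Y := convexHull_mono Set.sdiff_subset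
  have hnot : q ∉ convexHull ℝ (Y \ {q}) := by
    intro h
    have h1 := inter_extremePoints_subset_extremePoints_of_subset hsub ⟨h, hq⟩
    exact (extremePoints_convexHull_subset h1).2 rfl
  obtain ⟨f, u, h1, h2⟩ := geometric_hahn_banach_point_closed (convex_convexHull ℝ (Y \ {q}))
    ((hY.subset Set.sdiff_subset).isClosed_convexHull ℝ) hnot
  exact ⟨f.toLinearMap, fun y hy hne => h1.trans (h2 y (subset_convexHull ℝ _ ⟨hy, hne⟩))⟩

theorem fin_ext_hull {Y : Set (Fin n → ℝ)} (hY : Y.Finite) :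
    convexHull ℝ (Set.extremePoints ℝ (convexHull ℝ Y)) = convexHull ℝ Y := by
  have h := closure_convexHull_extremePoints (hY.isCompact_convexHull ℝ) (convex_convexHull ℝ Y)
  rwa [((hY.subset extremePoints_convexHull_subset).isClosed_convexHull ℝ).closure_eq] at h

theorem cone_convex {m : ℕ} (v : Fin n → ℝ) (w : Fin m → (Fin n → ℝ)) :
    Convex ℝ {x | ∃ α : Fin m → ℝ, (∀ i, 0 ≤ α i) ∧ x = v + ∑ i, α i • w i} := by
  rintro x ⟨α, hα, rfl⟩ y ⟨β, hβ, rfl⟩ a b ha hb hab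
  refine ⟨fun i => a * α i + b * β i, fun i => by have := hα i; have := hβ i; positivity, ?_⟩
  simp only [add_smul, mul_smul, Finset.sum_add_distrib, ← Finset.smul_sum, smul_add]
  have : v = a • v + b • v := by rw [← add_smul, hab, one_smul]
  nth_rw 3 [this]
  abel

theorem fdim_one {G : Set (Fin n → ℝ)} {v q p : Fin n → ℝ} (hv : v ∈ G) (hp : p ∈ G) (hpv : p ≠ v)
    (h : ∀ x ∈ G, ∃ s : ℝ, x = v + s • q) : fdim G = 1 := by
  have : vectorSpan ℝ G = Submodule.span ℝ {q} := by
    rw [vectorSpan_eq_span_vsub_set_right ℝ hv]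
    apply le_antisymm
    · rw [Submodule.span_le]
      rintro _ ⟨x, hx, rfl⟩
      obtain ⟨s, rfl⟩ := h x hx
      exact Submodule.mem_span_singleton.mpr ⟨s, by simp⟩
    · rw [Submodule.span_singleton_le_iff_mem]
      obtain ⟨s, hs⟩ := h p hp
      have hs0 : s ≠ 0 := by
        rintro rfl
        exact hpv (by simpa using hs)
      rw [← Submodule.smul_mem_iff _ hs0]
      exact Submodule.subset_span ⟨p, hp, by simp [hs]⟩
  unfold fdim
  rw [this]
  refine finrank_span_singleton ?_
  rintro rfl
  obtain ⟨s, hs⟩ := h p hp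
  exact hpv (by simpa using hs)

theorem cone_of_edges {V : Set (Fin n → ℝ)} (hV : V.Finite) {m : ℕ} {v : Fin n → ℝ}
    (hv : v ∈ Set.extremePoints ℝ (convexHull ℝ V)) (w : Fin m → (Fin n → ℝ))
    (hw : ∀ F, IsFace (convexHull ℝ V) F → v ∈ F → fdim F = 1 →
      ∃ i, ∃ c : ℝ, 0 ≤ c ∧ F = segment ℝ v (v + c • w i)) :
    ∀ x ∈ convexHull ℝ V, ∃ α : Fin m → ℝ, (∀ i, 0 ≤ α i) ∧ x = v + ∑ i, α i • w i := by
  obtain ⟨f, hf⟩ := fin_ext_strict hV hv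
  have hfp : ∀ p ∈ V, p ≠ v → 0 < f (p - v) := fun p hp hne => by
    rw [map_sub]; exact sub_pos.mpr (hf p hp hne)
  let r : (Fin n → ℝ) → (Fin n → ℝ) := fun p => (f (p - v))⁻¹ • (p - v)
  have hr : ∀ p ∈ V, p ≠ v → p - v = f (p - v) • r p := fun p hp hne => by
    simp only [r]
    rw [smul_smul, mul_inv_cancel₀ (hfp p hp hne).ne', one_smul]
  let Y : Set (Fin n → ℝ) := r '' (V \ {v})
  have hY : Y.Finite := (hV.subset Set.sdiff_subset).image r
  have hvP : v ∈ convexHull ℝ V := hv.1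
  have hext : ∀ q ∈ Set.extremePoints ℝ (convexHull ℝ Y), ∃ α : Fin m → ℝ, (∀ i, 0 ≤ α i) ∧ q = 0 + ∑ i, α i • w i := by
    intro q hq
    obtain ⟨h, hh⟩ := fin_ext_strict hY hq
    obtain ⟨p, ⟨hpV, hpv⟩, hpq⟩ := extremePoints_convexHull_subset hq
    have hpv : p ≠ v := hpv
    let g : (Fin n → ℝ) →ₗ[ℝ] ℝ := h - h q • f
    have hfr : ∀ p ∈ V, p ≠ v → f (r p) = 1 := fun p hp hne => by
      simp only [r, map_smul, smul_eq_mul]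
      exact inv_mul_cancel₀ (hfp p hp hne).ne'
    have hg : ∀ p ∈ V, p ≠ v → g (p - v) = f (p - v) * (h (r p) - h q) := fun p hp hne => by
      conv_lhs => rw [hr p hp hne]
      rw [map_smul, smul_eq_mul]
      congr 1
      simp only [g, LinearMap.sub_apply, LinearMap.smul_apply, smul_eq_mul, hfr p hp hne, mul_one]
    let C : Set (Fin n → ℝ) := {x | g v ≤ g x ∧ (g x = g v → ∃ s : ℝ, x = v + s • q)}
    have hC : Convex ℝ C := by
      rintro x ⟨hx1, hx2⟩ y ⟨hy1, hy2⟩ a b ha hb hab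
      have e1 : g (a • x + b • y) = a * g x + b * g y := by simp
      have e2 : g v = a * g v + b * g v := by rw [← add_mul, hab, one_mul]
      have ax := mul_le_mul_of_nonneg_left hx1 ha
      have by' := mul_le_mul_of_nonneg_left hy1 hb
      refine ⟨by rw [e1, e2]; linarith, fun heq => ?_⟩
      rw [e1] at heq
      have hx : a * g x = a * g v := by linarith
      have hy : b * g y = b * g v := by linarith
      have hX : ∃ s : ℝ, a • x = a • v + s • q := by
        rcases eq_or_ne a 0 with h0 | h0
        · exact ⟨0, by simp [h0]⟩
        · obtain ⟨s, hs⟩ := hx2 (mul_left_cancel₀ h0 hx)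
          exact ⟨a * s, by rw [hs, smul_add, smul_smul]⟩
      have hYy : ∃ s : ℝ, b • y = b • v + s • q := by
        rcases eq_or_ne b 0 with h0 | h0
        · exact ⟨0, by simp [h0]⟩
        · obtain ⟨s, hs⟩ := hy2 (mul_left_cancel₀ h0 hy)
          exact ⟨b * s, by rw [hs, smul_add, smul_smul]⟩
      obtain ⟨s, hs⟩ := hX
      obtain ⟨s', hs'⟩ := hYy
      refine ⟨s + s', ?_⟩
      have : v = a • v + b • v := by rw [← add_smul, hab, one_smul]
      rw [hs, hs', add_smul]
      nth_rw 3 [this]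
      abel
    have hPC : convexHull ℝ V ⊆ C := by
      refine convexHull_min (fun p' hp' => ?_) hC
      rcases eq_or_ne p' v with rfl | hne
      · exact ⟨le_rfl, fun _ => ⟨0, by simp⟩⟩
      · have h1 := hg p' hp' hne
        have h2 := hfp p' hp' hne
        rw [map_sub] at h1
        by_cases hq' : r p' = q
        · rw [hq', sub_self, mul_zero] at h1
          refine ⟨by linarith, fun _ => ⟨f (p' - v), ?_⟩⟩
          rw [← hq', ← hr p' hp' hne]; simp
        · have h3 := hh (r p') ⟨p', ⟨hp', hne⟩, rfl⟩ hq'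
          have h4 : 0 < f (p' - v) * (h (r p') - h q) := mul_pos h2 (sub_pos.mpr h3)
          refine ⟨by linarith, fun h5 => ?_⟩
          linarith
    have hpg : g p = g v := by
      have h1 := hg p hpV hpv
      rw [hpq, sub_self, mul_zero, map_sub] at h1
      linarith
    have hpP : p ∈ convexHull ℝ V := subset_convexHull ℝ _ hpV
    let G : Set (Fin n → ℝ) := {x ∈ convexHull ℝ V | g x = g v}
    have hGface : IsFace (convexHull ℝ V) G := ⟨⟨v, hvP, rfl⟩, g, g v, fun x hx => (hPC hx).1, rfl⟩
    have hdim : fdim G = 1 := fdim_one (v := v) (p := p) (q := q) ⟨hvP, rfl⟩ ⟨hpP, hpg⟩ hpv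
      fun x hx => (hPC hx.1).2 hx.2
    obtain ⟨i, c, hc, hG⟩ := hw G hGface ⟨hvP, rfl⟩ hdim
    have hpG : p ∈ G := ⟨hpP, hpg⟩
    rw [hG, segment_eq_image'] at hpG
    obtain ⟨θ, hθ, hpθ⟩ := hpG
    have e : p - v = (θ * c) • w i := by
      rw [← hpθ]
      simp [smul_smul]
    have h2 := hfp p hpV hpv
    refine ⟨Pi.single i ((f (p - v))⁻¹ * (θ * c)), fun j => ?_, ?_⟩
    · by_cases hj : j = i
      · subst hj; rw [Pi.single_eq_same]; have := hθ.1; positivity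
      · rw [Pi.single_eq_of_ne hj]
    · rw [zero_add, Finset.sum_eq_single i]
      · rw [Pi.single_eq_same, mul_smul, ← e]; exact hpq.symm
      · intro b _ hb; rw [Pi.single_eq_of_ne hb, zero_smul]
      · simp
  have hYK : convexHull ℝ Y ⊆ {x | ∃ α : Fin m → ℝ, (∀ i, 0 ≤ α i) ∧ x = 0 + ∑ i, α i • w i} := by
    rw [← fin_ext_hull hY]
    exact convexHull_min hext (cone_convex 0 w)
  refine convexHull_min (fun p hp => ?_) (cone_convex v w)
  rcases eq_or_ne p v with rfl | hne
  · exact ⟨0, fun _ => le_rfl, by simp⟩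
  · obtain ⟨α, hα, he⟩ := hYK (subset_convexHull ℝ Y ⟨p, ⟨hp, hne⟩, rfl⟩)
    have h1 := hr p hp hne
    refine ⟨fun i => f (p - v) * α i, fun i => mul_nonneg (hfp p hp hne).le (hα i), ?_⟩
    rw [he, zero_add] at h1
    simp only [mul_smul, ← Finset.smul_sum]
    rw [← h1]; simp

/-- local coordinate data of a smooth lattice polytope -/
structure SD (P : Set (Fin n → ℝ)) where
  w : Set.extremePoints ℝ P → Fin n → (Fin n → ℝ)
  φ : Set.extremePoints ℝ P → Fin n → ((Fin n → ℝ) →ᵃ[ℝ] ℝ)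
  c : Set.extremePoints ℝ P → Fin n → ℕ
  fin : (Set.extremePoints ℝ P).Finite
  hull : convexHull ℝ (Set.extremePoints ℝ P) = P
  lat : ∀ v : Set.extremePoints ℝ P, IsLatticePt v.1
  w_lat : ∀ v i, IsLatticePt (w v i)
  φ_lat : ∀ v i x, IsLatticePt x → ∃ z : ℤ, φ v i x = z
  φ_v : ∀ v i, φ v i v.1 = 0
  φ_w : ∀ v i j, (φ v i).linear (w v j) = if i = j then 1 else 0
  expand : ∀ v x, x = v.1 + ∑ i, φ v i x • w v i
  nonneg : ∀ v i, ∀ x ∈ P, 0 ≤ φ v i x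
  c_pos : ∀ v i, 1 ≤ c v i
  nb_mem : ∀ v i, v.1 + (c v i : ℝ) • w v i ∈ Set.extremePoints ℝ P

theorem face_ext {P F : Set (Fin n → ℝ)} (hF : IsFace P F) : Set.extremePoints ℝ F ⊆ Set.extremePoints ℝ P := by
  obtain ⟨_, u, c, h1, rfl⟩ := hF
  intro x hx
  rw [mem_extremePoints] at hx ⊢
  refine ⟨hx.1.1, fun a ha b hb hab => ?_⟩
  have hxab := hab
  obtain ⟨α, β, hα, hβ, hαβ, he⟩ := hab
  have hu := hx.1.2
  rw [← he, map_add, map_smul, map_smul, smul_eq_mul, smul_eq_mul] at hu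
  have h2 := h1 a ha
  have h3 := h1 b hb
  have e : c = α * c + β * c := by rw [← add_mul, hαβ, one_mul]
  have ea : u a = c := by nlinarith
  have eb : u b = c := by nlinarith
  exact hx.2 a ⟨ha, ea⟩ b ⟨hb, eb⟩ hxab

theorem seg_ext (a b : Fin n → ℝ) : b ∈ Set.extremePoints ℝ (segment ℝ a b) := by
  rcases eq_or_ne a b with rfl | hab
  · simp
  rw [mem_extremePoints]
  refine ⟨right_mem_segment ℝ a b, ?_⟩
  rw [segment_eq_image']
  rintro _ ⟨s, hs, rfl⟩ _ ⟨t, ht, rfl⟩ ⟨α, β, hα, hβ, hαβ, he⟩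
  have h0 : (α * s + β * t - 1) • (b - a) = 0 := by
    have e2 : b = b := rfl
    simp only at he
    have : α • (a + s • (b - a)) + β • (a + t • (b - a)) = (α + β) • a + (α * s + β * t) • (b - a) := by module
    rw [this, hαβ, one_smul] at he
    rw [sub_smul, one_smul, ← sub_eq_zero.mpr he]
    abel
  have h1 : α * s + β * t - 1 = 0 := (smul_eq_zero.mp h0).resolve_right (sub_ne_zero.mpr hab.symm)
  have h2 : s = 1 := by nlinarith [hs.2, ht.2]
  have h3 : t = 1 := by nlinarith [hs.2, ht.2]
  simp [h2, h3]

end geo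
end

noncomputable section
open MeasureTheory Pointwise
set_option linter.unusedSectionVars false
set_option linter.unusedVariables false
set_option linter.unusedSimpArgs false

section geo2
variable {n : ℕ}

theorem lat_cast {x : Fin n → ℝ} (hx : IsLatticePt x) : ∃ z : Fin n → ℤ, x = fun j => (z j : ℝ) := by
  choose z hz using hx
  exact ⟨z, funext hz⟩

theorem lat_sub {x y : Fin n → ℝ} (hx : IsLatticePt x) (hy : IsLatticePt y) : IsLatticePt (x - y) := by
  intro i
  obtain ⟨a, ha⟩ := hx i
  obtain ⟨b, hb⟩ := hy i
  exact ⟨a - b, by simp [ha, hb]⟩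

theorem lat_add {x y : Fin n → ℝ} (hx : IsLatticePt x) (hy : IsLatticePt y) : IsLatticePt (x + y) := by
  intro i
  obtain ⟨a, ha⟩ := hx i
  obtain ⟨b, hb⟩ := hy i
  exact ⟨a + b, by simp [ha, hb]⟩

theorem lat_smul {x : Fin n → ℝ} (hx : IsLatticePt x) (k : ℤ) : IsLatticePt ((k : ℝ) • x) := by
  intro i
  obtain ⟨a, ha⟩ := hx i
  exact ⟨k * a, by simp [ha]⟩

theorem lat_zero : IsLatticePt (0 : Fin n → ℝ) := fun i => ⟨0, by simp⟩

theorem lat_sum {ι : Type*} (s : Finset ι) (f : ι → Fin n → ℝ) (hf : ∀ i ∈ s, IsLatticePt (f i)) :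
    IsLatticePt (∑ i ∈ s, f i) := by
  classical
  induction s using Finset.induction_on with
  | empty => simpa using lat_zero
  | insert a s ha ih =>
    rw [Finset.sum_insert ha]
    exact lat_add (hf a (Finset.mem_insert_self _ _)) (ih fun i hi => hf i (Finset.mem_insert_of_mem hi))

theorem smooth_cast {P : Set (Fin n → ℝ)} (hsm : IsSmoothPoly P) (v) (hv : v ∈ Set.extremePoints ℝ P) :
    ∀ d, fdim P = d → ∃ (w : Fin d → (Fin n → ℤ)) (c : Fin d → ℝ),
      (∀ i, 0 < c i) ∧
      LinearIndependent ℝ (fun i => ((fun j => ((w i j : ℝ))) : Fin n → ℝ)) ∧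
      (∀ z : Fin n → ℤ, ((fun j => (z j : ℝ)) : Fin n → ℝ) ∈ vectorSpan ℝ P →
        ∃ m : Fin d → ℤ,
          ((fun j => (z j : ℝ)) : Fin n → ℝ) =
            ∑ i, (m i : ℝ) • ((fun j => ((w i j : ℝ))) : Fin n → ℝ)) ∧
      (∀ F : Set (Fin n → ℝ), (IsFace P F ∧ v ∈ F ∧ fdim F = 1) ↔
        ∃ i, F = segment ℝ v (v + c i • ((fun j => ((w i j : ℝ))) : Fin n → ℝ))) := by
  rintro d rfl
  obtain ⟨w, c, h1, h2, h3, h4, h5, h6⟩ := hsm v hv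
  exact ⟨w, c, h1, h3, h5, h6⟩

theorem SD_vertex (P : Set (Fin n → ℝ)) (hP : IsLatticePolytope P)
    (hfull : affineSpan ℝ P = ⊤) (hsm : IsSmoothPoly P) (v : Set.extremePoints ℝ P) :
    ∃ (w : Fin n → (Fin n → ℝ)) (φ : Fin n → ((Fin n → ℝ) →ᵃ[ℝ] ℝ)) (c : Fin n → ℕ),
      (∀ i, IsLatticePt (w i)) ∧ (∀ i x, IsLatticePt x → ∃ z : ℤ, φ i x = z) ∧ (∀ i, φ i v.1 = 0) ∧
      (∀ i j, (φ i).linear (w j) = if i = j then 1 else 0) ∧ (∀ x, x = v.1 + ∑ i, φ i x • w i) ∧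
      (∀ i, ∀ x ∈ P, 0 ≤ φ i x) ∧ (∀ i, 1 ≤ c i) ∧ (∀ i, v.1 + (c i : ℝ) • w i ∈ Set.extremePoints ℝ P) := by
  obtain ⟨V, hV, hPV⟩ := hP
  have hvs : vectorSpan ℝ P = ⊤ := by rw [← direction_affineSpan, hfull, AffineSubspace.direction_top]
  have hd : fdim P = n := by unfold fdim; rw [hvs, finrank_top]; simp
  have hextlat : ∀ x ∈ Set.extremePoints ℝ P, IsLatticePt x := by
    intro x hx
    rw [hPV] at hx
    exact hV x (extremePoints_convexHull_subset hx)
  obtain ⟨wz, c, hc, hli, hlat, hedge⟩ := smooth_cast hsm v.1 v.2 n hd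
  let w : Fin n → (Fin n → ℝ) := fun i j => (wz i j : ℝ)
  let B : Module.Basis (Fin n) ℝ (Fin n → ℝ) := Module.Basis.mk (v := w) hli
    (hli.span_eq_top_of_card_eq_finrank' (by simp)).ge
  have hB : ∀ i, B i = w i := fun i => by simp [B]
  let φ : Fin n → ((Fin n → ℝ) →ᵃ[ℝ] ℝ) := fun i =>
    { toFun := fun x => B.coord i (x - v.1)
      linear := B.coord i
      map_vadd' := fun p u => by
        simp only [vadd_eq_add]; rw [← map_add]; congr 1; abel }
  have hφ : ∀ i x, φ i x = B.coord i (x - v.1) := fun i x => rfl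
  have hcoord : ∀ (α : Fin n → ℝ) i, B.coord i (∑ j, α j • w j) = α i := by
    intro α i
    simp_rw [← hB]
    rw [map_sum]
    simp [Finsupp.single_apply]
  have hexp : ∀ x, x = v.1 + ∑ i, φ i x • w i := by
    intro x
    have h := B.sum_repr (x - v.1)
    simp_rw [hB] at h
    change ∑ i, φ i x • w i = _ at h
    rw [h]; abel
  have hφl : ∀ i x, IsLatticePt x → ∃ z : ℤ, φ i x = z := by
    intro i x hx
    obtain ⟨z, hz⟩ := lat_cast (lat_sub hx (hextlat _ v.2))
    obtain ⟨m, hm⟩ := hlat z (by rw [hvs]; trivial)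
    refine ⟨m i, ?_⟩
    rw [hφ, hz, hm]
    exact hcoord (fun i => (m i : ℝ)) i
  have hnb : ∀ i, v.1 + c i • w i ∈ Set.extremePoints ℝ P := by
    intro i
    have := ((hedge (segment ℝ v.1 (v.1 + c i • w i))).mpr ⟨i, rfl⟩).1
    exact face_ext this (seg_ext _ _)
  have hcz : ∀ i, ∃ k : ℕ, 1 ≤ k ∧ (k : ℝ) = c i := by
    intro i
    obtain ⟨z, hz⟩ := hφl i _ (hextlat _ (hnb i))
    have h1 : φ i (v.1 + c i • w i) = c i := by
      rw [hφ, add_sub_cancel_left, map_smul, ← hB]; simp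
    rw [h1] at hz
    have hz0 : (0 : ℝ) < z := hz ▸ hc i
    have hz1 : 0 < z := by exact_mod_cast hz0
    refine ⟨z.toNat, by omega, ?_⟩
    rw [hz]
    exact_mod_cast Int.toNat_of_nonneg hz1.le
  choose k hk1 hk using hcz
  refine ⟨w, φ, k, fun i j => ⟨wz i j, rfl⟩, hφl, fun i => by rw [hφ]; simp, ?_, hexp, ?_, hk1, ?_⟩
  · intro i j
    change B.coord i (w j) = _
    rw [← hB]
    simp [Finsupp.single_apply, eq_comm]
  · intro i x hx
    rw [hPV] at hx
    have hvv : v.1 ∈ Set.extremePoints ℝ (convexHull ℝ (V : Set (Fin n → ℝ))) := hPV ▸ v.2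
    obtain ⟨α, hα, hx'⟩ := cone_of_edges V.finite_toSet hvv w (by
      intro F hF hvF hF1
      rw [← hPV] at hF
      obtain ⟨i, hi⟩ := (hedge F).mp ⟨hF, hvF, hF1⟩
      exact ⟨i, c i, (hc i).le, hi⟩) x hx
    rw [hφ, hx', add_sub_cancel_left, hcoord]
    exact hα i
  · intro i
    rw [hk]
    exact hnb i

theorem SD_exists (P : Set (Fin n → ℝ)) (hP : IsLatticePolytope P)
    (hfull : affineSpan ℝ P = ⊤) (hsm : IsSmoothPoly P) : Nonempty (SD P) := by
  choose w φ c h1 h2 h3 h4 h5 h6 h7 h8 using SD_vertex P hP hfull hsm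
  obtain ⟨V, hV, hPV⟩ := hP
  refine ⟨⟨w, φ, c, ?_, ?_, ?_, h1, h2, h3, h4, h5, h6, h7, h8⟩⟩
  · rw [hPV]
    exact V.finite_toSet.subset extremePoints_convexHull_subset
  · rw [hPV]; exact fin_ext_hull V.finite_toSet
  · intro v
    have : v.1 ∈ Set.extremePoints ℝ (convexHull ℝ (V : Set (Fin n → ℝ))) := hPV ▸ v.2
    exact hV _ (extremePoints_convexHull_subset this)

end geo2
end

noncomputable section
open MeasureTheory Pointwise
set_option linter.unusedSectionVars false
set_option linter.unusedVariables false
set_option linter.unusedSimpArgs false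

namespace SD
variable {n : ℕ} {P : Set (Fin n → ℝ)} (X : SD P)

theorem φ_add (v i) (y : Fin n → ℝ) : X.φ v i (v.1 + y) = (X.φ v i).linear y := by
  have := (X.φ v i).map_vadd v.1 y
  rw [vadd_eq_add, vadd_eq_add, X.φ_v, add_zero, add_comm] at this
  exact this

theorem aff_add (f : (Fin n → ℝ) →ᵃ[ℝ] ℝ) (x y : Fin n → ℝ) : f (x + y) = f x + f.linear y := by
  have := f.map_vadd x y
  rw [vadd_eq_add, vadd_eq_add, add_comm, add_comm (f.linear y)] at this
  exact this

theorem lin_expand (v) (y : Fin n → ℝ) : y = ∑ i, (X.φ v i).linear y • X.w v i := by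
  have := X.expand v (v.1 + y)
  simp_rw [X.φ_add] at this
  exact add_left_cancel this

theorem lin_ext (v) (f : (Fin n → ℝ) →ₗ[ℝ] ℝ) (y : Fin n → ℝ) : f y = ∑ i, f (X.w v i) * (X.φ v i).linear y := by
  conv_lhs => rw [X.lin_expand v y, map_sum]
  simp [mul_comm]

theorem aff_expand (v) (f : (Fin n → ℝ) →ᵃ[ℝ] ℝ) (x : Fin n → ℝ) :
    f x = f v.1 + ∑ i, f.linear (X.w v i) * X.φ v i x := by
  conv_lhs => rw [X.expand v x]
  rw [aff_add, map_sum]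
  simp [mul_comm]

theorem conv (X : SD P) : Convex ℝ P := by
  have h := convex_convexHull ℝ (Set.extremePoints ℝ P)
  rwa [X.hull] at h

theorem mem (X : SD P) (v : Set.extremePoints ℝ P) : v.1 ∈ P := v.2.1

theorem ray_mem (v : Set.extremePoints ℝ P) (i) (s : ℝ) (h0 : 0 ≤ s) (h1 : s ≤ X.c v i) : v.1 + s • X.w v i ∈ P := by
  have hc : (0 : ℝ) < X.c v i := by exact_mod_cast X.c_pos v i
  have h := X.conv.add_smul_mem (X.mem v) (X.nb_mem v i).1 (t := s / X.c v i)
    ⟨by positivity, (div_le_one hc).mpr h1⟩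
  rwa [smul_smul, div_mul_cancel₀ _ hc.ne'] at h

theorem step_mem (v : Set.extremePoints ℝ P) (i) : v.1 + X.w v i ∈ P := by
  have := X.ray_mem v i 1 zero_le_one (by exact_mod_cast X.c_pos v i)
  rwa [one_smul] at this

theorem lin_int (v i) {y : Fin n → ℝ} (hy : IsLatticePt y) : ∃ z : ℤ, (X.φ v i).linear y = z := by
  rw [← X.φ_add]
  exact X.φ_lat v i _ (lat_add (X.lat v) hy)

theorem φ_step (v i j) : X.φ v i (v.1 + X.w v j) = if i = j then 1 else 0 := by rw [X.φ_add, X.φ_w]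

theorem φ_inj (v) {i j} (h : X.φ v i = X.φ v j) : i = j := by
  have h1 := X.φ_w v i i
  rw [h, X.φ_w] at h1
  by_contra hne
  simp [Ne.symm hne] at h1

theorem vanish {v u} {i} (h : X.φ v i u.1 = 0) : ∃ j, X.φ v i = X.φ u j := by
  set f := X.φ v i with hf
  set α : Fin n → ℝ := fun j => f.linear (X.w u j) with hα
  have hfx : ∀ x, f x = ∑ j, α j * X.φ u j x := fun x => by
    rw [X.aff_expand u f x, h, zero_add]
  have hα0 : ∀ j, 0 ≤ α j := fun j => by
    have := X.nonneg v i _ (X.step_mem u j)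
    rw [aff_add, h, zero_add] at this
    exact this
  have hz : ∀ j, α j ≠ 0 → ∀ x ∈ P, f x = 0 → X.φ u j x = 0 := by
    intro j hj x hx h0
    rw [hfx, Finset.sum_eq_zero_iff_of_nonneg fun k _ => mul_nonneg (hα0 k) (X.nonneg u k x hx)] at h0
    exact (mul_eq_zero.mp (h0 j (Finset.mem_univ j))).resolve_left hj
  have hl : ∀ j, α j ≠ 0 → ∀ y, (X.φ u j).linear y = (X.φ u j).linear (X.w v i) * f.linear y := by
    intro j hj y
    rw [X.lin_ext v (X.φ u j).linear y, Finset.sum_eq_single i]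
    · intro l _ hl
      have h1 := hz j hj _ (X.step_mem v l) (by rw [hf, X.φ_step, if_neg (Ne.symm hl)])
      rw [aff_add, hz j hj _ (X.mem v) (X.φ_v v i), zero_add] at h1
      rw [h1, zero_mul]
    · simp
  have hone : ∃ j, α j ≠ 0 := by
    by_contra hcon
    push Not at hcon
    have h1 := hfx (v.1 + X.w v i)
    rw [hf, X.φ_step, if_pos rfl] at h1
    simp [hcon] at h1
  obtain ⟨j, hj⟩ := hone
  have hj1 : (X.φ u j).linear (X.w v i) * α j = 1 := by
    rw [← hl j hj (X.w u j), X.φ_w, if_pos rfl]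
  have huniq : ∀ k, k ≠ j → α k = 0 := by
    intro k hkj
    by_contra hk
    have h1 := hl k hk (X.w u j)
    rw [X.φ_w, if_neg hkj] at h1
    have h2 := hl k hk (X.w u k)
    rw [X.φ_w, if_pos rfl] at h2
    rcases mul_eq_zero.mp h1.symm with h3 | h3
    · rw [h3, zero_mul] at h2; exact one_ne_zero h2
    · exact hj h3
  obtain ⟨a, ha⟩ := X.lin_int u j (X.w_lat v i)
  obtain ⟨b, hb⟩ := X.lin_int v i (X.w_lat u j)
  have hb : α j = b := hb
  have hj0 := hα0 j
  have hα1 : α j = 1 := by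
    rw [ha, hb] at hj1
    rw [hb] at hj0
    have h1 : a * b = 1 := by exact_mod_cast hj1
    have h2 : 0 ≤ b := by exact_mod_cast hj0
    have h3 : b = 1 := Int.eq_one_of_mul_eq_one_left h2 h1
    rw [hb, h3]; simp
  refine ⟨j, AffineMap.ext fun x => ?_⟩
  rw [hfx, Finset.sum_eq_single j]
  · rw [hα1, one_mul]
  · intro k _ hk; rw [huniq k hk, zero_mul]
  · simp

def nb (v : Set.extremePoints ℝ P) (i : Fin n) : Set.extremePoints ℝ P := ⟨v.1 + (X.c v i : ℝ) • X.w v i, X.nb_mem v i⟩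

theorem nb_val (v i) : (X.nb v i).1 = v.1 + (X.c v i : ℝ) • X.w v i := rfl

theorem φ_nb (v i j) : X.φ v j (X.nb v i).1 = if j = i then (X.c v i : ℝ) else 0 := by
  rw [nb_val, X.φ_add, map_smul, X.φ_w]
  simp

theorem exists_tau (v i) : ∃ τ : Equiv.Perm (Fin n), ∀ j, j ≠ i → X.φ v j = X.φ (X.nb v i) (τ j) := by
  have h : ∀ j, ∃ k, j ≠ i → X.φ v j = X.φ (X.nb v i) k := by
    intro j
    by_cases hj : j = i
    · exact ⟨j, fun h => absurd hj h⟩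
    · obtain ⟨k, hk⟩ := X.vanish (v := v) (u := X.nb v i) (i := j) (by rw [X.φ_nb, if_neg hj])
      exact ⟨k, fun _ => hk⟩
  choose f hf using h
  have hinj : Set.InjOn f (Finset.univ.erase i : Finset (Fin n)) := by
    intro a ha b hb hab
    have ha' := hf a (Finset.ne_of_mem_erase ha)
    have hb' := hf b (Finset.ne_of_mem_erase hb)
    rw [hab, ← hb'] at ha'
    exact X.φ_inj v ha'
  obtain ⟨g, hg⟩ := Finset.exists_equiv_extend_of_card_eq (t := (Finset.univ : Finset (Fin n))) (by simp)
    (Finset.subset_univ ((Finset.univ.erase i).image f)) hinj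
  refine ⟨g.trans (Equiv.subtypeUnivEquiv fun x => Finset.mem_univ x), fun j hj => ?_⟩
  have := hg j (Finset.mem_erase.mpr ⟨hj, Finset.mem_univ j⟩)
  rw [Equiv.trans_apply, Equiv.subtypeUnivEquiv_apply, this]
  exact hf j hj

def tau (v : Set.extremePoints ℝ P) (i : Fin n) : Equiv.Perm (Fin n) := (X.exists_tau v i).choose

theorem tau_spec (v i j) (hj : j ≠ i) : X.φ v j = X.φ (X.nb v i) (X.tau v i j) := (X.exists_tau v i).choose_spec j hj

theorem w_eq (v i) : X.w v i = (X.φ (X.nb v i) (X.tau v i i)).linear (X.w v i) • X.w (X.nb v i) (X.tau v i i) := by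
  conv_lhs => rw [X.lin_expand (X.nb v i) (X.w v i), ← Equiv.sum_comp (X.tau v i)]
  rw [Finset.sum_eq_single i]
  · intro j _ hj
    rw [← X.tau_spec v i j hj, X.φ_w, if_neg hj, zero_smul]
  · simp

theorem tau_w (v i) : (X.φ (X.nb v i) (X.tau v i i)).linear (X.w v i) = -1 := by
  obtain ⟨k, hk⟩ := X.lin_int (X.nb v i) (X.tau v i i) (X.w_lat v i)
  obtain ⟨m, hm⟩ := X.lin_int v i (X.w_lat (X.nb v i) (X.tau v i i))
  have h1 := congrArg (X.φ v i).linear (X.w_eq v i)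
  rw [map_smul, X.φ_w, if_pos rfl, hk, hm, smul_eq_mul] at h1
  have h2 : k * m = 1 := by exact_mod_cast h1.symm
  have h3 := X.nonneg (X.nb v i) (X.tau v i i) _ (X.mem v)
  have hv : v.1 = (X.nb v i).1 + (-(X.c v i : ℝ)) • X.w v i := by rw [nb_val]; simp
  rw [hv, X.φ_add, map_smul, hk, smul_eq_mul] at h3
  have hc : (0 : ℝ) < X.c v i := by exact_mod_cast X.c_pos v i
  have h4 : (k : ℝ) ≤ 0 := by nlinarith
  have h5 : k ≤ 0 := by exact_mod_cast h4
  rcases Int.isUnit_iff.mp (IsUnit.of_mul_eq_one m h2) with h6 | h6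
  · omega
  · rw [hk, h6]; simp

theorem w_nb (v i) : X.w (X.nb v i) (X.tau v i i) = - X.w v i := by
  have := X.w_eq v i
  rw [tau_w, neg_one_smul] at this
  rw [this, neg_neg]

theorem ray_eq {a d : Fin n → ℝ} {s t : ℝ} (ha : a ∈ P) (hs : 0 < s) (hs' : a + s • d ∈ Set.extremePoints ℝ P)
    (ht' : a + t • d ∈ P) (hst : s ≤ t) : a + s • d = a + t • d := by
  rcases eq_or_lt_of_le hst with h | h
  · rw [h]
  have ht : 0 < t := hs.trans h
  have := (mem_extremePoints.mp hs').2 a ha _ ht' ?_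
  · exact this.2.symm
  · refine ⟨1 - s / t, s / t, ?_, by positivity, by ring, ?_⟩
    · rw [sub_pos, div_lt_one ht]; exact h
    · rw [smul_add, smul_smul, div_mul_cancel₀ _ ht.ne']
      module

theorem ray_le (v : Set.extremePoints ℝ P) (i) (s : ℝ) (h : v.1 + s • X.w v i ∈ P) : s ≤ X.c v i := by
  by_contra hcon
  push Not at hcon
  have hc : (0 : ℝ) < X.c v i := by exact_mod_cast X.c_pos v i
  have h1 := ray_eq (X.mem v) hc (X.nb_mem v i) h hcon.le
  have h2 := congrArg (X.φ v i) h1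
  rw [X.φ_add, X.φ_add, map_smul, map_smul, X.φ_w] at h2
  simp at h2
  linarith

theorem nb_nb (v i) : X.nb (X.nb v i) (X.tau v i i) = v := by
  apply Subtype.ext
  have hv : v.1 = (X.nb v i).1 + (X.c v i : ℝ) • X.w (X.nb v i) (X.tau v i i) := by rw [w_nb, nb_val]; simp
  have hc : (0 : ℝ) < X.c v i := by exact_mod_cast X.c_pos v i
  have hc' : (0 : ℝ) < X.c (X.nb v i) (X.tau v i i) := by exact_mod_cast X.c_pos _ _
  have h1 : (X.c v i : ℝ) ≤ X.c (X.nb v i) (X.tau v i i) := X.ray_le _ _ _ (hv ▸ X.mem v)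
  rw [nb_val]
  conv_rhs => rw [hv]
  exact (ray_eq (X.mem _) hc (hv ▸ v.2) (X.nb_mem _ _).1 h1).symm

theorem tau_tau (v i) : X.tau (X.nb v i) (X.tau v i i) = (X.tau v i)⁻¹ := by
  have h : ∀ j, j ≠ i → X.tau (X.nb v i) (X.tau v i i) (X.tau v i j) = j := by
    intro j hj
    have h1 := X.tau_spec (X.nb v i) (X.tau v i i) (X.tau v i j) (fun h => hj ((X.tau v i).injective h))
    rw [← X.tau_spec v i j hj] at h1
    have h2 : ∀ u, u = v → X.φ v j = X.φ u (X.tau (X.nb v i) (X.tau v i i) (X.tau v i j)) →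
      X.tau (X.nb v i) (X.tau v i i) (X.tau v i j) = j := by
      rintro u rfl h; exact (X.φ_inj _ h).symm
    exact h2 _ (X.nb_nb v i) h1
  have hi : X.tau (X.nb v i) (X.tau v i i) (X.tau v i i) = i := by
    by_contra hne
    have h1 := h _ hne
    have h2 := (X.tau v i).injective ((X.tau (X.nb v i) (X.tau v i i)).injective h1)
    exact hne h2
  rw [eq_inv_iff_mul_eq_one]
  ext j
  rw [Equiv.Perm.mul_apply, Equiv.Perm.one_apply]
  by_cases hj : j = i
  · rw [hj, hi]
  · rw [h j hj]

theorem wall_eq (v i) (x : Fin n → ℝ) : X.φ (X.nb v i) (X.tau v i i) x = - X.φ v i x +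
    ∑ l ∈ Finset.univ.erase i, (X.φ (X.nb v i) (X.tau v i i)).linear (X.w v l) * X.φ v l x + X.c v i := by
  rw [X.aff_expand v, ← Finset.add_sum_erase _ _ (Finset.mem_univ i), tau_w]
  have hv : X.φ (X.nb v i) (X.tau v i i) v.1 = X.c v i := by
    have hv : v.1 = (X.nb v i).1 + (X.c v i : ℝ) • X.w (X.nb v i) (X.tau v i i) := by rw [w_nb, nb_val]; simp
    rw [hv, X.φ_add, map_smul, X.φ_w, if_pos rfl]; simp
  rw [hv]; ring

/-- lattice points of `P` -/
abbrev LP (P : Set (Fin n → ℝ)) := {x : Fin n → ℝ // x ∈ P ∧ IsLatticePt x}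

theorem lp_finite (X : SD P) : Finite (LP P) := by
  have hb : Bornology.IsBounded P := by
    have h := (X.fin.isCompact_convexHull ℝ).isBounded
    rwa [X.hull] at h
  obtain ⟨R, hR⟩ := hb.exists_norm_le
  have hfin : (Set.Icc (fun _ => -⌈R⌉ : Fin n → ℤ) (fun _ => ⌈R⌉)).Finite := Set.finite_Icc _ _
  refine ((hfin.image fun z j => ((z j : ℤ) : ℝ)).subset ?_ : Set.Finite {x : Fin n → ℝ | x ∈ P ∧ IsLatticePt x})
  rintro x ⟨hx, hl⟩
  obtain ⟨z, rfl⟩ := lat_cast hl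
  refine ⟨z, ?_, rfl⟩
  have h : ∀ j, |(z j : ℝ)| ≤ ⌈R⌉ := fun j => by
    have h1 := norm_le_pi_norm (fun j => (z j : ℝ)) j
    rw [Real.norm_eq_abs] at h1
    exact (h1.trans (hR _ hx)).trans (Int.le_ceil R)
  constructor
  · intro j
    have := (abs_le.mp (h j)).1
    exact_mod_cast this
  · intro j
    have := (abs_le.mp (h j)).2
    exact_mod_cast this

def loc (v : Set.extremePoints ℝ P) : Loc n (LP P) where
  a x j := ⌊X.φ v j x.1⌋₊
  o := ⟨v.1, X.mem v, X.lat v⟩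
  e i := ⟨v.1 + X.w v i, X.step_mem v i, lat_add (X.lat v) (X.w_lat v i)⟩
  ho j := by simp [X.φ_v]
  he i j := by
    simp only [X.φ_step]
    split_ifs <;> simp

theorem a_cast (v) (x : LP P) (j) : ((X.loc v).a x j : ℝ) = X.φ v j x.1 := by
  obtain ⟨z, hz⟩ := X.φ_lat v j x.1 x.2.2
  have h0 := X.nonneg v j x.1 x.2.1
  change ((⌊X.φ v j x.1⌋₊ : ℕ) : ℝ) = _
  rw [hz] at h0 ⊢
  have h1 : 0 ≤ z := by exact_mod_cast h0
  lift z to ℕ using h1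
  simp

def comb : Comb n (LP P) (Set.extremePoints ℝ P) where
  D := X.loc
  nb := X.nb
  tau := X.tau
  nb_nb := X.nb_nb
  tau_tau := X.tau_tau
  wall v i :=
    { c0 := X.c v i
      c := fun l => (X.φ (X.nb v i) (X.tau v i i)).linear (X.w v l)
      h1 := fun x j hj => by
        have : (((X.loc (X.nb v i)).a x (X.tau v i j) : ℕ) : ℝ) = (X.loc v).a x j := by
          rw [a_cast, a_cast, ← X.tau_spec v i j hj]
        exact_mod_cast this
      h2 := fun x => by
        simp only [a_cast]
        exact X.wall_eq v i x.1 }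

end SD
end

noncomputable section
open MeasureTheory Pointwise
set_option linter.unusedSectionVars false
set_option linter.unusedVariables false
set_option linter.unusedSimpArgs false

namespace SD
variable {n : ℕ} {P : Set (Fin n → ℝ)} (X : SD P)

def fc (v : Set.extremePoints ℝ P) (g : Finset (Fin n)) : Set (Fin n → ℝ) := {x ∈ P | ∀ i ∈ g, X.φ v i x = 0}

theorem φ_sub (v i) (x : Fin n → ℝ) : X.φ v i x = (X.φ v i).linear x - (X.φ v i).linear v.1 := by
  have := X.φ_add v i (x - v.1)
  rw [add_sub_cancel] at this
  rw [this, map_sub]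

theorem v_mem_fc (v g) : v.1 ∈ X.fc v g := ⟨X.mem v, fun i _ => X.φ_v v i⟩

theorem step_mem_fc (v g i) : v.1 + X.w v i ∈ X.fc v g ↔ i ∉ g := by
  constructor
  · intro h hi
    have := h.2 i hi
    rw [X.φ_step, if_pos rfl] at this
    exact one_ne_zero this
  · intro h
    refine ⟨X.step_mem v i, fun j hj => ?_⟩
    rw [X.φ_step, if_neg]
    rintro rfl; exact h hj

theorem fc_inj (v) {g g' : Finset (Fin n)} (h : X.fc v g = X.fc v g') : g = g' := by
  ext i
  have := X.step_mem_fc v g i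
  rw [h, step_mem_fc] at this
  tauto

theorem fc_face (v g) : IsFace P (X.fc v g) := by
  refine ⟨⟨v.1, X.v_mem_fc v g⟩, ∑ i ∈ g, (X.φ v i).linear, (∑ i ∈ g, (X.φ v i).linear) v.1, ?_, ?_⟩
  · intro x hx
    rw [← sub_nonneg]
    simp only [LinearMap.sum_apply, ← Finset.sum_sub_distrib, ← X.φ_sub]
    exact Finset.sum_nonneg fun i _ => X.nonneg v i x hx
  · ext x
    refine and_congr_right fun hx => ?_
    rw [← sub_eq_zero]
    simp only [LinearMap.sum_apply, ← Finset.sum_sub_distrib, ← X.φ_sub]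
    rw [Finset.sum_eq_zero_iff_of_nonneg fun i _ => X.nonneg v i x hx]

theorem face_eq {F} (hF : IsFace P F) (v : Set.extremePoints ℝ P) (hv : v.1 ∈ F) : ∃ g, F = X.fc v g := by
  classical
  obtain ⟨_, u, c, h1, rfl⟩ := hF
  have hw : ∀ i, 0 ≤ u (X.w v i) := fun i => by
    have := h1 _ (X.step_mem v i)
    rw [map_add, hv.2] at this
    linarith
  refine ⟨Finset.univ.filter fun i => u (X.w v i) ≠ 0, ?_⟩
  ext x
  refine and_congr_right fun hx => ?_
  have hux : u x = c + ∑ i, u (X.w v i) * X.φ v i x := by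
    conv_lhs => rw [X.expand v x, map_add, hv.2, map_sum]
    simp [mul_comm]
  rw [hux, add_eq_left, Finset.sum_eq_zero_iff_of_nonneg fun i _ => mul_nonneg (hw i) (X.nonneg v i x hx)]
  simp [or_iff_not_imp_left]

theorem face_sub {F} (hF : IsFace P F) : F ⊆ P := by
  obtain ⟨_, u, c, h1, rfl⟩ := hF
  exact fun x hx => hx.1

/-- a face is the hull of the vertices it contains -/
theorem face_hull (X : SD P) {F} (hF : IsFace P F) : F ⊆ convexHull ℝ (Set.extremePoints ℝ P ∩ F) := by
  obtain ⟨_, u, c, h1, rfl⟩ := id hF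
  intro x hx
  have hcomp : IsCompact P := by
    have h := X.fin.isCompact_convexHull ℝ
    rwa [X.hull] at h
  have hFc : IsCompact {x ∈ P | u x = c} :=
    hcomp.inter_right (isClosed_singleton.preimage (LinearMap.continuous_of_finiteDimensional u))
  have hFconv : Convex ℝ {x ∈ P | u x = c} := X.conv.inter (convex_hyperplane u.isLinear c)
  have hk := closure_convexHull_extremePoints hFc hFconv
  rw [← hk] at hx
  have hsub : Set.extremePoints ℝ {x ∈ P | u x = c} ⊆ Set.extremePoints ℝ P ∩ {x ∈ P | u x = c} :=
    fun y hy => ⟨face_ext hF hy, hy.1⟩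
  have hcl : IsClosed (convexHull ℝ (Set.extremePoints ℝ P ∩ {x ∈ P | u x = c})) :=
    ((X.fin.subset Set.inter_subset_left).isCompact_convexHull ℝ).isClosed
  exact closure_minimal (convexHull_mono hsub) hcl hx

theorem face_vertex (X : SD P) {F} (hF : IsFace P F) : ∃ v : Set.extremePoints ℝ P, v.1 ∈ F := by
  obtain ⟨x, hx⟩ := hF.1
  have h1 := X.face_hull hF hx
  have : (Set.extremePoints ℝ P ∩ F).Nonempty := by
    rw [← convexHull_nonempty_iff (𝕜 := ℝ)]
    exact ⟨x, h1⟩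
  obtain ⟨v, hv1, hv2⟩ := this
  exact ⟨⟨v, hv1⟩, hv2⟩

theorem vs_fc (v) (g : Finset (Fin n)) : vectorSpan ℝ (X.fc v g) = Submodule.span ℝ (X.w v '' {j | j ∉ g}) := by
  apply le_antisymm
  · rw [vectorSpan_eq_span_vsub_set_right ℝ (X.v_mem_fc v g), Submodule.span_le]
    rintro _ ⟨x, hx, rfl⟩
    have : x -ᵥ v.1 = ∑ i, X.φ v i x • X.w v i := by
      conv_lhs => rw [X.expand v x]
      simp
    simp only [this]
    refine Submodule.sum_mem _ fun i _ => ?_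
    by_cases hi : i ∈ g
    · rw [hx.2 i hi, zero_smul]; exact Submodule.zero_mem _
    · exact Submodule.smul_mem _ _ (Submodule.subset_span ⟨i, hi, rfl⟩)
  · rw [Submodule.span_le]
    rintro _ ⟨i, hi, rfl⟩
    have := vsub_mem_vectorSpan ℝ ((X.step_mem_fc v g i).mpr hi) (X.v_mem_fc v g)
    rwa [vsub_eq_sub, add_sub_cancel_left] at this

theorem w_indep (v) : LinearIndependent ℝ (X.w v) := by
  rw [Fintype.linearIndependent_iff]
  intro g hg i
  have := congrArg (X.φ v i).linear hg
  simpa [X.φ_w] using this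

theorem fdim_fc (v) (g : Finset (Fin n)) : fdim (X.fc v g) = gᶜ.card := by
  unfold fdim
  rw [X.vs_fc v g]
  have hset : X.w v '' {j | j ∉ g} = Set.range (X.w v ∘ (Subtype.val : {j // j ∉ g} → Fin n)) := by
    ext y; simp
  rw [hset, finrank_span_eq_card ((X.w_indep v).comp _ Subtype.val_injective)]
  rw [Fintype.card_subtype]
  congr 1
  ext; simp

theorem aff_fc (v) (g : Finset (Fin n)) (x : Fin n → ℝ) : x ∈ affineSpan ℝ (X.fc v g) ↔ ∀ i ∈ g, X.φ v i x = 0 := by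
  constructor
  · intro hx i hi
    have hle : affineSpan ℝ (X.fc v g) ≤ (AffineSubspace.mk' (0 : ℝ) ⊥).comap (X.φ v i) := by
      rw [affineSpan_le]
      intro y hy
      simp [AffineSubspace.mem_mk', hy.2 i hi]
    have := hle hx
    simpa [AffineSubspace.mem_mk'] using this
  · intro h
    have hd : x - v.1 ∈ (affineSpan ℝ (X.fc v g)).direction := by
      rw [direction_affineSpan, X.vs_fc v g]
      have : x - v.1 = ∑ i, X.φ v i x • X.w v i := by
        conv_lhs => rw [X.expand v x]
        simp
      rw [this]
      refine Submodule.sum_mem _ fun i _ => ?_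
      by_cases hi : i ∈ g
      · rw [h i hi, zero_smul]; exact Submodule.zero_mem _
      · exact Submodule.smul_mem _ _ (Submodule.subset_span ⟨i, hi, rfl⟩)
    have := AffineSubspace.vadd_mem_of_mem_direction hd (subset_affineSpan ℝ _ (X.v_mem_fc v g))
    simpa using this

/-- facets at `v` containing `F` -/
def gF (F : Set (Fin n → ℝ)) (v : Set.extremePoints ℝ P) : Finset (Fin n) := by
  classical exact Finset.univ.filter fun i => ∀ x ∈ F, X.φ v i x = 0

theorem fc_gF {F} (hF : IsFace P F) (v : Set.extremePoints ℝ P) (hv : v.1 ∈ F) : F = X.fc v (X.gF F v) := by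
  obtain ⟨g, hg⟩ := X.face_eq hF v hv
  apply Set.Subset.antisymm
  · intro x hx
    refine ⟨face_sub hF hx, fun i hi => ?_⟩
    simp only [gF, Finset.mem_filter] at hi
    exact hi.2 x hx
  · intro x hx
    rw [hg]
    refine ⟨hx.1, fun i hi => hx.2 i ?_⟩
    simp only [gF, Finset.mem_filter]
    refine ⟨Finset.mem_univ i, fun y hy => ?_⟩
    rw [hg] at hy
    exact hy.2 i hi

theorem gF_fc (v g) : X.gF (X.fc v g) v = g :=
  X.fc_inj v (X.fc_gF (X.fc_face v g) v (X.v_mem_fc v g)).symm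

theorem exists_eps {F} (hF : IsFace P F) (v : Set.extremePoints ℝ P) (hv : v.1 ∈ F) :
    ∃ ε : Fin (fdim F) → Fin n, Function.Injective ε ∧ ∀ j, j ∉ X.gF F v ↔ ∃ i, ε i = j := by
  have hc : (X.gF F v)ᶜ.card = fdim F := by
    conv_rhs => rw [X.fc_gF hF v hv, fdim_fc]
  refine ⟨(X.gF F v)ᶜ.orderEmbOfFin hc, ((X.gF F v)ᶜ.orderEmbOfFin hc).injective, fun j => ?_⟩
  have := Finset.range_orderEmbOfFin (X.gF F v)ᶜ hc
  have h2 : j ∈ Set.range ((X.gF F v)ᶜ.orderEmbOfFin hc) ↔ j ∈ ((X.gF F v)ᶜ : Finset (Fin n)) := by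
    rw [this]; simp
  rw [← Finset.mem_compl, ← h2]
  rfl

end SD
end

noncomputable section
open MeasureTheory Pointwise
set_option linter.unusedSectionVars false
set_option linter.unusedVariables false
set_option linter.unusedSimpArgs false

attribute [local instance] Matrix.normedAddCommGroup Matrix.normedSpace

namespace SD
variable {n : ℕ} {P : Set (Fin n → ℝ)} (X : SD P)

def eps {F} (hF : IsFace P F) (v : {v : Set.extremePoints ℝ P // v.1 ∈ F}) : Fin (fdim F) → Fin n :=
  (X.exists_eps hF v.1 v.2).choose

theorem eps_inj {F} (hF : IsFace P F) (v : {v : Set.extremePoints ℝ P // v.1 ∈ F}) :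
    Function.Injective (X.eps hF v) := (X.exists_eps hF v.1 v.2).choose_spec.1

theorem eps_iff {F} (hF : IsFace P F) (v : {v : Set.extremePoints ℝ P // v.1 ∈ F}) :
    ∀ j, j ∉ X.gF F v.1 ↔ ∃ i, X.eps hF v i = j := (X.exists_eps hF v.1 v.2).choose_spec.2

theorem hp {F} (hF : IsFace P F) (v : {v : Set.extremePoints ℝ P // v.1 ∈ F}) (x : LP P) :
    x.1 ∈ F ↔ ∀ j ∈ X.gF F v.1, (X.loc v.1).a x j = 0 := by
  conv_lhs => rw [X.fc_gF hF v.1 v.2]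
  constructor
  · intro h j hj
    have := h.2 j hj
    rw [← a_cast] at this
    exact_mod_cast this
  · intro h
    refine ⟨x.2.1, fun j hj => ?_⟩
    rw [← a_cast, h j hj, Nat.cast_zero]

theorem mem_aff {F} (hF : IsFace P F) (v : {v : Set.extremePoints ℝ P // v.1 ∈ F}) (x : Fin n → ℝ) :
    x ∈ affineSpan ℝ F ↔ ∀ i ∈ X.gF F v.1, X.φ v.1 i x = 0 := by
  have h := X.aff_fc v.1 (X.gF F v.1) x
  rwa [← X.fc_gF hF v.1 v.2] at h

theorem eps_expand {F} (hF : IsFace P F) (v : {v : Set.extremePoints ℝ P // v.1 ∈ F}) {x : Fin n → ℝ}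
    (hx : x ∈ affineSpan ℝ F) :
    x = v.1.1 + ∑ j, X.φ v.1 (X.eps hF v j) x • X.w v.1 (X.eps hF v j) := by
  classical
  conv_lhs => rw [X.expand v.1 x]
  congr 1
  rw [← Finset.sum_image (s := Finset.univ) (g := X.eps hF v) (f := fun i => X.φ v.1 i x • X.w v.1 i)
    fun a _ b _ h => X.eps_inj hF v h]
  symm
  apply Finset.sum_subset (Finset.subset_univ _)
  intro i _ hi
  have : i ∈ X.gF F v.1 := by
    by_contra hcon
    obtain ⟨k, hk⟩ := (X.eps_iff hF v i).mp hcon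
    exact hi (Finset.mem_image.mpr ⟨k, Finset.mem_univ k, hk⟩)
  rw [(X.mem_aff hF v x).mp hx i this, zero_smul]

def Wm {F} (hF : IsFace P F) (T : (Fin n → ℝ) →ᵃ[ℝ] (Fin (fdim F) → ℝ))
    (v : {v : Set.extremePoints ℝ P // v.1 ∈ F}) : Matrix (Fin (fdim F)) (Fin (fdim F)) ℝ :=
  Matrix.of fun k j => T.linear (X.w v.1 (X.eps hF v j)) k

theorem Wm_eq {F} (hF : IsFace P F) (T : (Fin n → ℝ) →ᵃ[ℝ] (Fin (fdim F) → ℝ))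
    (v : {v : Set.extremePoints ℝ P // v.1 ∈ F}) {x} (hx : x ∈ affineSpan ℝ F) :
    T x - T v.1.1 = (X.Wm hF T v).mulVec fun j => X.φ v.1 (X.eps hF v j) x := by
  have h1 : T x - T v.1.1 = T.linear (x - v.1.1) := by
    have := T.linearMap_vsub x v.1.1
    rw [vsub_eq_sub, vsub_eq_sub] at this
    exact this.symm
  have h2 : x - v.1.1 = ∑ j, X.φ v.1 (X.eps hF v j) x • X.w v.1 (X.eps hF v j) := by
    rw [sub_eq_iff_eq_add']
    exact X.eps_expand hF v hx
  rw [h1, h2, map_sum]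
  funext k
  simp [Wm, Matrix.mulVec, dotProduct, mul_comm]

theorem step_aff {F} (hF : IsFace P F) (v : {v : Set.extremePoints ℝ P // v.1 ∈ F}) (j) :
    v.1.1 + X.w v.1 (X.eps hF v j) ∈ affineSpan ℝ F := by
  rw [X.mem_aff hF v]
  intro i hi
  rw [X.φ_step, if_neg]
  rintro rfl
  exact (X.eps_iff hF v _).mpr ⟨j, rfl⟩ hi

theorem Wm_det {F} (hF : IsFace P F) (T : (Fin n → ℝ) →ᵃ[ℝ] (Fin (fdim F) → ℝ))
    (hT : T '' ((affineSpan ℝ F : Set (Fin n → ℝ)) ∩ {x | IsLatticePt x}) = {y | IsLatticePt y})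
    (v : {v : Set.extremePoints ℝ P // v.1 ∈ F}) : |(X.Wm hF T v).det| = 1 := by
  have hlat : ∀ x ∈ affineSpan ℝ F, IsLatticePt x → IsLatticePt (T x) := by
    intro x hx hl
    have : T x ∈ T '' ((affineSpan ℝ F : Set (Fin n → ℝ)) ∩ {x | IsLatticePt x}) := ⟨x, ⟨hx, hl⟩, rfl⟩
    rw [hT] at this
    exact this
  have hv := hlat _ (subset_affineSpan ℝ F v.2) (X.lat v.1)
  have hintg : ∀ k j, ∃ z : ℤ, X.Wm hF T v k j = z := by
    intro k j
    have h1 := hlat _ (X.step_aff hF v j) (lat_add (X.lat v.1) (X.w_lat _ _))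
    have h2 := lat_sub h1 hv
    have h3 : T (v.1.1 + X.w v.1 (X.eps hF v j)) - T v.1.1 = T.linear (X.w v.1 (X.eps hF v j)) := by
      have := T.linearMap_vsub (v.1.1 + X.w v.1 (X.eps hF v j)) v.1.1
      rw [vsub_eq_sub, vsub_eq_sub, add_sub_cancel_left] at this
      exact this.symm
    rw [h3] at h2
    exact h2 k
  choose Z hZ using hintg
  have hinv : ∀ k, ∃ m : Fin (fdim F) → ℤ, (X.Wm hF T v).mulVec (fun j => (m j : ℝ)) = Pi.single k 1 := by
    intro k
    have hl : IsLatticePt (T v.1.1 + Pi.single k 1) := by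
      refine lat_add hv fun i => ?_
      by_cases h : i = k
      · subst h; exact ⟨1, by simp⟩
      · exact ⟨0, by simp [h]⟩
    have : T v.1.1 + Pi.single k 1 ∈ {y | IsLatticePt y} := hl
    rw [← hT] at this
    obtain ⟨y, ⟨hy, hyl⟩, hyT⟩ := this
    choose m hm using fun j => X.φ_lat v.1 (X.eps hF v j) y hyl
    refine ⟨m, ?_⟩
    have h1 := X.Wm_eq hF T v hy
    rw [hyT, add_sub_cancel_left] at h1
    simp_rw [← hm]
    exact h1.symm
  choose M hM using hinv
  have hZM : (Matrix.of Z) * (Matrix.of fun j k => M k j) = 1 := by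
    ext i k
    have := congrFun (hM k) i
    simp only [Matrix.mulVec, dotProduct, hZ] at this
    rw [Matrix.mul_apply, Matrix.one_apply]
    simp only [Matrix.of_apply]
    have h2 : (((∑ j, Z i j * M k j : ℤ)) : ℝ) = ((if i = k then 1 else 0 : ℤ) : ℝ) := by
      push_cast
      rw [this, Pi.single_apply]
    exact_mod_cast h2
  have hdet : IsUnit (Matrix.of Z).det := by
    have := congrArg Matrix.det hZM
    rw [Matrix.det_mul, Matrix.det_one] at this
    exact IsUnit.of_mul_eq_one _ this
  have hWZ : X.Wm hF T v = (Matrix.of Z).map (Int.cast : ℤ → ℝ) := by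
    ext i j; rw [hZ]; rfl
  have : (X.Wm hF T v).det = ((Matrix.of Z).det : ℝ) := by
    rw [hWZ]
    exact ((Int.castRingHom ℝ).map_det (Matrix.of Z)).symm
  rw [this]
  rcases Int.isUnit_iff.mp hdet with h | h <;> rw [h] <;> simp

def tiling {F} (hF : IsFace P F) (T : (Fin n → ℝ) →ᵃ[ℝ] (Fin (fdim F) → ℝ))
    (hbij : Set.BijOn T (affineSpan ℝ F : Set (Fin n → ℝ)) Set.univ)
    (hT : T '' ((affineSpan ℝ F : Set (Fin n → ℝ)) ∩ {x | IsLatticePt x}) = {y | IsLatticePt y}) :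
    Tiling (fdim F) {x : LP P // x.1 ∈ F} {v : Set.extremePoints ℝ P // v.1 ∈ F} where
  D v := (X.loc v.1).restr (X.eps hF v) (X.eps_inj hF v) (X.gF F v.1) (X.eps_iff hF v) (fun x => x.1 ∈ F) (X.hp hF v)
  b x := T x.1.1
  W := X.Wm hF T
  hb v x := by
    have := X.Wm_eq hF T v (subset_affineSpan ℝ F x.2)
    refine Eq.trans this ?_
    congr 1
    funext j
    exact (X.a_cast v.1 x.1 _).symm
  hW := X.Wm_det hF T hT
  inj v v' h := by
    have := hbij.injOn (subset_affineSpan ℝ F v.2) (subset_affineSpan ℝ F v'.2) h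
    exact Subtype.ext (Subtype.ext this)
  hmax u := by
    have hfin : (Set.extremePoints ℝ P ∩ F).Finite := X.fin.subset Set.inter_subset_left
    obtain ⟨v0, hv0⟩ := X.face_vertex hF
    obtain ⟨v, hv, hmax⟩ := hfin.exists_maximalFor (fun y => dotProduct u (T y)) _ ⟨v0.1, v0.2, hv0⟩
    refine ⟨⟨⟨v, hv.1⟩, hv.2⟩, fun x => ?_⟩
    have hx := X.face_hull hF x.2
    have hcv : Convex ℝ {y | dotProduct u (T y) ≤ dotProduct u (T v)} := by
      intro a ha b hb s t hs ht hst
      have h1 : T (s • a + t • b) = s • T a + t • T b := Convex.combo_affine_apply hst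
      simp only [Set.mem_ofPred_eq] at ha hb ⊢
      rw [h1, dotProduct_add, dotProduct_smul, dotProduct_smul, smul_eq_mul, smul_eq_mul]
      have : t = 1 - s := by linarith
      subst this
      nlinarith
    refine convexHull_min ?_ hcv hx
    intro y hy
    rcases le_total (dotProduct u (T v)) (dotProduct u (T y)) with h | h
    · exact hmax hy h
    · exact h

theorem exists_relvol (X : SD P) {F} (hF : IsFace P F) : ∃ vol, HasRelVol F vol := by
  obtain ⟨v0, hv0⟩ := X.face_vertex hF
  set v : {v : Set.extremePoints ℝ P // v.1 ∈ F} := ⟨v0, hv0⟩ with hv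
  have key : ∀ y : Fin (fdim F) → ℝ, ∀ i, X.φ v.1 (X.eps hF v i) (v.1.1 + ∑ j, y j • X.w v.1 (X.eps hF v j)) = y i := by
    intro y i
    rw [X.φ_add, map_sum]
    simp [X.φ_w, (X.eps_inj hF v).eq_iff]
  have key2 : ∀ y : Fin (fdim F) → ℝ, v.1.1 + ∑ j, y j • X.w v.1 (X.eps hF v j) ∈ affineSpan ℝ F := by
    intro y
    rw [X.mem_aff hF v]
    intro i hi
    rw [X.φ_add, map_sum]
    refine Finset.sum_eq_zero fun j _ => ?_
    rw [map_smul, X.φ_w, if_neg, smul_zero]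
    rintro rfl
    exact (X.eps_iff hF v _).mpr ⟨j, rfl⟩ hi
  refine ⟨_, AffineMap.pi fun j => X.φ v.1 (X.eps hF v j), ⟨fun _ _ => Set.mem_univ _, ?_, ?_⟩, ?_, rfl⟩
  · intro x hx y hy hxy
    rw [X.eps_expand hF v hx, X.eps_expand hF v hy]
    congr 1
    refine Finset.sum_congr rfl fun j _ => ?_
    have := congrFun hxy j
    simp only [AffineMap.pi_apply] at this
    rw [this]
  · intro y _
    exact ⟨_, key2 y, funext fun i => key y i⟩
  · apply Set.Subset.antisymm
    · rintro _ ⟨x, ⟨_, hl⟩, rfl⟩ i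
      exact X.φ_lat v.1 _ x hl
    · intro y hy
      refine ⟨_, ⟨key2 y, ?_⟩, funext fun i => key y i⟩
      refine lat_add (X.lat v.1) (lat_sum _ _ fun j _ => ?_)
      obtain ⟨z, hz⟩ := hy j
      rw [hz]
      exact lat_smul (X.w_lat _ _) z

end SD
end

noncomputable section
open MeasureTheory Pointwise
set_option linter.unusedSectionVars false
set_option linter.unusedVariables false
set_option linter.unusedSimpArgs false

attribute [local instance] Matrix.normedAddCommGroup Matrix.normedSpace

namespace SD
variable {n : ℕ} {P : Set (Fin n → ℝ)} (X : SD P)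

def I0 [Fintype (LP P)] (v : Set.extremePoints ℝ P) (G : Finset (Fin n)) : ℝ :=
  ∫ y in cube n, (X.loc v).tile.FF (Lam n) 0 G (zG G y)

open Classical in
theorem vol_eq [Fintype (LP P)] [Fintype (Set.extremePoints ℝ P)] {F} (hF : IsFace P F) {vol : ℝ} (hv : HasRelVol F vol) :
    (-1 : ℝ) ^ (n - fdim F) * (Nat.factorial (fdim F + 1) : ℝ) * vol =
    ∑ v : Set.extremePoints ℝ P with v.1 ∈ F, (-1 : ℝ) ^ (X.gF F v).card * X.I0 v (X.gF F v) := by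
  obtain ⟨T, hbij, hT, rfl⟩ := hv
  have h1 := (X.tiling hF T hbij hT).volume_eq
  have h2 : convexHull ℝ (Set.range (X.tiling hF T hbij hT).b) = T '' F := by
    apply Set.Subset.antisymm
    · refine convexHull_min ?_ ?_
      · rintro _ ⟨x, rfl⟩
        exact ⟨x.1.1, x.2, rfl⟩
      · have hc : Convex ℝ F := by
          obtain ⟨_, u, c, h1, rfl⟩ := hF
          exact X.conv.inter (convex_hyperplane u.isLinear c)
        exact hc.affine_image T
    · refine (Set.image_mono (X.face_hull hF)).trans ?_
      rw [AffineMap.image_convexHull]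
      refine convexHull_mono ?_
      rintro _ ⟨x, hx, rfl⟩
      exact ⟨⟨⟨x, hx.1.1, X.lat ⟨x, hx.1⟩⟩, hx.2⟩, rfl⟩
  rw [h2] at h1
  rw [← h1, ← Finset.sum_subtype_of_mem (p := fun v : Set.extremePoints ℝ P => v.1 ∈ F) (s := Finset.univ.filter fun v : Set.extremePoints ℝ P => v.1 ∈ F)
    (f := fun v => (-1 : ℝ) ^ (X.gF F v).card * X.I0 v (X.gF F v)) (by simp), Finset.mul_sum]
  have hu : Finset.subtype (fun v : Set.extremePoints ℝ P => v.1 ∈ F) (Finset.univ.filter fun v : Set.extremePoints ℝ P => v.1 ∈ F) = Finset.univ := by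
    ext v; simp [v.2]
  rw [hu]
  refine Finset.sum_congr rfl fun v _ => ?_
  have h3 := (X.loc v.1).IG0 (X.eps hF v) (X.eps_inj hF v) (X.gF F v.1) (X.eps_iff hF v) (fun x => x.1 ∈ F) (X.hp hF v)
  have hc : fdim F = (X.gF F v.1)ᶜ.card := by
    conv_lhs => rw [X.fc_gF hF v.1 v.2, fdim_fc]
  have hc2 : (X.gF F v.1)ᶜ.card + (X.gF F v.1).card = n := by
    rw [add_comm, Finset.card_add_card_compl, Fintype.card_fin]
  have e1 : n - fdim F = (X.gF F v.1).card := by omega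
  have e2 : fdim F + 1 = n + 1 - (X.gF F v.1).card := by omega
  unfold I0
  rw [h3, e1, e2, mul_assoc]
  rfl

open Classical in
theorem faceSum_eq [Fintype (LP P)] [Fintype (Set.extremePoints ℝ P)] (𝓕 : Finset (Set (Fin n → ℝ)))
    (volf : Set (Fin n → ℝ) → ℝ) (h1 : ∀ F, F ∈ 𝓕 ↔ IsFace P F) (h2 : ∀ F ∈ 𝓕, HasRelVol F (volf F)) :
    faceSum 𝓕 volf = ∑ v, ∑ G : Finset (Fin n), (-1 : ℝ) ^ G.card * X.I0 v G := by
  unfold faceSum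
  rw [Finset.sum_congr rfl fun F hF => X.vol_eq ((h1 F).mp hF) (h2 F hF)]
  rw [Finset.sum_comm' (t' := Finset.univ) (s' := fun v => 𝓕.filter fun F => v.1 ∈ F) (by simp)]
  refine Finset.sum_congr rfl fun v _ => ?_
  symm
  refine Finset.sum_bij' (fun G _ => X.fc v G) (fun F _ => X.gF F v) ?_ ?_ ?_ ?_ ?_
  · intro G _
    rw [Finset.mem_filter, h1]
    exact ⟨X.fc_face v G, X.v_mem_fc v G⟩
  · simp
  · intro G _; exact X.gF_fc v G
  · intro F hF
    rw [Finset.mem_filter, h1] at hF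
    exact (X.fc_gF hF.1 v hF.2).symm
  · intro G _
    rw [X.gF_fc]

theorem faceSumZero_iff (X : SD P) [Fintype (LP P)] : FaceSumZero P ↔ ∀ v, (X.loc v).Sing := by
  classical
  have : Finite (Set.extremePoints ℝ P) := X.fin
  have := Fintype.ofFinite (Set.extremePoints ℝ P)
  have hmain := X.comb.glob.main
  have hS : ∑ v, ∑ G : Finset (Fin n), (-1 : ℝ) ^ G.card * X.I0 v G = 0 ↔ ∀ v, (X.loc v).Sing := by
    have e : ∑ v, ∑ G : Finset (Fin n), (-1 : ℝ) ^ G.card * X.I0 v G =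
      ∑ v, ∫ y in cube n, (X.loc v).tile.FF (Lam n) 1 ∅ (zG ∅ y) := hmain.symm
    rw [e, Finset.sum_eq_zero_iff_of_nonneg fun v _ => (X.loc v).IG1.1]
    simp only [Finset.mem_univ, true_imp_iff]
    exact forall_congr' fun v => (X.loc v).IG1.2
  rw [← hS]
  constructor
  · rintro ⟨𝓕, volf, h1, h2, h3⟩
    rw [← X.faceSum_eq 𝓕 volf h1 h2, h3]
  · intro h
    choose! volf hvol using fun F (hF : IsFace P F) => X.exists_relvol hF
    refine ⟨Finset.univ.image fun p : Set.extremePoints ℝ P × Finset (Fin n) => X.fc p.1 p.2, volf, ?_, ?_, ?_⟩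
    · intro F
      simp only [Finset.mem_image, Finset.mem_univ, true_and]
      constructor
      · rintro ⟨p, rfl⟩; exact X.fc_face _ _
      · intro hF
        obtain ⟨v, hv⟩ := X.face_vertex hF
        exact ⟨(v, X.gF F v), (X.fc_gF hF v hv).symm⟩
    · intro F hF
      obtain ⟨p, _, rfl⟩ := Finset.mem_image.mp hF
      exact hvol _ (X.fc_face _ _)
    · rw [X.faceSum_eq, h]
      · intro F
        simp only [Finset.mem_image, Finset.mem_univ, true_and]
        constructor
        · rintro ⟨p, rfl⟩; exact X.fc_face _ _
        · intro hF
          obtain ⟨v, hv⟩ := X.face_vertex hF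
          exact ⟨(v, X.gF F v), (X.fc_gF hF v hv).symm⟩
      · intro F hF
        obtain ⟨p, _, rfl⟩ := Finset.mem_image.mp hF
        exact hvol _ (X.fc_face _ _)

end SD
end

noncomputable section
open MeasureTheory Pointwise
set_option linter.unusedSectionVars false
set_option linter.unusedVariables false
set_option linter.unusedSimpArgs false

theorem Loc.sing_of {n t : ℕ} {S : Type*} [Fintype S] [DecidableEq S] (D : Loc n S) (f : S → Fin t → ℝ) (c : Fin t → ℝ)
    (B : Matrix (Fin t) (Fin n) ℝ) (C : Matrix (Fin n) (Fin t) ℝ) (hBC : B * C = 1)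
    (hf : ∀ x k, f x k = c k + ∑ j, B k j * D.a x j)
    (h01 : ∀ x k l, f x k * f x l = if k = l then f x k else 0) (ht : n < 2 * t) : D.Sing := by
  intro u hu
  set H : Matrix (Fin n) (Fin n) ℝ := Matrix.of fun j k => ∑ x, u x * D.a x j * D.a x k with hH
  have hu0 : ∑ x, u x = 0 := by simpa [Loc.la] using hu none
  have hu1 : ∀ j, ∑ x, u x * D.a x j = 0 := fun j => by simpa [Loc.la] using hu (some j)
  have hlin : ∀ k, ∑ x, u x * (∑ j, B k j * D.a x j) = 0 := by
    intro k
    simp_rw [Finset.mul_sum]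
    rw [Finset.sum_comm]
    refine Finset.sum_eq_zero fun j _ => ?_
    have : ∀ x, u x * (B k j * D.a x j) = B k j * (u x * D.a x j) := fun x => by ring
    simp_rw [this, ← Finset.mul_sum, hu1, mul_zero]
  have hff : ∀ k l, ∑ x, u x * (f x k * f x l) = 0 := by
    intro k l
    simp_rw [h01]
    split_ifs with h
    · simp_rw [hf, mul_add, Finset.sum_add_distrib, ← Finset.sum_mul, hu0, hlin]
      simp
    · simp
  have hBHB : B * H * B.transpose = 0 := by
    ext k l
    have e1 : (B * H * B.transpose) k l = ∑ x, u x * ((∑ j, B k j * D.a x j) * (∑ i, B l i * D.a x i)) := by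
      simp only [Matrix.mul_apply, Matrix.transpose_apply, hH, Matrix.of_apply]
      simp_rw [Finset.sum_mul_sum, Finset.mul_sum, Finset.sum_mul]
      rw [Finset.sum_comm]
      conv_rhs => rw [Finset.sum_comm]
      refine Finset.sum_congr rfl fun j _ => ?_
      conv_rhs => rw [Finset.sum_comm]
      refine Finset.sum_congr rfl fun i _ => ?_
      refine Finset.sum_congr rfl fun x _ => ?_
      ring
    have e2 := hff k l
    have e3 : ∀ x, u x * (f x k * f x l) = u x * ((∑ j, B k j * D.a x j) * (∑ i, B l i * D.a x i)) +
      (c k * c l * u x + c l * (u x * (∑ j, B k j * D.a x j)) + c k * (u x * (∑ i, B l i * D.a x i))) := by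
      intro x; rw [hf, hf]; ring
    simp_rw [e3, Finset.sum_add_distrib, ← Finset.mul_sum, hlin, hu0] at e2
    rw [e1, Matrix.zero_apply]
    linarith
  by_contra hdet
  have hHu : IsUnit H.det := isUnit_iff_ne_zero.mpr hdet
  have hinj : Function.Injective (H * B.transpose).mulVecLin := by
    have hl : (C.transpose * H⁻¹) * (H * B.transpose) = 1 := by
      rw [Matrix.mul_assoc, ← Matrix.mul_assoc H⁻¹, Matrix.nonsing_inv_mul _ hHu, Matrix.one_mul,
        ← Matrix.transpose_mul, hBC, Matrix.transpose_one]
    intro y z hyz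
    have := congrArg (C.transpose * H⁻¹).mulVec hyz
    simp only [Matrix.mulVecLin_apply, Matrix.mulVec_mulVec, hl, Matrix.one_mulVec] at this
    exact this
  have hker : ∀ y, (H * B.transpose).mulVecLin y ∈ LinearMap.ker B.mulVecLin := by
    intro y
    rw [LinearMap.mem_ker, Matrix.mulVecLin_apply, Matrix.mulVecLin_apply, Matrix.mulVec_mulVec, ← Matrix.mul_assoc, hBHB,
      Matrix.zero_mulVec]
  have h1 : t ≤ Module.finrank ℝ (LinearMap.ker B.mulVecLin) := by
    have := LinearMap.finrank_le_finrank_of_injective (f := (H * B.transpose).mulVecLin.codRestrict _ hker)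
      (fun a b hab => hinj (congrArg Subtype.val hab))
    simpa using this
  have hsurj : LinearMap.range B.mulVecLin = ⊤ := by
    rw [LinearMap.range_eq_top]
    intro y
    refine ⟨C.mulVec y, ?_⟩
    rw [Matrix.mulVecLin_apply, Matrix.mulVec_mulVec, hBC, Matrix.one_mulVec]
  have h2 := LinearMap.finrank_range_add_finrank_ker B.mulVecLin
  rw [hsurj] at h2
  simp at h2
  omega

theorem unimodSimplex_sub {t : ℕ} {y : Fin t → ℝ} (hy : y ∈ unimodSimplex t) : (∀ k, 0 ≤ y k) ∧ ∑ k, y k ≤ 1 := by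
  have hc : Convex ℝ {y : Fin t → ℝ | (∀ k, 0 ≤ y k) ∧ ∑ k, y k ≤ 1} := by
    intro a ha b hb p q hp hq hpq
    refine ⟨fun k => ?_, ?_⟩
    · have h1 := ha.1 k
      have h2 := hb.1 k
      simp only [Pi.add_apply, Pi.smul_apply, smul_eq_mul]
      positivity
    · simp only [Pi.add_apply, Pi.smul_apply, smul_eq_mul, Finset.sum_add_distrib, ← Finset.mul_sum]
      have := ha.2
      have := hb.2
      nlinarith
  refine convexHull_min ?_ hc hy
  rintro _ ⟨k, rfl⟩
  refine ⟨fun j => ?_, ?_⟩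
  · unfold stdSimplexVert; split_ifs <;> norm_num
  · unfold stdSimplexVert
    rcases Nat.eq_zero_or_pos (k : ℕ) with h | h
    · simp [h]
    · rw [Finset.sum_eq_single ⟨(k : ℕ) - 1, by omega⟩]
      · split_ifs <;> norm_num
      · intro j _ hj
        rw [if_neg]
        intro h'
        exact hj (Fin.ext (by simp; omega))
      · simp

theorem simplex_lat {t : ℕ} {y : Fin t → ℝ} (hy : y ∈ unimodSimplex t) (hl : IsLatticePt y) (k l : Fin t) :
    y k * y l = if k = l then y k else 0 := by
  obtain ⟨h0, h1⟩ := unimodSimplex_sub hy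
  obtain ⟨z, rfl⟩ := lat_cast hl
  simp only at h0 h1 ⊢
  have h0' : ∀ k, 0 ≤ z k := fun k => by exact_mod_cast h0 k
  have h1' : ∑ k, z k ≤ 1 := by exact_mod_cast h1
  have key : z k * z l = if k = l then z k else 0 := by
    split_ifs with h
    · subst h
      have := Finset.single_le_sum (f := z) (fun i _ => h0' i) (Finset.mem_univ k)
      have h2 := h0' k
      have : z k = 0 ∨ z k = 1 := by omega
      rcases this with h | h <;> rw [h] <;> rfl
    · have h2 : z k + z l ≤ ∑ i, z i := by
        rw [← Finset.add_sum_erase _ _ (Finset.mem_univ k)]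
        have := Finset.single_le_sum (f := z) (s := Finset.univ.erase k) (fun i _ => h0' i) (Finset.mem_erase.mpr ⟨Ne.symm h, Finset.mem_univ l⟩)
        omega
      have h3 := h0' k
      have h4 := h0' l
      have : z k = 0 ∨ z l = 0 := by omega
      rcases this with h | h <;> rw [h] <;> simp
  have := congrArg (Int.cast : ℤ → ℝ) key
  push_cast at this
  convert this using 1

/-- the forward direction -/
theorem forward {n : ℕ} {P : Set (Fin n → ℝ)} (X : SD P) (t : ℕ) (U : Matrix (Fin n) (Fin n) ℤ) (w : Fin n → ℤ)
    (A : Matrix (Fin t) (Fin n) ℤ) (hU : IsUnit U.det) (hsurj : ∀ y : Fin t → ℤ, ∃ x : Fin n → ℤ, A.mulVec x = y)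
    (himg : matMap A '' (unimodMap U w '' P) = unimodSimplex t) (ht : (n : ℝ) / 2 < (t : ℝ)) : FaceSumZero P := by
  classical
  have : Finite (SD.LP P) := X.lp_finite
  have := Fintype.ofFinite (SD.LP P)
  rw [X.faceSumZero_iff]
  intro v
  have ht' : n < 2 * t := by
    have : (n : ℝ) < 2 * t := by linarith
    exact_mod_cast this
  set M : Matrix (Fin t) (Fin n) ℤ := A * U with hM
  set f : (Fin n → ℝ) → Fin t → ℝ := fun x => matMap A (unimodMap U w x) with hf
  have hfM : ∀ x k, f x k = ∑ j, (M k j : ℝ) * x j + ∑ i, (A k i : ℝ) * w i := by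
    intro x k
    simp only [hf, matMap, unimodMap, hM, Matrix.mul_apply, mul_add, Finset.sum_add_distrib]
    congr 1
    push_cast
    simp_rw [Finset.mul_sum, Finset.sum_mul]
    rw [Finset.sum_comm]
    simp_rw [mul_assoc]
  have hsub : ∀ x y k, f (x + y) k = f x k + ∑ j, (M k j : ℝ) * y j := by
    intro x y k
    rw [hfM, hfM]
    simp only [Pi.add_apply, mul_add, Finset.sum_add_distrib]
    ring
  have hC : ∀ k : Fin t, ∃ y : Fin n → ℤ, M.mulVec y = Pi.single k 1 := by
    intro k
    obtain ⟨x, hx⟩ := hsurj (Pi.single k 1)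
    refine ⟨U⁻¹.mulVec x, ?_⟩
    rw [hM, Matrix.mulVec_mulVec, Matrix.mul_assoc, Matrix.mul_nonsing_inv _ hU, Matrix.mul_one, hx]
  choose Y hY using hC
  set Mr : (Fin n → ℝ) → Fin t → ℝ := fun y k => ∑ j, (M k j : ℝ) * y j with hMr
  refine (X.loc v).sing_of (fun x => f x.1) (fun k => f v.1 k) (Matrix.of fun k j => Mr (X.w v j) k)
    (Matrix.of fun j k => (X.φ v j).linear fun i => (Y k i : ℝ)) ?_ ?_ ?_ ht'
  · ext k l
    rw [Matrix.mul_apply, Matrix.one_apply]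
    simp only [Matrix.of_apply]
    have h1 : (fun i => (Y l i : ℝ)) = ∑ j, (X.φ v j).linear (fun i => (Y l i : ℝ)) • X.w v j := X.lin_expand v _
    have h2 : Mr (fun i => (Y l i : ℝ)) k = ∑ j, Mr (X.w v j) k * (X.φ v j).linear (fun i => (Y l i : ℝ)) := by
      conv_lhs => rw [h1]
      simp only [hMr, Finset.sum_apply, Pi.smul_apply, smul_eq_mul, Finset.mul_sum, Finset.sum_mul]
      rw [Finset.sum_comm]
      refine Finset.sum_congr rfl fun j _ => Finset.sum_congr rfl fun i _ => ?_
      ring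
    rw [← h2]
    have h3 := congrFun (hY l) k
    have h4 : Mr (fun i => (Y l i : ℝ)) k = ((M.mulVec (Y l) k : ℤ) : ℝ) := by
      simp [hMr, Matrix.mulVec, dotProduct]
    rw [h4, h3, Pi.single_apply]
    split_ifs <;> simp
  · intro x k
    have h1 := X.expand v x.1
    simp only [Matrix.of_apply, SD.a_cast]
    conv_lhs => rw [h1, hsub]
    congr 1
    simp only [hMr, Finset.sum_apply, Pi.smul_apply, smul_eq_mul, Finset.mul_sum, Finset.sum_mul]
    rw [Finset.sum_comm]
    refine Finset.sum_congr rfl fun j _ => Finset.sum_congr rfl fun i _ => ?_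
    ring
  · intro x k l
    refine simplex_lat (y := f x.1) ?_ ?_ k l
    · rw [← himg]
      exact ⟨_, ⟨x.1, x.2.1, rfl⟩, rfl⟩
    · obtain ⟨z, hz⟩ := lat_cast x.2.2
      intro k
      refine ⟨∑ j, M k j * z j + ∑ i, A k i * w i, ?_⟩
      rw [hfM, hz]
      push_cast
      rfl
end

noncomputable section
open MeasureTheory Pointwise
set_option linter.unusedSectionVars false
set_option linter.unusedVariables false
set_option linter.unusedSimpArgs false

/-- local unimodular cone data of a set `R` at a point `v` -/
structure ConeAt {n : ℕ} (R : Set (Fin n → ℝ)) (v : Fin n → ℝ) (d : ℕ) where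
  w : Fin d → (Fin n → ℝ)
  ψ : Fin d → ((Fin n → ℝ) →ₗ[ℝ] ℝ)
  c : Fin d → ℝ
  w_lat : ∀ i, IsLatticePt (w i)
  ψ_lat : ∀ i x, IsLatticePt x → ∃ z : ℤ, ψ i x = z
  ψ_w : ∀ i j, ψ i (w j) = if i = j then 1 else 0
  expand : ∀ x ∈ R, x = v + ∑ i, ψ i (x - v) • w i
  nonneg : ∀ x ∈ R, ∀ i, 0 ≤ ψ i (x - v)
  c_pos : ∀ i, 0 < c i
  c_mem : ∀ i, v + c i • w i ∈ R
  c_max : ∀ i s, v + s • w i ∈ R → s ≤ c i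

namespace ConeAt
variable {n : ℕ} {R : Set (Fin n → ℝ)} {v : Fin n → ℝ} {d : ℕ} (D : ConeAt R v d)

theorem indep : LinearIndependent ℝ D.w := by
  rw [Fintype.linearIndependent_iff]
  intro g hg i
  have := congrArg (D.ψ i) hg
  simpa [D.ψ_w] using this

/-- the subset where the coordinates in `g` vanish -/
def sub (g : Finset (Fin d)) : Set (Fin n → ℝ) := {x ∈ R | ∀ i ∈ g, D.ψ i (x - v) = 0}

theorem mem_sub (hv : v ∈ R) (g) : v ∈ D.sub g := ⟨hv, fun i _ => by simp⟩

theorem step_sub (g) (i) (hi : i ∉ g) : v + D.c i • D.w i ∈ D.sub g := by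
  refine ⟨D.c_mem i, fun j hj => ?_⟩
  rw [add_sub_cancel_left, map_smul, D.ψ_w, if_neg, smul_zero]
  rintro rfl; exact hi hj

theorem vs_sub (hv : v ∈ R) (g : Finset (Fin d)) : vectorSpan ℝ (D.sub g) = Submodule.span ℝ (D.w '' {j | j ∉ g}) := by
  apply le_antisymm
  · rw [vectorSpan_eq_span_vsub_set_right ℝ (D.mem_sub hv g), Submodule.span_le]
    rintro _ ⟨x, hx, rfl⟩
    have : x -ᵥ v = ∑ i, D.ψ i (x - v) • D.w i := by
      rw [vsub_eq_sub, sub_eq_iff_eq_add']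
      exact D.expand x hx.1
    simp only [this]
    refine Submodule.sum_mem _ fun i _ => ?_
    by_cases hi : i ∈ g
    · rw [hx.2 i hi, zero_smul]; exact Submodule.zero_mem _
    · exact Submodule.smul_mem _ _ (Submodule.subset_span ⟨i, hi, rfl⟩)
  · rw [Submodule.span_le]
    rintro _ ⟨i, hi, rfl⟩
    have := vsub_mem_vectorSpan ℝ (D.step_sub g i hi) (D.mem_sub hv g)
    rw [vsub_eq_sub, add_sub_cancel_left] at this
    have h2 := Submodule.smul_mem _ (D.c i)⁻¹ this
    rwa [smul_smul, inv_mul_cancel₀ (D.c_pos i).ne', one_smul] at h2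

theorem fdim_sub (hv : v ∈ R) (g : Finset (Fin d)) : fdim (D.sub g) = gᶜ.card := by
  unfold fdim
  rw [D.vs_sub hv g]
  have hset : D.w '' {j | j ∉ g} = Set.range (D.w ∘ (Subtype.val : {j // j ∉ g} → Fin d)) := by
    ext y; simp
  rw [hset, finrank_span_eq_card (D.indep.comp _ Subtype.val_injective)]
  rw [Fintype.card_subtype]
  congr 1
  ext; simp

theorem sub_empty : D.sub ∅ = R := by ext x; simp [sub]

theorem sub_face (hv : v ∈ R) (g) : IsFace R (D.sub g) := by
  refine ⟨⟨v, D.mem_sub hv g⟩, ∑ i ∈ g, D.ψ i, (∑ i ∈ g, D.ψ i) v, ?_, ?_⟩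
  · intro x hx
    rw [← sub_nonneg]
    simp only [LinearMap.sum_apply, ← Finset.sum_sub_distrib, ← map_sub]
    exact Finset.sum_nonneg fun i _ => D.nonneg x hx i
  · ext x
    refine and_congr_right fun hx => ?_
    rw [← sub_eq_zero]
    simp only [LinearMap.sum_apply, ← Finset.sum_sub_distrib, ← map_sub]
    rw [Finset.sum_eq_zero_iff_of_nonneg fun i _ => D.nonneg x hx i]

theorem face_sub {F} (hF : IsFace R F) (hv : v ∈ F) : ∃ g, F = D.sub g := by
  classical
  obtain ⟨_, u, c, h1, rfl⟩ := hF
  have hw : ∀ i, 0 ≤ u (D.w i) := fun i => by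
    have := h1 _ (D.c_mem i)
    rw [map_add, hv.2, map_smul, smul_eq_mul] at this
    have := D.c_pos i
    by_contra hcon
    push Not at hcon
    nlinarith
  refine ⟨Finset.univ.filter fun i => u (D.w i) ≠ 0, ?_⟩
  ext x
  refine and_congr_right fun hx => ?_
  have hux : u x = c + ∑ i, u (D.w i) * D.ψ i (x - v) := by
    conv_lhs => rw [D.expand x hx, map_add, hv.2, map_sum]
    simp [mul_comm]
  rw [hux, add_eq_left, Finset.sum_eq_zero_iff_of_nonneg fun i _ => mul_nonneg (hw i) (D.nonneg x hx i)]
  simp [or_iff_not_imp_left]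

theorem sub_seg (hR : Convex ℝ R) (hv : v ∈ R) (i) : D.sub ({i}ᶜ : Finset (Fin d)) = segment ℝ v (v + D.c i • D.w i) := by
  apply Set.Subset.antisymm
  · intro x hx
    have e : x = v + D.ψ i (x - v) • D.w i := by
      conv_lhs => rw [D.expand x hx.1]
      congr 1
      rw [Finset.sum_eq_single i]
      · intro j _ hj
        rw [hx.2 j (by simp [hj]), zero_smul]
      · simp
    have h1 := D.nonneg x hx.1 i
    have h2 := D.c_max i (D.ψ i (x - v)) (by rw [← e]; exact hx.1)
    have hc := D.c_pos i
    rw [segment_eq_image']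
    refine ⟨D.ψ i (x - v) / D.c i, ⟨by positivity, (div_le_one hc).mpr h2⟩, ?_⟩
    simp only [add_sub_cancel_left]
    rw [smul_smul, div_mul_cancel₀ _ hc.ne', ← e]
  · intro x hx
    refine ⟨hR.segment_subset hv (D.c_mem i) hx, fun j hj => ?_⟩
    rw [segment_eq_image'] at hx
    obtain ⟨s, _, rfl⟩ := hx
    simp only [add_sub_cancel_left]
    rw [map_smul, map_smul, D.ψ_w, if_neg (by simpa using hj)]
    simp

theorem prim (i) (z : Fin n → ℤ) (hz : D.w i = fun j => (z j : ℝ)) : IsPrimitive z := by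
  constructor
  · rintro rfl
    have h1 := D.ψ_w i i
    have : D.w i = 0 := by rw [hz]; funext j; simp
    rw [this, map_zero, if_pos rfl] at h1
    exact zero_ne_one h1
  · intro k hk
    choose y hy using hk
    have e : D.w i = (k : ℝ) • fun j => (y j : ℝ) := by
      rw [hz]; funext j
      simp only [Pi.smul_apply, smul_eq_mul]
      rw [hy j]; push_cast; ring
    obtain ⟨m, hm⟩ := D.ψ_lat i (fun j => (y j : ℝ)) fun j => ⟨y j, rfl⟩
    have h1 := D.ψ_w i i
    rw [e, map_smul, hm, if_pos rfl, smul_eq_mul] at h1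
    have h2 : k * m = 1 := by exact_mod_cast h1
    exact IsUnit.of_mul_eq_one m h2

end ConeAt

theorem smooth_of {n : ℕ} {R : Set (Fin n → ℝ)} (hR : Convex ℝ R)
    (h : ∀ v ∈ Set.extremePoints ℝ R, ∃ d, Nonempty (ConeAt R v d)) : IsSmoothPoly R := by
  intro v hv
  have hvR := hv.1
  obtain ⟨d, ⟨D⟩⟩ := h v hv
  have hd : fdim R = d := by
    have := D.fdim_sub hvR ∅
    rw [D.sub_empty] at this
    simpa using this
  subst hd
  choose z hz using fun i => lat_cast (D.w_lat i)
  have hspan : vectorSpan ℝ R = Submodule.span ℝ (Set.range D.w) := by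
    have := D.vs_sub hvR ∅
    rw [D.sub_empty] at this
    rw [this]
    simp
  refine ⟨z, D.c, D.c_pos, fun i => D.prim i _ (hz i), ?_⟩
  simp_rw [← hz]
  have hzw : D.w = fun i j => (z i j : ℝ) := funext hz
  refine ⟨hzw ▸ D.indep, fun i => ?_, ?_, ?_⟩
  · rw [hspan]; exact Submodule.subset_span ⟨i, rfl⟩
  · intro y hy
    rw [hspan, Submodule.mem_span_range_iff_exists_fun] at hy
    obtain ⟨m, hm⟩ := hy
    choose k hk using fun i => D.ψ_lat i (fun j => (y j : ℝ)) fun j => ⟨y j, rfl⟩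
    refine ⟨k, ?_⟩
    have : ∀ i, m i = k i := fun i => by
      rw [← hk, ← hm, map_sum]
      simp [D.ψ_w]
    simp_rw [← this]
    exact hm.symm
  · intro F
    constructor
    · rintro ⟨hF, hvF, h1⟩
      obtain ⟨g, rfl⟩ := D.face_sub hF hvF
      rw [D.fdim_sub hvR] at h1
      obtain ⟨i, hi⟩ := Finset.card_eq_one.mp h1
      refine ⟨i, ?_⟩
      rw [← D.sub_seg hR hvR i, ← hi, compl_compl]
    · rintro ⟨i, rfl⟩
      rw [← D.sub_seg hR hvR i]
      refine ⟨D.sub_face hvR _, D.mem_sub hvR _, ?_⟩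
      rw [D.fdim_sub hvR]
      simp

theorem ext_translate {n : ℕ} (R : Set (Fin n → ℝ)) (a : Fin n → ℝ) {v : Fin n → ℝ}
    (hv : v ∈ Set.extremePoints ℝ ((fun x => x - a) '' R)) : v + a ∈ Set.extremePoints ℝ R := by
  rw [mem_extremePoints] at hv ⊢
  obtain ⟨⟨r, hr, rfl⟩, h⟩ := hv
  simp only [sub_add_cancel] at h ⊢
  refine ⟨hr, fun x hx y hy hxy => ?_⟩
  have := h (x - a) ⟨x, hx, rfl⟩ (y - a) ⟨y, hy, rfl⟩ ?_
  · exact ⟨sub_left_injective this.1, sub_left_injective this.2⟩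
  · obtain ⟨s, t, hs, ht, hst, rfl⟩ := hxy
    refine ⟨s, t, hs, ht, hst, ?_⟩
    have : a = (s + t) • a := by rw [hst, one_smul]
    conv_rhs => rw [this]
    module

theorem convex_translate {n : ℕ} {R : Set (Fin n → ℝ)} (hR : Convex ℝ R) (a : Fin n → ℝ) :
    Convex ℝ ((fun x => x - a) '' R) := by
  have : (fun x => x - a) '' R = (fun x => -a + x) '' R := by
    congr 1; funext x; abel
  rw [this]
  exact hR.translate (-a)

/-- a translate of a face of a smooth polytope is smooth -/
theorem SD.face_smooth {n : ℕ} {P : Set (Fin n → ℝ)} (X : SD P) {F} (hF : IsFace P F) (a : Fin n → ℝ) :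
    IsSmoothPoly ((fun x => x - a) '' F) := by
  have hc : Convex ℝ F := by
    obtain ⟨_, u, c, h1, rfl⟩ := hF
    exact X.conv.inter (convex_hyperplane u.isLinear c)
  refine smooth_of (convex_translate hc a) fun r hr => ?_
  have hr' := ext_translate F a hr
  set v : {v : Set.extremePoints ℝ P // v.1 ∈ F} := ⟨⟨r + a, face_ext hF hr'⟩, hr'.1⟩ with hv
  have hrv : r = v.1.1 - a := by simp [hv]
  refine ⟨fdim F, ⟨{
    w := fun i => X.w v.1 (X.eps hF v i)
    ψ := fun i => (X.φ v.1 (X.eps hF v i)).linear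
    c := fun i => X.c v.1 (X.eps hF v i)
    w_lat := fun i => X.w_lat _ _
    ψ_lat := fun i x hx => X.lin_int _ _ hx
    ψ_w := fun i j => by rw [X.φ_w]; simp [(X.eps_inj hF v).eq_iff]
    expand := ?_
    nonneg := ?_
    c_pos := fun i => by exact_mod_cast X.c_pos _ _
    c_mem := ?_
    c_max := ?_ }⟩⟩
  · rintro _ ⟨x, hx, rfl⟩
    simp only
    have h1 := X.eps_expand hF v (subset_affineSpan ℝ F hx)
    have h2 : x - a - r = x - v.1.1 := by rw [hrv]; abel
    rw [h2]
    simp only [map_sub, ← X.φ_sub]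
    conv_lhs => rw [h1]
    rw [hrv]; abel
  · rintro _ ⟨x, hx, rfl⟩ i
    have h2 : x - a - r = x - v.1.1 := by rw [hrv]; abel
    rw [h2, map_sub, ← X.φ_sub]
    exact X.nonneg _ _ _ (SD.face_sub hF hx)
  · intro i
    refine ⟨v.1.1 + (X.c v.1 (X.eps hF v i) : ℝ) • X.w v.1 (X.eps hF v i), ?_, ?_⟩
    · refine (X.fc_gF hF v.1 v.2).symm.subset ⟨(X.nb_mem _ _).1, fun j hj => ?_⟩
      rw [X.φ_add, map_smul, X.φ_w, if_neg, smul_zero]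
      rintro rfl
      exact (X.eps_iff hF v _).mpr ⟨i, rfl⟩ hj
    · simp only; rw [hrv]; abel
  · rintro i s ⟨x, hx, hxs⟩
    refine X.ray_le v.1 _ s ?_
    have : v.1.1 + s • X.w v.1 (X.eps hF v i) = x := by
      simp only at hxs
      rw [sub_eq_iff_eq_add] at hxs
      rw [hxs, hrv]; abel
    rw [this]
    exact SD.face_sub hF hx
end

noncomputable section
open MeasureTheory Pointwise
set_option linter.unusedSectionVars false
set_option linter.unusedVariables false
set_option linter.unusedSimpArgs false

/-- combinatorial data of a Cayley decomposition -/
structure Cay {n : ℕ} {P : Set (Fin n → ℝ)} (X : SD P) (t : ℕ) where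
  v : Set.extremePoints ℝ P
  κ : Fin t → Fin n
  κ_inj : Function.Injective κ
  u : Set.extremePoints ℝ P
  j : Fin n
  hL : ∀ x, X.φ u j x = 1 - ∑ k, X.φ v (κ k) x
  ht : n < 2 * t

namespace SD
variable {n : ℕ} {P : Set (Fin n → ℝ)} (X : SD P)

def mm (v : Set.extremePoints ℝ P) (i l : Fin n) : ℕ :=
  ⌊X.φ v i ((X.nb v i).1 + X.w (X.nb v i) (X.tau v i l))⌋₊

theorem mm_cast (v i l) : (X.mm v i l : ℝ) = X.φ v i ((X.nb v i).1 + X.w (X.nb v i) (X.tau v i l)) :=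
  X.a_cast v ⟨(X.nb v i).1 + X.w (X.nb v i) (X.tau v i l), X.step_mem _ _, lat_add (X.lat _) (X.w_lat _ _)⟩ i

theorem mm_pt (v i l) (hl : l ≠ i) : (X.nb v i).1 + X.w (X.nb v i) (X.tau v i l) = v.1 + X.w v l + (X.mm v i l : ℝ) • X.w v i := by
  have h := X.expand v ((X.nb v i).1 + X.w (X.nb v i) (X.tau v i l))
  rw [h, add_assoc]
  congr 1
  rw [← Finset.add_sum_erase _ _ (Finset.mem_univ i), ← mm_cast, add_comm]
  congr 1
  rw [Finset.sum_eq_single l]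
  · rw [X.tau_spec v i l hl, X.φ_step, if_pos rfl, one_smul]
  · intro j hj hjl
    rw [X.tau_spec v i j (Finset.ne_of_mem_erase hj), X.φ_step, if_neg, zero_smul]
    exact fun h => hjl ((X.tau v i).injective h)
  · intro h
    exact absurd (Finset.mem_erase.mpr ⟨hl, Finset.mem_univ l⟩) h

theorem exists_cay (X : SD P) [Fintype (LP P)] (v : Set.extremePoints ℝ P) (hs : (X.loc v).Sing) : ∃ t, Nonempty (Cay X t) := by
  classical
  have hE : ∀ i k, k ≤ X.c v i → ∃ x, ∀ j, (X.loc v).a x j = if j = i then k else 0 := by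
    intro i k hk
    have hmem := X.ray_mem v i k (by positivity) (by exact_mod_cast hk)
    refine ⟨⟨v.1 + (k : ℝ) • X.w v i, hmem, lat_add (X.lat v) ?_⟩, fun j => ?_⟩
    · exact_mod_cast lat_smul (X.w_lat v i) k
    · have h := X.a_cast v ⟨v.1 + (k : ℝ) • X.w v i, hmem, lat_add (X.lat v) (by exact_mod_cast lat_smul (X.w_lat v i) k)⟩ j
      simp only at h
      rw [X.φ_add, map_smul, X.φ_w] at h
      split_ifs at h ⊢ with hji
      · simp at h; exact_mod_cast h
      · simp at h; exact_mod_cast h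
  have hE2 : ∀ i l, l ≠ i → ∀ k ≤ X.mm v i l, ∃ x, ∀ j, (X.loc v).a x j = if j = i then k else if j = l then 1 else 0 := by
    intro i l hl k hk
    have hmem : v.1 + X.w v l + (k : ℝ) • X.w v i ∈ P := by
      have h1 := X.step_mem v l
      have h2 := X.step_mem (X.nb v i) (X.tau v i l)
      rw [X.mm_pt v i l hl] at h2
      rcases Nat.eq_zero_or_pos (X.mm v i l) with h0 | h0
      · have : k = 0 := by omega
        subst this
        simpa using h1
      · have hp : (0 : ℝ) < X.mm v i l := by exact_mod_cast h0
        have h := X.conv.add_smul_mem h1 h2 (t := k / X.mm v i l)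
          ⟨by positivity, (div_le_one hp).mpr (by exact_mod_cast hk)⟩
        rwa [smul_smul, div_mul_cancel₀ _ hp.ne'] at h
    have hlat : IsLatticePt (v.1 + X.w v l + (k : ℝ) • X.w v i) :=
      lat_add (lat_add (X.lat v) (X.w_lat v l)) (by exact_mod_cast lat_smul (X.w_lat v i) k)
    refine ⟨⟨_, hmem, hlat⟩, fun j => ?_⟩
    have h := X.a_cast v ⟨_, hmem, hlat⟩ j
    simp only at h
    rw [show X.φ v j (v.1 + X.w v l + (k : ℝ) • X.w v i) = (if j = l then 1 else 0) + (k : ℝ) • (if j = i then 1 else 0) by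
      rw [add_assoc, X.φ_add, map_add, map_smul, X.φ_w, X.φ_w]] at h
    by_cases hji : j = i
    · subst hji
      rw [if_neg (Ne.symm hl)] at h
      simp at h ⊢
      exact_mod_cast h
    · rw [if_neg hji] at h ⊢
      split_ifs at h ⊢ with hjl
      · simp at h; exact_mod_cast h
      · simp at h; exact_mod_cast h
  obtain ⟨i, hi1, hi2, hi3⟩ := (X.loc v).sing_struct hs (X.c v) (X.mm v) (X.c_pos v) hE hE2
  set C : Finset (Fin n) := (Finset.univ.filter fun l => l ≠ i ∧ X.mm v i l = 1)ᶜ with hC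
  have hcard : C.card + (Finset.univ.filter fun l => l ≠ i ∧ X.mm v i l = 1).card = n := by
    rw [hC, Finset.card_compl_add_card, Fintype.card_fin]
  refine ⟨C.card, ⟨{
    v := v
    κ := C.orderEmbOfFin rfl
    κ_inj := (C.orderEmbOfFin rfl).injective
    u := X.nb v i
    j := X.tau v i i
    hL := ?_
    ht := by omega }⟩⟩
  intro x
  have hs : ∑ k, X.φ v (C.orderEmbOfFin rfl k) x = ∑ l ∈ C, X.φ v l x := by
    have h := Finset.sum_map Finset.univ (C.orderEmbOfFin rfl).toEmbedding (fun l => X.φ v l x)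
    rw [Finset.map_orderEmbOfFin_univ] at h
    exact h.symm
  have hα : ∀ l, l ≠ i → (X.φ (X.nb v i) (X.tau v i i)).linear (X.w v l) = X.mm v i l - 1 := by
    intro l hl
    have h1 := X.wall_eq v i ((X.nb v i).1 + X.w (X.nb v i) (X.tau v i l))
    rw [X.φ_step, if_neg (fun h => hl ((X.tau v i).injective h).symm), ← mm_cast, hi1,
      Finset.sum_eq_single l] at h1
    · rw [X.tau_spec v i l hl, X.φ_step, if_pos rfl] at h1
      push_cast at h1
      linarith
    · intro j hj hjl
      rw [X.tau_spec v i j (Finset.ne_of_mem_erase hj), X.φ_step, if_neg, mul_zero]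
      exact fun h => hjl ((X.tau v i).injective h)
    · intro h
      exact absurd (Finset.mem_erase.mpr ⟨hl, Finset.mem_univ l⟩) h
  have hiC : i ∈ C := by simp [hC]
  rw [hs, X.wall_eq v i x, hi1, ← Finset.add_sum_erase _ _ hiC]
  have h2 : ∑ l ∈ Finset.univ.erase i, (X.φ (X.nb v i) (X.tau v i i)).linear (X.w v l) * X.φ v l x =
      - ∑ l ∈ C.erase i, X.φ v l x := by
    rw [← Finset.sum_neg_distrib]
    symm
    refine Eq.trans (Finset.sum_congr rfl fun l hl => ?_) (Finset.sum_subset (f := fun l =>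
      (X.φ (X.nb v i) (X.tau v i i)).linear (X.w v l) * X.φ v l x) (Finset.erase_subset_erase i (Finset.subset_univ C)) ?_)
    · have hli := Finset.ne_of_mem_erase hl
      have hlC := Finset.mem_of_mem_erase hl
      have h0 : X.mm v i l = 0 := by
        have h1 := hi2 l hli
        simp [hC, hli] at hlC
        omega
      rw [hα l hli, h0]; simp
    · intro l hl hlC
      have hli := Finset.ne_of_mem_erase hl
      have h0 : X.mm v i l = 1 := by
        by_contra hne
        exact hlC (Finset.mem_erase.mpr ⟨hli, by simp [hC, hli, hne]⟩)
      rw [hα l hli, h0]; simp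
  rw [h2]
  push_cast
  ring

end SD
end

noncomputable section
open MeasureTheory Pointwise
set_option linter.unusedSectionVars false
set_option linter.unusedVariables false
set_option linter.unusedSimpArgs false

namespace Cay
variable {n : ℕ} {P : Set (Fin n → ℝ)} {X : SD P} {t : ℕ} (K : Cay X t)

def L : Fin (t + 1) → ((Fin n → ℝ) →ᵃ[ℝ] ℝ) := Fin.cons (X.φ K.u K.j) fun k => X.φ K.v (K.κ k)

theorem L_zero : K.L 0 = X.φ K.u K.j := rfl
theorem L_succ (k) : K.L (Fin.succ k) = X.φ K.v (K.κ k) := rfl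

theorem isφ (k) : ∃ p j, K.L k = X.φ p j := by
  refine Fin.cases ⟨_, _, rfl⟩ (fun k => ⟨_, _, rfl⟩) k

theorem L_sum (x) : ∑ k, K.L k x = 1 := by
  rw [Fin.sum_univ_succ, K.L_zero, K.hL]
  simp [L_succ]

theorem L_lin_sum (y) : ∑ k, (K.L k).linear y = 0 := by
  have h1 := K.L_sum (0 + y)
  simp_rw [SD.aff_add, Finset.sum_add_distrib, K.L_sum] at h1
  linarith

theorem L_nonneg (k) {x} (hx : x ∈ P) : 0 ≤ K.L k x := by
  obtain ⟨p, j, h⟩ := K.isφ k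
  rw [h]; exact X.nonneg _ _ _ hx

theorem L_lat (k) {x} (hx : IsLatticePt x) : ∃ z : ℤ, K.L k x = z := by
  obtain ⟨p, j, h⟩ := K.isφ k
  rw [h]; exact X.φ_lat _ _ _ hx

/-- the pieces -/
def R (k : Fin (t + 1)) : Set (Fin n → ℝ) := {x ∈ P | ∀ l, l ≠ k → K.L l x = 0}

theorem R_one {k x} (hx : x ∈ K.R k) : K.L k x = 1 := by
  have := K.L_sum x
  rwa [Finset.sum_eq_single k (fun l _ hl => hx.2 l hl) (by simp)] at this

theorem L_inj : Function.Injective K.L := by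
  have h0 : ∀ k, K.L 0 ≠ K.L (Fin.succ k) := by
    intro k h
    have h1 := K.L_sum K.v.1
    rw [Fin.sum_univ_succ, h] at h1
    simp [L_succ, X.φ_v] at h1
  intro a b
  refine Fin.cases (Fin.cases (fun _ => rfl) (fun b h => absurd h (h0 b)) b) (fun a => ?_) a
  refine Fin.cases (fun h => absurd h.symm (h0 a)) (fun b h => ?_) b
  exact congrArg Fin.succ (K.κ_inj (X.φ_inj K.v h))

theorem vert_mem (p : Set.extremePoints ℝ P) : ∃ k, p.1 ∈ K.R k := by
  choose z hz using fun k => K.L_lat k (X.lat p)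
  have h0 : ∀ k, 0 ≤ z k := fun k => by
    have := K.L_nonneg k p.2.1
    rw [hz] at this
    exact_mod_cast this
  have h1 : ∑ k, z k = 1 := by
    have := K.L_sum p.1
    simp_rw [hz] at this
    exact_mod_cast this
  have : ∃ k, z k ≠ 0 := by
    by_contra hcon
    push Not at hcon
    simp [hcon] at h1
  obtain ⟨k, hk⟩ := this
  refine ⟨k, p.2.1, fun l hl => ?_⟩
  have h2 : z k + z l ≤ 1 := by
    rw [← h1, ← Finset.add_sum_erase _ _ (Finset.mem_univ k)]
    have := Finset.single_le_sum (f := z) (s := Finset.univ.erase k) (fun i _ => h0 i) (Finset.mem_erase.mpr ⟨hl, Finset.mem_univ l⟩)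
    omega
  have h3 := h0 k
  have h4 := h0 l
  have : z l = 0 := by omega
  rw [hz, this]; simp

def nonL (p : Set.extremePoints ℝ P) (j : Fin n) : Prop := ∀ l, K.L l ≠ X.φ p j

theorem ex_idx {p : Set.extremePoints ℝ P} {k l} (hp : p.1 ∈ K.R k) (hl : l ≠ k) : ∃ j, K.L l = X.φ p j := by
  obtain ⟨q, i, h⟩ := K.isφ l
  rw [h]
  refine X.vanish ?_
  rw [← h]
  exact hp.2 l hl

theorem lin_nonL {p : Set.extremePoints ℝ P} {k l} (hp : p.1 ∈ K.R k) {j} (hj : K.nonL p j) :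
    (K.L l).linear (X.w p j) = 0 := by
  have h : ∀ l, l ≠ k → (K.L l).linear (X.w p j) = 0 := by
    intro l hl
    obtain ⟨i, hi⟩ := K.ex_idx hp hl
    rw [hi, X.φ_w, if_neg]
    rintro rfl
    exact hj l hi
  by_cases hl : l = k
  · have := K.L_lin_sum (X.w p j)
    rw [Finset.sum_eq_single k (fun l _ hl => h l hl) (by simp)] at this
    rw [hl, this]
  · exact h l hl

theorem step_R {p : Set.extremePoints ℝ P} {k} (hp : p.1 ∈ K.R k) {j} (hj : K.nonL p j) : p.1 + X.w p j ∈ K.R k := by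
  refine ⟨X.step_mem p j, fun l hl => ?_⟩
  rw [SD.aff_add, hp.2 l hl, K.lin_nonL hp hj, add_zero]

theorem φ_R {p : Set.extremePoints ℝ P} {k} (hp : p.1 ∈ K.R k) {j} (hj : ¬ K.nonL p j) {x} (hx : x ∈ K.R k) :
    X.φ p j x = 0 := by
  unfold nonL at hj
  push Not at hj
  obtain ⟨l, hl⟩ := hj
  rw [← hl]
  refine hx.2 l ?_
  rintro rfl
  have := K.R_one hp
  rw [hl, X.φ_v] at this
  exact zero_ne_one this

/-- moving between pieces -/
theorem swap {p : Set.extremePoints ℝ P} {k l} (hp : p.1 ∈ K.R k) (hl : l ≠ k) :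
    ∃ q : Set.extremePoints ℝ P, q.1 ∈ K.R l ∧ (∃ a, K.L l = X.φ p a ∧ q.1 = p.1 + X.w p a) ∧
      (∀ j, K.nonL p j → ∃ j', K.nonL q j' ∧ X.w q j' = X.w p j) ∧
      (∀ j', K.nonL q j' → ∃ j, K.nonL p j ∧ X.w q j' = X.w p j) := by
  obtain ⟨a, ha⟩ := K.ex_idx hp hl
  have hval : ∀ l', l' ≠ k → l' ≠ l → K.L l' (X.nb p a).1 = 0 := by
    intro l' h1 h2
    obtain ⟨b, hb⟩ := K.ex_idx hp h1
    rw [hb, X.φ_nb, if_neg]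
    rintro rfl
    exact h2 (K.L_inj (hb.trans ha.symm))
  have hLl : K.L l (X.nb p a).1 = X.c p a := by rw [ha, X.φ_nb, if_pos rfl]
  have hsum := K.L_sum (X.nb p a).1
  rw [← Finset.add_sum_erase _ _ (Finset.mem_univ l), ← Finset.add_sum_erase _ _ (Finset.mem_erase.mpr ⟨Ne.symm hl, Finset.mem_univ k⟩),
    Finset.sum_eq_zero (fun l' h => hval l' (Finset.ne_of_mem_erase h) (Finset.ne_of_mem_erase (Finset.mem_of_mem_erase h))), hLl] at hsum
  have hk0 := K.L_nonneg k (X.nb p a).2.1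
  have hc1 : (1 : ℝ) ≤ X.c p a := by exact_mod_cast X.c_pos p a
  have hLk : K.L k (X.nb p a).1 = 0 := by linarith
  have hc : (X.c p a : ℝ) = 1 := by linarith
  have hq : (X.nb p a).1 ∈ K.R l := by
    refine ⟨(X.nb p a).2.1, fun l' hl' => ?_⟩
    by_cases h : l' = k
    · rw [h, hLk]
    · exact hval l' h hl'
  have hLk' : K.L k = X.φ (X.nb p a) (X.tau p a a) := by
    obtain ⟨b, hb⟩ := K.ex_idx hq (Ne.symm hl)
    obtain ⟨b', rfl⟩ := (X.tau p a).surjective b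
    by_cases h : b' = a
    · rw [hb, h]
    · rw [← X.tau_spec p a b' h] at hb
      have := K.R_one hp
      rw [hb, X.φ_v] at this
      exact absurd this zero_ne_one
  have hw : ∀ j, j ≠ a → K.nonL p j → K.nonL (X.nb p a) (X.tau p a j) ∧ X.w (X.nb p a) (X.tau p a j) = X.w p j := by
    intro j hja hj
    have hn : K.nonL (X.nb p a) (X.tau p a j) := by
      intro l' h
      rw [← X.tau_spec p a j hja] at h
      exact hj l' h
    refine ⟨hn, ?_⟩
    rw [X.lin_expand p (X.w (X.nb p a) (X.tau p a j)), Finset.sum_eq_single j]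
    · rw [X.tau_spec p a j hja, X.φ_w, if_pos rfl, one_smul]
    · intro b _ hb
      by_cases hba : b = a
      · rw [hba, ← ha, K.lin_nonL hq hn, zero_smul]
      · rw [X.tau_spec p a b hba, X.φ_w, if_neg (fun h => hb ((X.tau p a).injective h)), zero_smul]
    · simp
  have hne : ∀ j, K.nonL p j → j ≠ a := by
    rintro j hj rfl
    exact hj l ha
  refine ⟨X.nb p a, hq, ⟨a, ha, ?_⟩, fun j hj => ⟨X.tau p a j, hw j (hne j hj) hj⟩, fun j' hj' => ?_⟩
  · rw [X.nb_val, hc, one_smul]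
  · obtain ⟨j, rfl⟩ := (X.tau p a).surjective j'
    have hja : j ≠ a := by
      rintro rfl
      exact hj' k hLk'
    have hj : K.nonL p j := by
      intro l' h
      rw [X.tau_spec p a j hja] at h
      exact hj' l' h
    exact ⟨j, hj, (hw j hja hj).2⟩

/-- minimal face -/
def Mn (k : Fin (t + 1)) (f : (Fin n → ℝ) →ₗ[ℝ] ℝ) : Set (Fin n → ℝ) := {x ∈ K.R k | ∀ y ∈ K.R k, f x ≤ f y}

theorem Mn_iff {p : Set.extremePoints ℝ P} {k} (hp : p.1 ∈ K.R k) (f : (Fin n → ℝ) →ₗ[ℝ] ℝ) :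
    p.1 ∈ K.Mn k f ↔ ∀ j, K.nonL p j → 0 ≤ f (X.w p j) := by
  constructor
  · intro h j hj
    have := h.2 _ (K.step_R hp hj)
    rw [map_add] at this
    linarith
  · intro h
    refine ⟨hp, fun y hy => ?_⟩
    have : f y = f p.1 + ∑ j, X.φ p j y * f (X.w p j) := by
      conv_lhs => rw [X.expand p y, map_add, map_sum]
      simp
    rw [this]
    have : 0 ≤ ∑ j, X.φ p j y * f (X.w p j) := by
      refine Finset.sum_nonneg fun j _ => ?_
      by_cases hj : K.nonL p j
      · exact mul_nonneg (X.nonneg p j y hy.1) (h j hj)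
      · rw [K.φ_R hp hj hy, zero_mul]
    linarith

theorem R_ne (k) : ∃ p : Set.extremePoints ℝ P, p.1 ∈ K.R k := by
  obtain ⟨k0, h0⟩ := K.vert_mem K.v
  by_cases h : k = k0
  · exact ⟨K.v, h ▸ h0⟩
  · obtain ⟨q, hq, _⟩ := K.swap h0 h
    exact ⟨q, hq⟩

theorem R_face (k) : IsFace P (K.R k) := by
  classical
  obtain ⟨p, hp⟩ := K.R_ne k
  have : K.R k = X.fc p (Finset.univ.filter fun j => ¬ K.nonL p j) := by
    apply Set.Subset.antisymm
    · intro x hx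
      refine ⟨hx.1, fun j hj => K.φ_R hp (Finset.mem_filter.mp hj).2 hx⟩
    · intro x hx
      refine ⟨hx.1, fun l hl => ?_⟩
      obtain ⟨j, hj⟩ := K.ex_idx hp hl
      rw [hj]
      refine hx.2 j (Finset.mem_filter.mpr ⟨Finset.mem_univ j, ?_⟩)
      intro h
      exact h l hj
  rw [this]
  exact X.fc_face _ _

theorem R_conv (k) : Convex ℝ (K.R k) := by
  obtain ⟨_, u, c, h1, h2⟩ := K.R_face k
  rw [h2]
  exact X.conv.inter (convex_hyperplane u.isLinear c)

theorem Mn_conv (k f) : Convex ℝ (K.Mn k f) := by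
  have : K.Mn k f = K.R k ∩ ⋂ y ∈ K.R k, {x | f x ≤ f y} := by
    ext x; simp [Mn]
  rw [this]
  exact (K.R_conv k).inter (convex_iInter₂ fun y _ => convex_halfSpace_le f.isLinear _)

theorem Mn_hull (k f) {x} (hx : x ∈ K.Mn k f) : x ∈ convexHull ℝ (Set.extremePoints ℝ P ∩ K.Mn k f) := by
  have hcomp : IsCompact P := by
    have h := X.fin.isCompact_convexHull ℝ
    rwa [X.hull] at h
  have hf : IsFace (K.R k) (K.Mn k f) := by
    refine ⟨⟨x, hx⟩, f, f x, hx.2, ?_⟩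
    ext y
    refine and_congr_right fun hy => ?_
    constructor
    · intro h; exact le_antisymm (h x hx.1) (hx.2 y hy)
    · intro h z hz; rw [h]; exact hx.2 z hz
  have hMc : IsCompact (K.Mn k f) := by
    obtain ⟨_, u, c, h1, h2⟩ := hf
    obtain ⟨_, u', c', h1', h2'⟩ := K.R_face k
    rw [h2, h2']
    exact (hcomp.inter_right (isClosed_singleton.preimage (LinearMap.continuous_of_finiteDimensional u'))).inter_right
      (isClosed_singleton.preimage (LinearMap.continuous_of_finiteDimensional u))
  have hk := closure_convexHull_extremePoints hMc (K.Mn_conv k f)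
  rw [← hk] at hx
  have hsub : Set.extremePoints ℝ (K.Mn k f) ⊆ Set.extremePoints ℝ P ∩ K.Mn k f :=
    fun y hy => ⟨face_ext (K.R_face k) (face_ext hf hy), hy.1⟩
  have hcl : IsClosed (convexHull ℝ (Set.extremePoints ℝ P ∩ K.Mn k f)) :=
    ((X.fin.subset Set.inter_subset_left).isCompact_convexHull ℝ).isClosed
  exact closure_minimal (convexHull_mono hsub) hcl hx

theorem Mn_sub {k l} (hl : l ≠ k) {f g : (Fin n → ℝ) →ₗ[ℝ] ℝ} (h : K.Mn k f = K.Mn k g) : K.Mn l f ⊆ K.Mn l g := by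
  intro x hx
  refine convexHull_min ?_ (K.Mn_conv l g) (K.Mn_hull l f hx)
  rintro p ⟨hp, hpM⟩
  have hpR := hpM.1
  obtain ⟨q, hq, _, h1, h2⟩ := K.swap (p := ⟨p, hp⟩) hpR (Ne.symm hl)
  have hiff : ∀ f : (Fin n → ℝ) →ₗ[ℝ] ℝ, p ∈ K.Mn l f ↔ q.1 ∈ K.Mn k f := by
    intro f
    rw [K.Mn_iff (p := ⟨p, hp⟩) hpR, K.Mn_iff hq]
    constructor
    · intro h j' hj'
      obtain ⟨j, hj, e⟩ := h2 j' hj'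
      rw [e]; exact h j hj
    · intro h j hj
      obtain ⟨j', hj', e⟩ := h1 j hj
      rw [← e]; exact h j' hj'
  rw [hiff, ← h, ← hiff]
  exact hpM

theorem Mn_eq (k l) {f g : (Fin n → ℝ) →ₗ[ℝ] ℝ} (h : K.Mn k f = K.Mn k g) : K.Mn l f = K.Mn l g := by
  by_cases hl : l = k
  · rw [hl, h]
  · exact Set.Subset.antisymm (K.Mn_sub hl h) (K.Mn_sub hl h.symm)

end Cay
end

noncomputable section
open MeasureTheory Pointwise
set_option linter.unusedSectionVars false
set_option linter.unusedVariables false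
set_option linter.unusedSimpArgs false

theorem int_of {n : ℕ} {P : Set (Fin n → ℝ)} (hc : Convex ℝ P) (hne : (interior P).Nonempty) {y : Fin n → ℝ}
    (h : ∀ f : (Fin n → ℝ) →ₗ[ℝ] ℝ, (∀ x ∈ P, f y ≤ f x) → f = 0) : y ∈ interior P := by
  by_contra hy
  obtain ⟨f, hf⟩ := geometric_hahn_banach_point_open hc.interior isOpen_interior hy
  have h0 := h f.toLinearMap (fun x hx => by
    have hx' : x ∈ closure (interior P) := by
      rw [hc.closure_interior_eq_closure_of_nonempty_interior hne]
      exact subset_closure hx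
    have hcl : IsClosed {x | f y ≤ f x} := isClosed_le continuous_const f.continuous
    exact closure_minimal (fun b hb => (hf b hb).le) hcl hx')
  obtain ⟨b, hb⟩ := hne
  have h1 := hf b hb
  have e : ∀ x, f x = 0 := fun x => by
    have := congrArg (fun g : (Fin n → ℝ) →ₗ[ℝ] ℝ => g x) h0
    simpa using this
  rw [e, e] at h1
  exact lt_irrefl _ h1

namespace Cay
variable {n : ℕ} {P : Set (Fin n → ℝ)} {X : SD P} {t : ℕ} (K : Cay X t)

theorem v_mem : K.v.1 ∈ K.R 0 := by
  refine ⟨X.mem _, fun l => ?_⟩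
  refine Fin.cases (fun h => absurd rfl h) (fun l _ => ?_) l
  rw [L_succ, X.φ_v]

theorem nonL_v {j} (hj : j ∉ Set.range K.κ) : K.nonL K.v j := by
  intro l
  refine Fin.cases (fun h => ?_) (fun l h => ?_) l
  · have := K.R_one K.v_mem
    rw [h, X.φ_v] at this
    exact zero_ne_one this
  · exact hj ⟨l, X.φ_inj K.v h⟩

theorem pt_mem (k) {j} (hj : j ∉ Set.range K.κ) : K.v.1 + X.w K.v (K.κ k) + X.w K.v j ∈ P := by
  obtain ⟨q, hq, ⟨a, ha, hqa⟩, h1, _⟩ := K.swap K.v_mem (l := Fin.succ k) (Fin.succ_ne_zero k)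
  have hak : K.κ k = a := X.φ_inj K.v ha
  obtain ⟨j', _, hj'⟩ := h1 j (K.nonL_v hj)
  rw [hak, ← hqa, ← hj']
  exact X.step_mem q j'

theorem codeg_ge (K : Cay X t) {s : ℕ} (hs : 0 < s) {x : Fin n → ℝ} (hx : x ∈ interior ((s : ℝ) • P)) (hl : IsLatticePt x) : t + 1 ≤ s := by
  have hsr : (0 : ℝ) < s := by exact_mod_cast hs
  have hnn : ∀ k, ∀ y ∈ ((s : ℝ) • P), 0 ≤ (K.L k).linear y + s * K.L k 0 := by
    rintro k _ ⟨p, hp, rfl⟩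
    have h1 := K.L_nonneg k hp
    have h2 := SD.aff_add (K.L k) 0 p
    rw [zero_add] at h2
    have : (K.L k).linear ((s : ℝ) • p) + s * K.L k 0 = s * K.L k p := by rw [map_smul, h2, smul_eq_mul]; ring
    change 0 ≤ (K.L k).linear ((s : ℝ) • p) + s * K.L k 0
    rw [this]; positivity
  have hintg : ∀ k, ∃ z : ℤ, (K.L k).linear x + s * K.L k 0 = z := by
    intro k
    obtain ⟨a, ha⟩ := K.L_lat k hl
    obtain ⟨b, hb⟩ := K.L_lat k (x := (0 : Fin n → ℝ)) lat_zero
    have h2 := SD.aff_add (K.L k) 0 x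
    rw [zero_add, ha, hb] at h2
    refine ⟨a - b + s * b, ?_⟩
    rw [hb]; push_cast; linarith
  choose z hz using hintg
  have hpos : ∀ k, 1 ≤ z k := by
    intro k
    obtain ⟨p, j, hpj⟩ := K.isφ k
    have hw : (K.L k).linear (X.w p j) = 1 := by rw [hpj, X.φ_w, if_pos rfl]
    have hcont : Filter.Tendsto (fun δ : ℝ => x - δ • X.w p j) (nhdsWithin 0 (Set.Ioi 0)) (nhds x) := by
      have : Continuous (fun δ : ℝ => x - δ • X.w p j) := by fun_prop
      have h := this.tendsto 0
      simp only [zero_smul, sub_zero] at h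
      exact h.mono_left nhdsWithin_le_nhds
    have hev := (hcont.eventually (mem_interior_iff_mem_nhds.mp hx)).and self_mem_nhdsWithin
    obtain ⟨δ, h1, h2⟩ := hev.exists
    have h3 := hnn k _ h1
    rw [map_sub, map_smul, hw] at h3
    have h4 : (0 : ℝ) < δ := h2
    have h5 := hz k
    have h6 : (0 : ℝ) < z k := by
      rw [← h5]
      simp only [smul_eq_mul, mul_one] at h3
      linarith
    exact_mod_cast h6
  have hsum : (∑ k, z k : ℤ) = s := by
    have : ∑ k, ((K.L k).linear x + s * K.L k 0) = s := by
      rw [Finset.sum_add_distrib, K.L_lin_sum, ← Finset.mul_sum, K.L_sum]; ring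
    simp_rw [hz] at this
    exact_mod_cast this
  have := Finset.sum_le_sum (s := Finset.univ) (fun k _ => hpos k)
  rw [hsum] at this
  simp at this
  exact_mod_cast this

theorem codeg_le (K : Cay X t) (hfull : affineSpan ℝ P = ⊤) : HasInteriorLatticePt P (t + 1) := by
  classical
  have hcard : Fintype.card (Option {j // j ∉ Set.range K.κ}) ≤ Fintype.card (Fin t) := by
    have h1 : Fintype.card {j // j ∉ Set.range K.κ} = n - t := by
      rw [Fintype.card_subtype_compl]
      have : Fintype.card {j // j ∈ Set.range K.κ} = t := by
        have h := Fintype.card_congr (Equiv.ofInjective K.κ K.κ_inj)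
        rw [Fintype.card_fin] at h
        refine Eq.trans ?_ h.symm
        exact Fintype.card_congr (Equiv.refl _)
      rw [this, Fintype.card_fin]
    rw [Fintype.card_option, h1, Fintype.card_fin]
    have := K.ht
    omega
  obtain ⟨emb⟩ := Function.Embedding.nonempty_of_card_le hcard
  let e : Fin t → Option {j // j ∉ Set.range K.κ} := Function.invFun emb
  have he : Function.Surjective e := Function.invFun_surjective emb.injective
  let g : Option {j // j ∉ Set.range K.κ} → (Fin n → ℝ) := fun o => o.elim 0 fun j => X.w K.v j.1
  have hgl : ∀ o, IsLatticePt (g o) := by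
    rintro (_ | j)
    · exact lat_zero
    · exact X.w_lat _ _
  let m : Fin (t + 1) → (Fin n → ℝ) := Fin.cons K.v.1 fun k => K.v.1 + X.w K.v (K.κ k) + g (e k)
  have hm0 : m 0 = K.v.1 := rfl
  have hms : ∀ k : Fin t, m k.succ = K.v.1 + X.w K.v (K.κ k) + g (e k) := fun _ => rfl
  have hmP : ∀ k, m k ∈ P := by
    refine Fin.cases (X.mem _) fun k => ?_
    rw [hms]
    rcases h : e k with _ | j
    · change _ + 0 ∈ P
      rw [add_zero]; exact X.step_mem _ _
    · exact K.pt_mem k j.2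
  have hml : ∀ k, IsLatticePt (m k) := by
    refine Fin.cases (X.lat _) fun k => ?_
    rw [hms]
    exact lat_add (lat_add (X.lat _) (X.w_lat _ _)) (hgl _)
  have hpos : (0 : ℝ) < ((t + 1 : ℕ) : ℝ) := by positivity
  let y : Fin n → ℝ := (((t + 1 : ℕ) : ℝ))⁻¹ • ∑ k, m k
  have hy : y ∈ interior P := by
    refine int_of X.conv (X.conv.interior_nonempty_iff_affineSpan_eq_top.mpr hfull) fun f hf => ?_
    have hfy : ∑ k, (f (m k) - f y) = 0 := by
      rw [Finset.sum_sub_distrib, ← map_sum]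
      simp only [y, map_smul, smul_eq_mul, Finset.sum_const, Finset.card_univ, Fintype.card_fin, nsmul_eq_mul]
      rw [← mul_assoc, mul_inv_cancel₀ hpos.ne', one_mul, sub_self]
    have hz := (Finset.sum_eq_zero_iff_of_nonneg (fun k _ => sub_nonneg.mpr (hf _ (hmP k)))).mp hfy
    have hk : ∀ k, f (m k) = f y := fun k => sub_eq_zero.mp (hz k (Finset.mem_univ k))
    have hv : f K.v.1 = f y := hk 0
    have hwn : ∀ b, 0 ≤ f (X.w K.v b) := fun b => by
      have := hf _ (X.step_mem K.v b)
      rw [map_add, hv] at this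
      linarith
    have hgn : ∀ o, 0 ≤ f (g o) := by
      rintro (_ | j)
      · change 0 ≤ f 0
        rw [map_zero]
      · exact hwn _
    have hs : ∀ k : Fin t, f (X.w K.v (K.κ k)) + f (g (e k)) = 0 := fun k => by
      have := hk k.succ
      rw [hms, map_add, map_add, hv] at this
      linarith
    have hw0 : ∀ b, f (X.w K.v b) = 0 := by
      intro b
      by_cases hb : b ∈ Set.range K.κ
      · obtain ⟨k, rfl⟩ := hb
        have h1 := hs k
        have h2 := hgn (e k)
        have h3 := hwn (K.κ k)
        linarith
      · obtain ⟨k, hk'⟩ := he (some ⟨b, hb⟩)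
        have h1 := hs k
        have h2 := hgn (e k)
        have h3 := hwn (K.κ k)
        have h4 : f (g (e k)) = 0 := by linarith
        rw [hk'] at h4
        exact h4
    refine LinearMap.ext fun x => ?_
    rw [X.lin_ext K.v f x]
    simp [hw0]
  refine ⟨∑ k, m k, ?_, lat_sum _ _ (fun k _ => hml k)⟩
  rw [interior_smul₀ hpos.ne']
  refine ⟨y, hy, ?_⟩
  change ((t + 1 : ℕ) : ℝ) • y = _
  simp only [y]
  rw [smul_smul, mul_inv_cancel₀ hpos.ne', one_smul]

theorem codeg_eq (K : Cay X t) (hfull : affineSpan ℝ P = ⊤) : t + 1 = codeg P := by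
  have hmem : t + 1 ∈ {t : ℕ | 0 < t ∧ HasInteriorLatticePt P t} := ⟨Nat.succ_pos t, K.codeg_le hfull⟩
  refine le_antisymm (le_csInf ⟨_, hmem⟩ ?_) (Nat.sInf_le hmem)
  rintro s ⟨hs, x, hx, hl⟩
  exact K.codeg_ge hs hx hl

theorem exists_A : ∃ A : Matrix (Fin t) (Fin n) ℤ, ∀ x k, matMap A (x - K.v.1) k = K.L (Fin.succ k) x := by
  choose z hz using fun (k : Fin t) (j : Fin n) => X.lin_int K.v (K.κ k) (y := Pi.single j 1) (fun i => by
    by_cases h : i = j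
    · subst h; exact ⟨1, by simp⟩
    · exact ⟨0, by simp [h]⟩)
  refine ⟨Matrix.of z, fun x k => ?_⟩
  rw [L_succ, X.φ_sub, ← map_sub]
  generalize x - K.v.1 = y
  unfold matMap
  simp only [Matrix.of_apply]
  conv_rhs => rw [pi_eq_sum_univ' y, map_sum]
  refine Finset.sum_congr rfl fun j _ => ?_
  rw [map_smul, smul_eq_mul, mul_comm, ← hz]

theorem back (K : Cay X t) (hfull : affineSpan ℝ P = ⊤) :
    ∃ (t : ℕ) (U : Matrix (Fin n) (Fin n) ℤ) (w : Fin n → ℤ)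
        (A : Matrix (Fin t) (Fin n) ℤ), IsUnit U.det ∧
        IsCayleyWith (unimodMap U w '' P) A ∧
        (∀ k : Fin (t + 1),
          IsSmoothPoly (cayleyPiece A (unimodMap U w '' P) k) ∧
          IsLatticePolytope (cayleyPiece A (unimodMap U w '' P) k)) ∧
        t + 1 = codeg P ∧ (n : ℝ) / 2 < (t : ℝ) := by
  classical
  obtain ⟨z, hz⟩ := lat_cast (X.lat K.v)
  obtain ⟨A, hA⟩ := K.exists_A
  have hQ : unimodMap (1 : Matrix (Fin n) (Fin n) ℤ) (fun i => - z i) '' P = (fun x => x - K.v.1) '' P := by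
    congr 1
    funext x
    funext i
    simp only [unimodMap, hz, Pi.sub_apply]
    rw [Finset.sum_eq_single i (fun j _ h => by simp [Matrix.one_apply_ne (Ne.symm h)]) (by simp)]
    simp [sub_eq_add_neg]
  have hval : ∀ {x k}, x ∈ K.R k → matMap A (x - K.v.1) = stdSimplexVert t k := by
    intro x k hx
    funext j
    rw [hA]
    unfold stdSimplexVert
    split_ifs with h
    · have : k = j.succ := Fin.ext (by simpa using h)
      rw [← this, K.R_one hx]
    · refine hx.2 _ ?_
      rintro rfl
      exact h (by simp)
  have hR : ∀ k, cayleyPiece A ((fun x => x - K.v.1) '' P) k = (fun x => x - K.v.1) '' K.R k := by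
    intro k
    ext y
    constructor
    · rintro ⟨⟨x, hx, rfl⟩, h⟩
      refine ⟨x, ⟨hx, ?_⟩, rfl⟩
      have h1 : ∀ j : Fin t, K.L j.succ x = if (k : ℕ) = (j : ℕ) + 1 then 1 else 0 := by
        intro j
        rw [← hA, h]; rfl
      have h2 := K.L_sum x
      rw [Fin.sum_univ_succ] at h2
      simp_rw [h1] at h2
      intro l
      refine Fin.cases (fun hl => ?_) (fun l hl => ?_) l
      · obtain ⟨k', rfl⟩ := Fin.exists_succ_eq.mpr (Ne.symm hl)
        have : ∑ j : Fin t, (if ((k'.succ : Fin (t+1)) : ℕ) = (j : ℕ) + 1 then (1 : ℝ) else 0) = 1 := by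
          rw [Finset.sum_eq_single k']
          · simp
          · intro j _ hj
            rw [if_neg]
            simp only [Fin.val_succ, add_left_inj]
            exact fun h => hj (Fin.ext h.symm)
          · simp
        rw [this] at h2
        linarith
      · rw [h1, if_neg]
        intro h
        exact hl (Fin.ext (by simpa using h.symm))
    · rintro ⟨x, hx, rfl⟩
      exact ⟨⟨x, hx.1, rfl⟩, hval hx⟩
  have hmin : ∀ k (f : (Fin n → ℝ) →ₗ[ℝ] ℝ), {x ∈ (fun x => x - K.v.1) '' K.R k | ∀ y ∈ (fun x => x - K.v.1) '' K.R k, f x ≤ f y} =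
      (fun x => x - K.v.1) '' K.Mn k f := by
    intro k f
    ext y
    constructor
    · rintro ⟨⟨x, hx, rfl⟩, h⟩
      refine ⟨x, ⟨hx, fun y hy => ?_⟩, rfl⟩
      have := h _ ⟨y, hy, rfl⟩
      simp only [map_sub] at this
      linarith
    · rintro ⟨x, hx, rfl⟩
      refine ⟨⟨x, hx.1, rfl⟩, ?_⟩
      rintro _ ⟨y, hy, rfl⟩
      have := hx.2 y hy
      simp only [map_sub]
      linarith
  have hinj : Function.Injective (fun x : Fin n → ℝ => x - K.v.1) := fun a b h => sub_left_injective h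
  refine ⟨t, 1, fun i => - z i, A, by simp, ?_, ?_, K.codeg_eq hfull, ?_⟩
  · rw [hQ]
    refine ⟨?_, ?_, ?_⟩
    · intro y
      have hl : IsLatticePt (∑ k, (y k : ℝ) • X.w K.v (K.κ k)) := lat_sum _ _ fun k _ => lat_smul (X.w_lat _ _) _
      obtain ⟨x, hx⟩ := lat_cast hl
      refine ⟨x, ?_⟩
      funext k
      have h := hA (K.v.1 + ∑ k, (y k : ℝ) • X.w K.v (K.κ k)) k
      have hsum : (X.φ K.v (K.κ k)).linear (∑ k, (y k : ℝ) • X.w K.v (K.κ k)) = y k := by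
        rw [map_sum, Finset.sum_eq_single k]
        · rw [map_smul, X.φ_w, if_pos rfl, smul_eq_mul, mul_one]
        · intro l _ hl
          rw [map_smul, X.φ_w, if_neg (fun h => hl (K.κ_inj h).symm), smul_zero]
        · simp
      rw [add_sub_cancel_left, L_succ, X.φ_add, hsum, hx] at h
      simp only [matMap] at h
      have h' : (∑ j, A k j * x j : ℤ) = y k := by exact_mod_cast h
      exact h'
    · have hlin : ∃ T : (Fin n → ℝ) →ₗ[ℝ] (Fin t → ℝ), ∀ x, T x = matMap A x := by
        refine ⟨{ toFun := matMap A, map_add' := ?_, map_smul' := ?_ }, fun x => rfl⟩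
        · intro a b
          funext k
          simp [matMap, mul_add, Finset.sum_add_distrib]
        · intro c a
          funext k
          simp only [matMap, Pi.smul_apply, smul_eq_mul, Finset.mul_sum, RingHom.id_apply]
          exact Finset.sum_congr rfl fun j _ => by ring
      obtain ⟨T, hT⟩ := hlin
      have hTf : matMap A = T := funext fun x => (hT x).symm
      have hsub : (fun x => x - K.v.1) = fun x : Fin n → ℝ => x + (-K.v.1) := by funext x; rw [sub_eq_add_neg]
      apply Set.Subset.antisymm
      · rintro _ ⟨_, ⟨x, hx, rfl⟩, rfl⟩
        have hc : Convex ℝ {x : Fin n → ℝ | matMap A (x - K.v.1) ∈ unimodSimplex t} := by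
          have : Convex ℝ (T ⁻¹' unimodSimplex t) := (convex_convexHull ℝ _).linear_preimage T
          have h2 := this.translate_preimage_left (-K.v.1)
          have e : {x : Fin n → ℝ | matMap A (x - K.v.1) ∈ unimodSimplex t} = (fun x => x + -K.v.1) ⁻¹' (T ⁻¹' unimodSimplex t) := by
            refine Set.ext fun x => ?_
            rw [Set.mem_setOf_eq, Set.mem_preimage, Set.mem_preimage, hT, sub_eq_add_neg]
          rw [e]
          exact h2
        rw [← X.hull] at hx
        refine convexHull_min ?_ hc hx
        intro p hp
        obtain ⟨k, hk⟩ := K.vert_mem ⟨p, hp⟩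
        rw [Set.mem_setOf_eq, hval hk]
        exact subset_convexHull ℝ _ ⟨k, rfl⟩
      · refine convexHull_min ?_ ?_
        · rintro _ ⟨k, rfl⟩
          obtain ⟨p, hp⟩ := K.R_ne k
          exact ⟨_, ⟨p.1, X.mem p, rfl⟩, hval hp⟩
        · rw [hTf, hsub]
          have h3 := X.conv
          exact (convex_translate h3 K.v.1).linear_image T
    · intro k l f g
      rw [hR, hR, hmin, hmin, hmin, hmin, Set.image_eq_image hinj, Set.image_eq_image hinj]
      exact ⟨K.Mn_eq k l, K.Mn_eq l k⟩
  · intro k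
    rw [hQ, hR]
    refine ⟨X.face_smooth (K.R_face k) _, ?_⟩
    have hfin : ((fun x => x - K.v.1) '' (Set.extremePoints ℝ P ∩ K.R k)).Finite := (X.fin.subset Set.inter_subset_left).image _
    refine ⟨hfin.toFinset, ?_, ?_⟩
    · intro y hy
      rw [Set.Finite.mem_toFinset] at hy
      obtain ⟨x, ⟨hx, _⟩, rfl⟩ := hy
      exact lat_sub (X.lat ⟨x, hx⟩) (X.lat K.v)
    · rw [Set.Finite.coe_toFinset]
      have h1 : K.R k = convexHull ℝ (Set.extremePoints ℝ P ∩ K.R k) :=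
        Set.Subset.antisymm (X.face_hull (K.R_face k)) (convexHull_min Set.inter_subset_right (K.R_conv k))
      conv_lhs => rw [h1]
      have h2 := AffineMap.image_convexHull (𝕜 := ℝ) (AffineEquiv.vaddConst ℝ (-K.v.1)).toAffineMap (Set.extremePoints ℝ P ∩ K.R k)
      convert h2 using 1
      · congr 1
      · congr 1
  · have := K.ht
    have h : (n : ℝ) < 2 * t := by exact_mod_cast this
    linarith

end Cay

end

/-- A smooth full-dimensional lattice polytope `P ⊆ ℝ^n` is unimodularly
equivalent to a Cayley sum `Cayley(R_0, …, R_t)_π` of normally equivalent smooth lattice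
polytopes with `t + 1 = cd(P)` and `t > n/2` iff
`Σ_F (-1)^{n - dim F} (dim F + 1)! Vol(F) = 0`. -/
theorem stmt10 {n : ℕ} (P : Set (Fin n → ℝ)) (hP : IsLatticePolytope P)
    (hfull : affineSpan ℝ P = ⊤) (hsm : IsSmoothPoly P) :
    (∃ (t : ℕ) (U : Matrix (Fin n) (Fin n) ℤ) (w : Fin n → ℤ)
        (A : Matrix (Fin t) (Fin n) ℤ), IsUnit U.det ∧
        IsCayleyWith (unimodMap U w '' P) A ∧
        (∀ k : Fin (t + 1),
          IsSmoothPoly (cayleyPiece A (unimodMap U w '' P) k) ∧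
          IsLatticePolytope (cayleyPiece A (unimodMap U w '' P) k)) ∧
        t + 1 = codeg P ∧ (n : ℝ) / 2 < (t : ℝ)) ↔
      FaceSumZero P := by
  obtain ⟨X⟩ := SD_exists P hP hfull hsm
  constructor
  · rintro ⟨t, U, w, A, hU, ⟨hsurj, himg, _⟩, _, _, ht⟩
    exact forward X t U w A hU hsurj himg ht
  · intro h
    have hfin : Finite (SD.LP P) := X.lp_finite
    have hft : Fintype (SD.LP P) := Fintype.ofFinite _
    rw [X.faceSumZero_iff] at h
    have hne : P.Nonempty := by
      rw [← affineSpan_nonempty ℝ, hfull]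
      exact ⟨0, trivial⟩
    rw [← X.hull, convexHull_nonempty_iff] at hne
    obtain ⟨v, hv⟩ := hne
    obtain ⟨t, ⟨K⟩⟩ := X.exists_cay ⟨v, hv⟩ (h _)
    exact K.back hfull
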